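/- arXiv:1903.07420 — 2 statements merged into one kernel-verified Lean document; each statement's English description precedes it below -/
import Mathlib

section
/- Let s ∈ ((n−1)/n, 1) and p ∈ [1,∞) with sp > n−1, and let u, u_1, u_2, … ∈ W^{s,p}(Ω;ℝ^n) with ‖u_k − u‖_{W^{s,p}(Ω)} → 0. Then for almost every a ∈ ℝ^n the maps u^a and u_k^a belong to W^{(n−1)/n,n}(Ω;ℝ^n), and for every R > 0, ∫_{B(0,R)} ‖u_k^a − u^a‖_{W^{(n−1)/n,n}(Ω)}^n da → 0 as k → ∞; that is, the functions a ↦ ‖u_k^a − u^a‖_{W^{(n−1)/n,n}(Ω)}^n converge to 0 in L^1_loc(ℝ^n). -/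
open MeasureTheory Metric Filter Topology

noncomputable section

abbrev Euc (n : ℕ) := EuclideanSpace ℝ (Fin n)

/-- The Jacobian matrix `∇u(x)` of a map `u : ℝⁿ → ℝⁿ`, with entries `∂_j u_i (x)`. -/
def jacMat (n : ℕ) (u : Euc n → Euc n) (x : Euc n) : Matrix (Fin n) (Fin n) ℝ :=
  Matrix.of fun i j => fderiv ℝ u x (EuclideanSpace.single j 1) i

/-- The vector field `j u := (1/n) (cof ∇u)ᵀ u` (componentwise); note that
`(cof A)ᵀ = adjugate A`. -/
def jvec (n : ℕ) (u : Euc n → Euc n) (x : Euc n) : Fin n → ℝ :=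
  fun i => (n : ℝ)⁻¹ * Matrix.mulVec (Matrix.adjugate (jacMat n u x)) (fun j => u x j) i

/-- The pointwise pairing `j u (x) · ∇ψ(x)`. -/
def jPair (n : ℕ) (u : Euc n → Euc n) (ψ : Euc n → ℝ) (x : Euc n) : ℝ :=
  ∑ i, jvec n u x i * fderiv ℝ ψ x (EuclideanSpace.single i 1)

/-- `ψ ∈ C¹_c(Ω)`. -/
def Cc1 (n : ℕ) (Ω : Set (Euc n)) (ψ : Euc n → ℝ) : Prop :=
  ContDiff ℝ 1 ψ ∧ HasCompactSupport ψ ∧ tsupport ψ ⊆ Ω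

/-- The fractional Sobolev seminorm `[u]_{W^{s,p}(Ω)}`. -/
def sobSemi (n : ℕ) (s p : ℝ) (Ω : Set (Euc n)) {F : Type*} [NormedAddCommGroup F]
    (u : Euc n → F) : ℝ :=
  (∫ x in Ω, ∫ y in Ω, ‖u x - u y‖ ^ p / dist x y ^ ((n : ℝ) + s * p)) ^ (1 / p)

/-- The fractional Sobolev norm `‖u‖_{W^{s,p}(Ω)} = ‖u‖_{L^p(Ω)} + [u]_{W^{s,p}(Ω)}`. -/
def sobNorm (n : ℕ) (s p : ℝ) (Ω : Set (Euc n)) {F : Type*} [NormedAddCommGroup F]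
    (u : Euc n → F) : ℝ :=
  (∫ x in Ω, ‖u x‖ ^ p) ^ (1 / p) + sobSemi n s p Ω u

/-- Membership `u ∈ W^{s,p}(Ω; F)`: `u ∈ L^p(Ω)` and the double integral defining
`[u]_{W^{s,p}(Ω)}^p` is finite. -/
def MemWsp (n : ℕ) (s p : ℝ) (Ω : Set (Euc n)) {F : Type*} [NormedAddCommGroup F]
    (u : Euc n → F) : Prop :=
  AEStronglyMeasurable u (volume.restrict Ω) ∧
  Integrable (fun x => ‖u x‖ ^ p) (volume.restrict Ω) ∧
  Integrable (fun q : Euc n × Euc n => ‖u q.1 - u q.2‖ ^ p / dist q.1 q.2 ^ ((n : ℝ) + s * p))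
    ((volume.restrict Ω).prod (volume.restrict Ω))

/-- `Ω` has smooth boundary: it is a sublevel set of a smooth function whose
differential does not vanish on the boundary. -/
def SmoothBoundary (n : ℕ) (Ω : Set (Euc n)) : Prop :=
  ∃ f : Euc n → ℝ, ContDiff ℝ (⊤ : ℕ∞) f ∧ Ω = f ⁻¹' Set.Iio 0 ∧
    ∀ x ∈ frontier Ω, fderiv ℝ f x ≠ 0

/-- `u^a(x) = (u(x) - a)/|u(x) - a|`. -/
def proj (n : ℕ) (u : Euc n → Euc n) (a : Euc n) : Euc n → Euc n :=
  fun x => ‖u x - a‖⁻¹ • (u x - a)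

/-- The set of Hölder quotients of `u` on `Ω`. -/
def holderSet (n : ℕ) (α : ℝ) (Ω : Set (Euc n)) {F : Type*} [NormedAddCommGroup F]
    (u : Euc n → F) : Set ℝ :=
  {r | ∃ x ∈ Ω, ∃ y ∈ Ω, x ≠ y ∧ r = ‖u x - u y‖ / dist x y ^ α}

/-- The Hölder seminorm `[u]_{C^{0,α}(Ω)}`. -/
def holderSemi (n : ℕ) (α : ℝ) (Ω : Set (Euc n)) {F : Type*} [NormedAddCommGroup F]
    (u : Euc n → F) : ℝ :=
  sSup (holderSet n α Ω u)

/-- The Hölder norm `‖u‖_{C^{0,α}(Ω)} = sup_Ω ‖u‖ + [u]_{C^{0,α}(Ω)}`. -/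
def holderNorm (n : ℕ) (α : ℝ) (Ω : Set (Euc n)) {F : Type*} [NormedAddCommGroup F]
    (u : Euc n → F) : ℝ :=
  sSup {r | ∃ x ∈ Ω, r = ‖u x‖} + holderSemi n α Ω u

/-- the volume `ω_n` of the unit ball of `ℝⁿ`. -/
def ballVol (n : ℕ) : ℝ := (volume (ball (0 : Euc n) 1)).toReal

/-- `⟨Jv, ψ⟩ = J` for `v ∈ W^{(n-1)/n, n}(Ω; ℝⁿ)`: approximating sequences of maps which are
`C¹` up to the boundary exist, and for every such sequence the Jacobian integrals converge
to `J`. -/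
def JPairing (n : ℕ) (Ω : Set (Euc n)) (v : Euc n → Euc n) (ψ : Euc n → ℝ) (J : ℝ) : Prop :=
  (∃ vk : ℕ → Euc n → Euc n, (∀ k, ContDiffOn ℝ 1 (vk k) (closure Ω)) ∧
      Tendsto (fun k => sobNorm n (((n : ℝ) - 1) / n) n Ω (vk k - v)) atTop (𝓝 0) ∧
      Tendsto (fun k => ∫ x in Ω, (jacMat n (vk k) x).det * ψ x) atTop (𝓝 J)) ∧
  (∀ vk : ℕ → Euc n → Euc n, (∀ k, ContDiffOn ℝ 1 (vk k) (closure Ω)) →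
      Tendsto (fun k => sobNorm n (((n : ℝ) - 1) / n) n Ω (vk k - v)) atTop (𝓝 0) →
      Tendsto (fun k => ∫ x in Ω, (jacMat n (vk k) x).det * ψ x) atTop (𝓝 J))

/-- The set of values `⟨Jv, ψ⟩` over test functions `ψ ∈ C¹_c(Ω)` with `|ψ| ≤ 1`;
its supremum is the total variation `|Jv|_{TV}`. -/
def TVset (n : ℕ) (Ω : Set (Euc n)) (v : Euc n → Euc n) : Set ℝ :=
  {r | ∃ ψ : Euc n → ℝ, Cc1 n Ω ψ ∧ (∀ x, |ψ x| ≤ 1) ∧ JPairing n Ω v ψ r}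

/-- `⟨Jv, ψ⟩ = -∫_Ω j v · ∇ψ` for (pointwise defined) `v`. -/
def jpairOn (n : ℕ) (Ω : Set (Euc n)) (v : Euc n → Euc n) (ψ : Euc n → ℝ) : ℝ :=
  -∫ x in Ω, jPair n v ψ x

/-- The `W^{-1,1}(Ω)` distance between two functionals on test functions:
`sup { S ψ - T ψ : ψ ∈ C¹_c(Ω), Lip ψ ≤ 1 }`. -/
def Wm11dist (n : ℕ) (Ω : Set (Euc n)) (S T : (Euc n → ℝ) → ℝ) : ℝ :=
  sSup {r | ∃ ψ : Euc n → ℝ, Cc1 n Ω ψ ∧ LipschitzWith 1 ψ ∧ r = S ψ - T ψ}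


open scoped ENNReal NNReal

lemma aux_int_ball (n : ℕ) (hn : 2 ≤ n) (b r : ℝ) (hb : b < n) :
    ∫⁻ z in ball (0 : Euc n) r, ENNReal.ofReal (‖z‖ ^ (-b)) < ⊤ := by
  have : Nonempty (Fin n) := ⟨⟨0, by omega⟩⟩
  have h : IntegrableOn (fun z : Euc n => ‖z‖ ^ (-b)) (ball 0 r) volume := by
    rw [integrableOn_fun_norm_addHaar (volume : Measure (Euc n)) (f := fun t => t ^ (-b))]
    rcases le_or_gt r 0 with hr | hr
    · simp [Set.Ioo_eq_empty (not_lt.mpr hr)]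
    have h2 : IntegrableOn (fun y : ℝ => y ^ ((n : ℝ) - 1 - b)) (Set.Ioo 0 r) := by
      rw [intervalIntegral.integrableOn_Ioo_rpow_iff hr]; linarith
    refine h2.congr_fun (fun y hy => ?_) measurableSet_Ioo
    have hy0 : 0 < y := hy.1
    simp only [finrank_euclideanSpace, Fintype.card_fin, smul_eq_mul]
    rw [← Real.rpow_natCast, ← Real.rpow_add hy0, Nat.cast_sub (by omega)]
    congr 1
    push_cast; ring
  have := h.2
  rw [hasFiniteIntegral_iff_ofReal (Filter.Eventually.of_forall fun z => by positivity)] at this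
  exact this

lemma aux_transl (n : ℕ) (b r : ℝ) (x : Euc n) :
    ∫⁻ a in ball x r, ENNReal.ofReal (‖x - a‖ ^ (-b)) =
      ∫⁻ z in ball (0 : Euc n) r, ENNReal.ofReal (‖z‖ ^ (-b)) := by
  rw [← lintegral_indicator measurableSet_ball, ← lintegral_indicator measurableSet_ball,
    ← lintegral_sub_left_eq_self _ x]
  congr 1
  ext a
  have e1 : x - a - x = -a := by abel
  simp only [Set.indicator, mem_ball, dist_eq_norm, sub_zero, e1, norm_neg, sub_sub_cancel]

lemma aux_ball_unif (n : ℕ) (hn : 2 ≤ n) (b r : ℝ) (hb : b < n) (hb0 : 0 ≤ b) :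
    ∃ C : ℝ≥0∞, C ≠ ⊤ ∧ ∀ x : Euc n,
      ∫⁻ a in ball (0 : Euc n) r, ENNReal.ofReal (‖x - a‖ ^ (-b)) ≤ C := by
  refine ⟨(∫⁻ z in ball (0 : Euc n) 1, ENNReal.ofReal (‖z‖ ^ (-b))) +
    volume (ball (0 : Euc n) r), ?_, fun x => ?_⟩
  · exact ENNReal.add_ne_top.mpr ⟨(aux_int_ball n hn b 1 hb).ne, measure_ball_lt_top.ne⟩
  · rw [← aux_transl n b 1 x, ← setLIntegral_one (ball (0 : Euc n) r),
      ← lintegral_indicator measurableSet_ball, ← lintegral_indicator measurableSet_ball,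
      ← lintegral_indicator measurableSet_ball, ← lintegral_add_right]
    · refine lintegral_mono fun a => ?_
      by_cases h1 : a ∈ ball (0 : Euc n) r
      · by_cases h2 : a ∈ ball x 1
        · simp [Set.indicator, h1, h2]
        · simp only [Set.indicator, h1, h2, if_true, if_false, zero_add]
          rw [ENNReal.ofReal_le_one]
          apply Real.rpow_le_one_of_one_le_of_nonpos _ (by linarith)
          rw [mem_ball, dist_comm, dist_eq_norm, not_lt] at h2
          exact h2
      · simp [Set.indicator, h1]
    · exact measurable_const.indicator measurableSet_ball

lemma aux_kernel (n : ℕ) (hn : 2 ≤ n) (Ω : Set (Euc n))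
    (hΩb : Bornology.IsBounded Ω) (b : ℝ) (hb : b < n) :
    ∫⁻ q : Euc n × Euc n, ENNReal.ofReal (dist q.1 q.2 ^ (-b))
      ∂((volume.restrict Ω).prod (volume.restrict Ω)) < ⊤ := by
  obtain ⟨R, hR⟩ := hΩb.subset_ball (0 : Euc n)
  have hm : Measurable fun q : Euc n × Euc n => ENNReal.ofReal (dist q.1 q.2 ^ (-b)) := by
    fun_prop
  have hle : (volume.restrict Ω).prod (volume.restrict Ω) ≤
      (volume.restrict (ball (0 : Euc n) R)).prod (volume.restrict (ball (0 : Euc n) R)) := by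
    rw [Measure.prod_restrict, Measure.prod_restrict]
    exact Measure.restrict_mono (Set.prod_mono hR hR) le_rfl
  refine (lintegral_mono' hle le_rfl).trans_lt ?_
  rw [lintegral_prod _ hm.aemeasurable]
  calc _ ≤ ∫⁻ x in ball (0 : Euc n) R,
        (∫⁻ z in ball (0 : Euc n) (2 * R), ENNReal.ofReal (‖z‖ ^ (-b))) := by
        refine setLIntegral_mono' measurableSet_ball fun x hx => ?_
        rw [← aux_transl n b (2 * R) x]
        simp only [dist_eq_norm]
        refine lintegral_mono' (Measure.restrict_mono (fun y hy => ?_) le_rfl) le_rfl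
        rw [mem_ball] at *
        calc dist y x ≤ dist y 0 + dist x 0 := dist_triangle_right _ _ _
          _ < 2 * R := by linarith
    _ < ⊤ := by
        rw [lintegral_const]
        refine ENNReal.mul_lt_top (aux_int_ball n hn b _ hb) ?_
        simp [measure_ball_lt_top]

/-- the pointwise projection -/
def Pr (n : ℕ) (X a : Euc n) : Euc n := ‖X - a‖⁻¹ • (X - a)

lemma Pr_norm_le (n : ℕ) (X a : Euc n) : ‖Pr n X a‖ ≤ 1 := by
  unfold Pr
  rw [norm_smul, norm_inv, norm_norm]
  exact inv_mul_le_one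

lemma Pr_sub_le (n : ℕ) (X Y a : Euc n) (h : X ≠ a) :
    ‖Pr n X a - Pr n Y a‖ ≤ 2 * (‖X - Y‖ / ‖X - a‖) := by
  have hv : 0 < ‖X - a‖ := norm_pos_iff.mpr (sub_ne_zero.mpr h)
  have e : Pr n X a - Pr n Y a =
      ‖X - a‖⁻¹ • (X - Y) + (‖X - a‖⁻¹ - ‖Y - a‖⁻¹) • (Y - a) := by
    unfold Pr
    generalize ‖X - a‖⁻¹ = c
    generalize ‖Y - a‖⁻¹ = c'
    module
  have h2 : ‖(‖X - a‖⁻¹ - ‖Y - a‖⁻¹) • (Y - a)‖ ≤ ‖X - Y‖ / ‖X - a‖ := by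
    rw [norm_smul]
    rcases eq_or_ne Y a with rfl | hY
    · simp; positivity
    have hw : 0 < ‖Y - a‖ := norm_pos_iff.mpr (sub_ne_zero.mpr hY)
    have : ‖X - a‖⁻¹ - ‖Y - a‖⁻¹ = (‖Y - a‖ - ‖X - a‖) / (‖X - a‖ * ‖Y - a‖) := by
      field_simp
    rw [this, Real.norm_eq_abs, abs_div, abs_of_pos (mul_pos hv hw)]
    have h3 : |‖Y - a‖ - ‖X - a‖| ≤ ‖X - Y‖ := by
      refine (abs_norm_sub_norm_le _ _).trans ?_
      rw [norm_sub_rev X Y]; simp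
    calc _ = |‖Y - a‖ - ‖X - a‖| / ‖X - a‖ := by field_simp
      _ ≤ _ := by gcongr
  rw [e]
  refine (norm_add_le _ _).trans ?_
  rw [norm_smul, norm_inv, norm_norm, inv_mul_eq_div]
  linarith

lemma Pr_pow_le (n : ℕ) (q : ℝ) (hq : 0 < q) (hqn : q < n) (X Y a : Euc n) (h : X ≠ a) :
    ‖Pr n X a - Pr n Y a‖ ^ (n : ℝ) ≤ 2 ^ n * (‖X - Y‖ ^ q * ‖X - a‖ ^ (-q)) := by
  set r := ‖Pr n X a - Pr n Y a‖ / 2 with hr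
  have hr0 : 0 ≤ r := by positivity
  have hv : 0 < ‖X - a‖ := norm_pos_iff.mpr (sub_ne_zero.mpr h)
  have h1 : r ≤ 1 := by
    have := norm_sub_le (Pr n X a) (Pr n Y a)
    have := Pr_norm_le n X a
    have := Pr_norm_le n Y a
    rw [hr]; linarith
  have h2 : r ≤ ‖X - Y‖ / ‖X - a‖ := by
    have := Pr_sub_le n X Y a h
    rw [hr]; linarith
  have e : ‖Pr n X a - Pr n Y a‖ = 2 * r := by rw [hr]; ring
  rw [e, Real.mul_rpow (by norm_num) hr0, Real.rpow_natCast 2 n]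
  gcongr
  calc r ^ (n : ℝ) ≤ r ^ q := by
        rcases hr0.eq_or_lt with h0 | h0
        · rw [← h0, Real.zero_rpow (by linarith), Real.zero_rpow (by linarith)]
        · exact Real.rpow_le_rpow_of_exponent_ge h0 h1 hqn.le
    _ ≤ (‖X - Y‖ / ‖X - a‖) ^ q := Real.rpow_le_rpow hr0 h2 hq.le
    _ = _ := by
        rw [Real.div_rpow (norm_nonneg _) hv.le, Real.rpow_neg hv.le, div_eq_mul_inv]

lemma Pr_lint (n : ℕ) (hn : 2 ≤ n) (q R : ℝ) (hq : 0 < q) (hqn : q < n) :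
    ∃ C : ℝ≥0∞, C ≠ ⊤ ∧ ∀ X Y : Euc n,
      ∫⁻ a in ball (0 : Euc n) R, ENNReal.ofReal (‖Pr n X a - Pr n Y a‖ ^ (n : ℝ)) ≤
        C * ENNReal.ofReal (‖X - Y‖ ^ q) := by
  have : Nonempty (Fin n) := ⟨⟨0, by omega⟩⟩
  obtain ⟨C, hC, hCx⟩ := aux_ball_unif n hn q R hqn hq.le
  refine ⟨ENNReal.ofReal (2 ^ n) * C, ENNReal.mul_ne_top (by simp) hC, fun X Y => ?_⟩
  calc _ ≤ ∫⁻ a in ball (0 : Euc n) R, (ENNReal.ofReal (2 ^ n) * ENNReal.ofReal (‖X - Y‖ ^ q)) *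
        ENNReal.ofReal (‖X - a‖ ^ (-q)) := by
        refine lintegral_mono_ae ?_
        have : ∀ᵐ a ∂(volume.restrict (ball (0 : Euc n) R)), a ≠ X :=
          ae_restrict_of_ae (by simp [ae_iff])
        filter_upwards [this] with a ha
        rw [← ENNReal.ofReal_mul (by positivity), ← ENNReal.ofReal_mul (by positivity)]
        apply ENNReal.ofReal_le_ofReal
        rw [mul_assoc]
        exact Pr_pow_le n q hq hqn X Y a ha.symm
    _ ≤ _ := by
        rw [lintegral_const_mul' _ _ (ENNReal.mul_ne_top (by simp) (by simp))]
        calc _ ≤ (ENNReal.ofReal (2 ^ n) * ENNReal.ofReal (‖X - Y‖ ^ q)) * C := by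
              gcongr; exact hCx X
          _ = _ := by ring

lemma aux_rpow_add (x y p : ℝ) (hx : 0 ≤ x) (hy : 0 ≤ y) (hp : 0 ≤ p) :
    (x + y) ^ p ≤ 2 ^ p * (x ^ p + y ^ p) := by
  have hx' := Real.rpow_nonneg hx p
  have hy' := Real.rpow_nonneg hy p
  rcases le_total x y with h | h
  · calc (x + y) ^ p ≤ (2 * y) ^ p := Real.rpow_le_rpow (by positivity) (by linarith) hp
      _ = 2 ^ p * y ^ p := Real.mul_rpow (by norm_num) hy
      _ ≤ _ := by gcongr; linarith
  · calc (x + y) ^ p ≤ (2 * x) ^ p := Real.rpow_le_rpow (by positivity) (by linarith) hp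
      _ = 2 ^ p * x ^ p := Real.mul_rpow (by norm_num) hx
      _ ≤ _ := by gcongr; linarith

lemma aux_rpow_le {E : Type*} [NormedAddCommGroup E] (w x y : E) (p : ℝ) (hp : 0 ≤ p)
    (h : ‖w‖ ≤ ‖x‖ + ‖y‖) :
    ‖w‖ ^ p ≤ 2 ^ p * (‖x‖ ^ p + ‖y‖ ^ p) :=
  (Real.rpow_le_rpow (norm_nonneg _) h hp).trans
    (aux_rpow_add _ _ p (norm_nonneg _) (norm_nonneg _) hp)

lemma aux_split0 (A δ q p : ℝ) (hA : 0 ≤ A) (hδ : 0 < δ) (hq : 0 < q) (hqp : q < p) :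
    A ^ q ≤ δ ^ (q - p) * A ^ p + δ ^ q := by
  rcases le_total A δ with h | h
  · have h1 : A ^ q ≤ δ ^ q := Real.rpow_le_rpow hA h hq.le
    have : 0 ≤ δ ^ (q - p) * A ^ p := by positivity
    linarith
  · have hA0 : 0 < A := hδ.trans_le h
    have h1 : A ^ (q - p) ≤ δ ^ (q - p) :=
      Real.rpow_le_rpow_of_nonpos hδ h (by linarith)
    have h2 : A ^ q = A ^ (q - p) * A ^ p := by
      rw [← Real.rpow_add hA0]; congr 1; ring
    have h3 : 0 ≤ δ ^ q := by positivity
    have h4 : A ^ (q - p) * A ^ p ≤ δ ^ (q - p) * A ^ p := by gcongr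
    linarith

lemma aux_split (A d δ q p e e' : ℝ) (hA : 0 ≤ A) (hd : 0 ≤ d) (hd0 : d = 0 → A = 0)
    (hδ : 0 < δ) (hq : 0 < q) (hqp : q < p) :
    A ^ q / d ^ e ≤ δ ^ (q - p) * (A ^ p / d ^ e') +
      δ ^ q * d ^ (-(e - (e' - e) / (p - q) * q)) := by
  rcases hd.eq_or_lt with h | h
  · rw [hd0 h.symm, Real.zero_rpow hq.ne', zero_div]; positivity
  · set t := (e' - e) / (p - q) with ht
    have htt : t * (p - q) = e' - e := by rw [ht]; field_simp [sub_ne_zero.mpr hqp.ne']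
    have h1 := aux_split0 A (δ * d ^ t) q p hA (by positivity) hq hqp
    have h2 : A ^ q / d ^ e ≤ ((δ * d ^ t) ^ (q - p) * A ^ p + (δ * d ^ t) ^ q) / d ^ e := by
      gcongr
    refine h2.trans (le_of_eq ?_)
    rw [Real.mul_rpow hδ.le (by positivity), Real.mul_rpow hδ.le (by positivity),
      ← Real.rpow_mul h.le, ← Real.rpow_mul h.le, add_div]
    congr 1
    · have : d ^ (t * (q - p)) / d ^ e = (d ^ e')⁻¹ := by
        rw [← Real.rpow_sub h, ← Real.rpow_neg h.le]; congr 1; linarith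
      rw [div_eq_mul_inv (A ^ p), ← this]; ring
    · rw [mul_div_assoc, ← Real.rpow_sub h]; congr 2; ring

lemma aux_squeeze (L B S c : ℕ → ℝ≥0∞) (hS : Tendsto S atTop (𝓝 0))
    (hB : Tendsto B atTop (𝓝 0)) (hc : ∀ j, c j ≠ ⊤) (h : ∀ j k, L k ≤ S j + c j * B k) :
    Tendsto L atTop (𝓝 0) := by
  rw [ENNReal.tendsto_nhds_zero] at *
  intro ε hε
  obtain ⟨j, hj⟩ := (hS (ε / 2) (ENNReal.half_pos hε.ne')).exists
  have h1 : Tendsto (fun k => c j * B k) atTop (𝓝 (c j * 0)) :=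
    ENNReal.Tendsto.const_mul (ENNReal.tendsto_nhds_zero.mpr hB) (Or.inr (hc j))
  rw [mul_zero, ENNReal.tendsto_nhds_zero] at h1
  filter_upwards [h1 (ε / 2) (ENNReal.half_pos hε.ne')] with k hk
  calc L k ≤ S j + c j * B k := h j k
    _ ≤ ε / 2 + ε / 2 := add_le_add hj hk
    _ = ε := ENNReal.add_halves ε

/-- Gagliardo integrand -/
def kin (n : ℕ) (w : Euc n → Euc n) (q e : ℝ) (z : Euc n × Euc n) : ℝ≥0∞ :=
  ENNReal.ofReal (‖w z.1 - w z.2‖ ^ q / dist z.1 z.2 ^ e)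

lemma aux_interp (n : ℕ) (μ : Measure (Euc n × Euc n)) (w : Euc n → Euc n) (δ q p e e' : ℝ)
    (hδ : 0 < δ) (hq : 0 < q) (hqp : q < p) :
    ∫⁻ z, kin n w q e z ∂μ ≤ ENNReal.ofReal (δ ^ q) *
        (∫⁻ z : Euc n × Euc n,
          ENNReal.ofReal (dist z.1 z.2 ^ (-(e - (e' - e) / (p - q) * q))) ∂μ) +
      ENNReal.ofReal (δ ^ (q - p)) * ∫⁻ z, kin n w p e' z ∂μ := by
  rw [← lintegral_const_mul' _ _ ENNReal.ofReal_ne_top,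
    ← lintegral_const_mul' _ _ ENNReal.ofReal_ne_top, ← lintegral_add_left (by fun_prop)]
  refine lintegral_mono fun z => ?_
  unfold kin
  rw [← ENNReal.ofReal_mul (by positivity), ← ENNReal.ofReal_mul (by positivity),
    ← ENNReal.ofReal_add (by positivity) (by positivity)]
  apply ENNReal.ofReal_le_ofReal
  rw [add_comm]
  refine aux_split _ _ δ q p e e' (norm_nonneg _) dist_nonneg (fun h => ?_) hδ hq hqp
  rw [dist_eq_zero.mp h]; simp

lemma aux_interp0 (n : ℕ) (μ : Measure (Euc n)) (w : Euc n → Euc n) (δ q p : ℝ)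
    (hδ : 0 < δ) (hq : 0 < q) (hqp : q < p) :
    ∫⁻ x, ENNReal.ofReal (‖w x‖ ^ q) ∂μ ≤ ENNReal.ofReal (δ ^ q) * μ Set.univ +
      ENNReal.ofReal (δ ^ (q - p)) * ∫⁻ x, ENNReal.ofReal (‖w x‖ ^ p) ∂μ := by
  rw [← lintegral_const, ← lintegral_const_mul' _ _ ENNReal.ofReal_ne_top,
    ← lintegral_add_left (by fun_prop)]
  refine lintegral_mono fun z => ?_
  rw [← ENNReal.ofReal_mul (by positivity),
    ← ENNReal.ofReal_add (by positivity) (by positivity)]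
  apply ENNReal.ofReal_le_ofReal
  rw [add_comm]
  exact aux_split0 _ δ q p (norm_nonneg _) hδ hq hqp

lemma aux_deltas (q : ℝ) (hq : 0 < q) (C : ℝ≥0∞) (hC : C ≠ ⊤) :
    Tendsto (fun j : ℕ => ENNReal.ofReal ((1 / ((j : ℝ) + 1)) ^ q) * C) atTop (𝓝 0) := by
  have h1 : Tendsto (fun j : ℕ => (1 / ((j : ℝ) + 1)) ^ q) atTop (𝓝 (0 ^ q)) :=
    (tendsto_one_div_add_atTop_nhds_zero_nat (𝕜 := ℝ)).rpow_const (Or.inr hq.le)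
  rw [Real.zero_rpow hq.ne'] at h1
  have h2 := ENNReal.tendsto_ofReal h1
  have h3 := ENNReal.Tendsto.mul_const h2 (b := C) (Or.inr hC)
  simpa using h3

lemma aux_tend (n : ℕ) (μ : Measure (Euc n × Euc n)) (w : ℕ → Euc n → Euc n) (q p e e' : ℝ)
    (hq : 0 < q) (hqp : q < p)
    (hfin : ∫⁻ z : Euc n × Euc n,
          ENNReal.ofReal (dist z.1 z.2 ^ (-(e - (e' - e) / (p - q) * q))) ∂μ < ⊤)
    (h : Tendsto (fun k => ∫⁻ z, kin n (w k) p e' z ∂μ) atTop (𝓝 0)) :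
    Tendsto (fun k => ∫⁻ z, kin n (w k) q e z ∂μ) atTop (𝓝 0) :=
  aux_squeeze _ _ _ (fun j : ℕ => ENNReal.ofReal ((1 / ((j : ℝ) + 1)) ^ (q - p)))
    (aux_deltas q hq _ hfin.ne) h (fun _ => ENNReal.ofReal_ne_top)
    (fun j k => aux_interp n μ (w k) _ q p e e' (by positivity) hq hqp)

lemma aux_tend0 (n : ℕ) (μ : Measure (Euc n)) [IsFiniteMeasure μ] (w : ℕ → Euc n → Euc n)
    (q p : ℝ) (hq : 0 < q) (hqp : q < p)
    (h : Tendsto (fun k => ∫⁻ x, ENNReal.ofReal (‖w k x‖ ^ p) ∂μ) atTop (𝓝 0)) :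
    Tendsto (fun k => ∫⁻ x, ENNReal.ofReal (‖w k x‖ ^ q) ∂μ) atTop (𝓝 0) :=
  aux_squeeze _ _ _ (fun j : ℕ => ENNReal.ofReal ((1 / ((j : ℝ) + 1)) ^ (q - p)))
    (aux_deltas q hq _ (measure_ne_top μ _)) h (fun _ => ENNReal.ofReal_ne_top)
    (fun j k => aux_interp0 n μ (w k) _ q p (by positivity) hq hqp)

lemma Pr_meas (n : ℕ) : Measurable fun q : Euc n × Euc n => Pr n q.1 q.2 := by
  unfold Pr; fun_prop

lemma Pr_meas_right (n : ℕ) (X : Euc n) : Measurable fun a : Euc n => Pr n X a := by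
  unfold Pr; fun_prop

lemma Pr_four (n : ℕ) (q R : ℝ) (C : ℝ≥0∞)
    (hC : ∀ X Y : Euc n,
      ∫⁻ a in ball (0 : Euc n) R, ENNReal.ofReal (‖Pr n X a - Pr n Y a‖ ^ (n : ℝ)) ≤
        C * ENNReal.ofReal (‖X - Y‖ ^ q)) (X Y X' Y' : Euc n) :
    ∫⁻ a in ball (0 : Euc n) R,
      ENNReal.ofReal (‖(Pr n X a - Pr n Y a) - (Pr n X' a - Pr n Y' a)‖ ^ (n : ℝ)) ≤
      ENNReal.ofReal (2 ^ (n : ℝ)) * C *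
        (ENNReal.ofReal (‖X - Y‖ ^ q + ‖X' - Y'‖ ^ q)) := by
  have m1 := Pr_meas_right n X
  have m2 := Pr_meas_right n Y
  calc _ ≤ ∫⁻ a in ball (0 : Euc n) R, ENNReal.ofReal (2 ^ (n : ℝ)) *
        (ENNReal.ofReal (‖Pr n X a - Pr n Y a‖ ^ (n : ℝ)) +
          ENNReal.ofReal (‖Pr n X' a - Pr n Y' a‖ ^ (n : ℝ))) := by
        refine lintegral_mono fun a => ?_
        rw [← ENNReal.ofReal_add (by positivity) (by positivity),
          ← ENNReal.ofReal_mul (by positivity)]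
        exact ENNReal.ofReal_le_ofReal
          (aux_rpow_le _ _ _ _ (Nat.cast_nonneg n) (norm_sub_le _ _))
    _ = ENNReal.ofReal (2 ^ (n : ℝ)) *
        ((∫⁻ a in ball (0 : Euc n) R, ENNReal.ofReal (‖Pr n X a - Pr n Y a‖ ^ (n : ℝ))) +
        ∫⁻ a in ball (0 : Euc n) R, ENNReal.ofReal (‖Pr n X' a - Pr n Y' a‖ ^ (n : ℝ))) := by
        rw [lintegral_const_mul' _ _ ENNReal.ofReal_ne_top, lintegral_add_left (by fun_prop)]
    _ ≤ ENNReal.ofReal (2 ^ (n : ℝ)) *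
        (C * ENNReal.ofReal (‖X - Y‖ ^ q) + C * ENNReal.ofReal (‖X' - Y'‖ ^ q)) := by
        gcongr
        · exact hC _ _
        · exact hC _ _
    _ = _ := by
        rw [ENNReal.ofReal_add (by positivity) (by positivity)]; ring

lemma Pr_pt (n : ℕ) (q R e δ : ℝ) (hq : 0 < q) (he : 0 ≤ e) (hδ : 0 < δ) (C : ℝ≥0∞)
    (hC : ∀ X Y : Euc n,
      ∫⁻ a in ball (0 : Euc n) R, ENNReal.ofReal (‖Pr n X a - Pr n Y a‖ ^ (n : ℝ)) ≤
        C * ENNReal.ofReal (‖X - Y‖ ^ q)) (u v : Euc n → Euc n) (z : Euc n × Euc n) :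
    ∫⁻ a in ball (0 : Euc n) R,
      ENNReal.ofReal (‖(Pr n (v z.1) a - Pr n (u z.1) a) - (Pr n (v z.2) a - Pr n (u z.2) a)‖
        ^ (n : ℝ) / dist z.1 z.2 ^ e) ≤
      ENNReal.ofReal (2 ^ (n : ℝ)) * C * ENNReal.ofReal (2 ^ q + 1) *
        (kin n (v - u) q e z + {z | dist z.1 z.2 < δ}.indicator (kin n u q e) z +
          ENNReal.ofReal (δ ^ (-e)) * (ENNReal.ofReal (‖(v - u) z.1‖ ^ q) +
            ENNReal.ofReal (‖(v - u) z.2‖ ^ q))) := by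
  have hd : 0 ≤ dist z.1 z.2 := dist_nonneg
  simp only [div_eq_mul_inv]
  have e1 : ∀ t : ℝ, 0 ≤ t → ENNReal.ofReal (t * (dist z.1 z.2 ^ e)⁻¹) =
      ENNReal.ofReal t * ENNReal.ofReal ((dist z.1 z.2 ^ e)⁻¹) :=
    fun t ht => ENNReal.ofReal_mul ht
  rw [lintegral_congr (fun a => e1 _ (by positivity)),
    lintegral_mul_const' _ _ ENNReal.ofReal_ne_top]
  by_cases h : dist z.1 z.2 < δ
  · have e2 : ∀ a, (Pr n (v z.1) a - Pr n (u z.1) a) - (Pr n (v z.2) a - Pr n (u z.2) a) =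
        (Pr n (v z.1) a - Pr n (v z.2) a) - (Pr n (u z.1) a - Pr n (u z.2) a) := fun a => by abel
    simp only [e2]
    have h4 := Pr_four n q R C hC (v z.1) (v z.2) (u z.1) (u z.2)
    have h5 : ‖v z.1 - v z.2‖ ^ q + ‖u z.1 - u z.2‖ ^ q ≤ (2 ^ q + 1) *
        (‖(v - u) z.1 - (v - u) z.2‖ ^ q + ‖u z.1 - u z.2‖ ^ q) := by
      have h6 : ‖v z.1 - v z.2‖ ≤ ‖(v - u) z.1 - (v - u) z.2‖ + ‖u z.1 - u z.2‖ := by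
        have : v z.1 - v z.2 = ((v - u) z.1 - (v - u) z.2) + (u z.1 - u z.2) := by
          simp only [Pi.sub_apply]; abel
        rw [this]; exact norm_add_le _ _
      have h7 := aux_rpow_le _ _ _ q hq.le h6
      have h8 : 0 ≤ ‖(v - u) z.1 - (v - u) z.2‖ ^ q := by positivity
      linarith
    calc _ ≤ (ENNReal.ofReal (2 ^ (n : ℝ)) * C * (ENNReal.ofReal ((2 ^ q + 1) *
        (‖(v - u) z.1 - (v - u) z.2‖ ^ q + ‖u z.1 - u z.2‖ ^ q)))) *
          ENNReal.ofReal ((dist z.1 z.2 ^ e)⁻¹) := by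
          gcongr
          exact h4.trans (by gcongr)
      _ = ENNReal.ofReal (2 ^ (n : ℝ)) * C * ENNReal.ofReal (2 ^ q + 1) *
        (kin n (v - u) q e z + kin n u q e z) := by
          unfold kin
          rw [ENNReal.ofReal_mul (by positivity),
            ENNReal.ofReal_add (p := ‖(v - u) z.1 - (v - u) z.2‖ ^ q) (by positivity)
              (by positivity)]
          simp only [div_eq_mul_inv]
          rw [e1 _ (by positivity), e1 _ (by positivity)]
          ring
      _ ≤ _ := by
          have : ({z | dist z.1 z.2 < δ} : Set (Euc n × Euc n)).indicator (kin n u q e) z =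
            kin n u q e z := by simp [Set.indicator, h]
          rw [this]
          exact mul_le_mul' le_rfl le_self_add
  · have h4 := Pr_four n q R C hC (v z.1) (u z.1) (v z.2) (u z.2)
    have h9 : (dist z.1 z.2 ^ e)⁻¹ ≤ δ ^ (-e) := by
      rw [Real.rpow_neg hδ.le]
      have := Real.rpow_le_rpow hδ.le (not_lt.mp h) he
      gcongr
    calc _ ≤ (ENNReal.ofReal (2 ^ (n : ℝ)) * C *
        (ENNReal.ofReal (‖v z.1 - u z.1‖ ^ q + ‖v z.2 - u z.2‖ ^ q))) *
          ENNReal.ofReal (δ ^ (-e)) := by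
          gcongr
      _ = ENNReal.ofReal (2 ^ (n : ℝ)) * C * 1 *
        (ENNReal.ofReal (δ ^ (-e)) * (ENNReal.ofReal (‖(v - u) z.1‖ ^ q) +
            ENNReal.ofReal (‖(v - u) z.2‖ ^ q))) := by
          rw [ENNReal.ofReal_add (by positivity) (by positivity)]
          simp only [Pi.sub_apply]
          ring
      _ ≤ _ := by
          gcongr
          · rw [← ENNReal.ofReal_one]
            apply ENNReal.ofReal_le_ofReal
            have : (0 : ℝ) ≤ 2 ^ q := by positivity
            linarith
          · exact le_add_self

lemma kin_meas (n : ℕ) (μ : Measure (Euc n)) [SFinite μ] (u : Euc n → Euc n)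
    (hu : AEMeasurable u μ) (q e : ℝ) : AEMeasurable (kin n u q e) (μ.prod μ) := by
  have h1 : AEMeasurable (fun z : Euc n × Euc n => u z.1) (μ.prod μ) := hu.comp_fst
  have h2 : AEMeasurable (fun z : Euc n × Euc n => u z.2) (μ.prod μ) := hu.comp_snd
  unfold kin
  fun_prop

lemma trip_meas (n : ℕ) (ν μ : Measure (Euc n)) [SFinite ν] [SFinite μ] (u v : Euc n → Euc n)
    (hu : AEMeasurable u μ) (hv : AEMeasurable v μ) (e : ℝ) :
    AEMeasurable (fun t : Euc n × (Euc n × Euc n) =>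
      ENNReal.ofReal (‖(Pr n (v t.2.1) t.1 - Pr n (u t.2.1) t.1) -
        (Pr n (v t.2.2) t.1 - Pr n (u t.2.2) t.1)‖ ^ (n : ℝ) / dist t.2.1 t.2.2 ^ e))
      (ν.prod (μ.prod μ)) := by
  have key : ∀ w : Euc n → Euc n, AEMeasurable w μ →
      AEMeasurable (fun t : Euc n × (Euc n × Euc n) => Pr n (w t.2.1) t.1) (ν.prod (μ.prod μ)) ∧
      AEMeasurable (fun t : Euc n × (Euc n × Euc n) => Pr n (w t.2.2) t.1) (ν.prod (μ.prod μ)) := by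
    intro w hw
    have h1 : AEMeasurable (fun t : Euc n × (Euc n × Euc n) => w t.2.1) (ν.prod (μ.prod μ)) :=
      (hw.comp_fst (ν := μ)).comp_snd
    have h2 : AEMeasurable (fun t : Euc n × (Euc n × Euc n) => w t.2.2) (ν.prod (μ.prod μ)) :=
      (hw.comp_snd (μ := μ)).comp_snd
    have h0 : AEMeasurable (fun t : Euc n × (Euc n × Euc n) => t.1) (ν.prod (μ.prod μ)) :=
      measurable_fst.aemeasurable
    have h3 := (Pr_meas n).comp_aemeasurable (h1.prodMk h0)
    have h4 := (Pr_meas n).comp_aemeasurable (h2.prodMk h0)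
    exact ⟨h3, h4⟩
  obtain ⟨h1, h2⟩ := key u hu
  obtain ⟨h3, h4⟩ := key v hv
  fun_prop

lemma duo_meas (n : ℕ) (ν μ : Measure (Euc n)) [SFinite ν] [SFinite μ] (u v : Euc n → Euc n)
    (hu : AEMeasurable u μ) (hv : AEMeasurable v μ) :
    AEMeasurable (fun t : Euc n × Euc n =>
      ENNReal.ofReal (‖Pr n (v t.2) t.1 - Pr n (u t.2) t.1‖ ^ (n : ℝ)))
      (ν.prod μ) := by
  have key : ∀ w : Euc n → Euc n, AEMeasurable w μ →
      AEMeasurable (fun t : Euc n × Euc n => Pr n (w t.2) t.1) (ν.prod μ) := by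
    intro w hw
    have h1 : AEMeasurable (fun t : Euc n × Euc n => w t.2) (ν.prod μ) := hw.comp_snd
    have h0 : AEMeasurable (fun t : Euc n × Euc n => t.1) (ν.prod μ) :=
      measurable_fst.aemeasurable
    have h3 := (Pr_meas n).comp_aemeasurable (h1.prodMk h0)
    exact h3
  have h1 := key u hu
  have h3 := key v hv
  fun_prop

lemma bound_one (n : ℕ) (q R e δ : ℝ) (hq : 0 < q) (he : 0 ≤ e) (hδ : 0 < δ) (C : ℝ≥0∞)
    (hCt : C ≠ ⊤) (hC : ∀ X Y : Euc n,
      ∫⁻ a in ball (0 : Euc n) R, ENNReal.ofReal (‖Pr n X a - Pr n Y a‖ ^ (n : ℝ)) ≤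
        C * ENNReal.ofReal (‖X - Y‖ ^ q)) (u v : Euc n → Euc n)
    (μ : Measure (Euc n)) [IsFiniteMeasure μ]
    (hu : AEMeasurable u μ) (hv : AEMeasurable v μ) :
    ∫⁻ a in ball (0 : Euc n) R, ∫⁻ z, ENNReal.ofReal
      (‖(Pr n (v z.1) a - Pr n (u z.1) a) - (Pr n (v z.2) a - Pr n (u z.2) a)‖
        ^ (n : ℝ) / dist z.1 z.2 ^ e) ∂(μ.prod μ) ≤
      ENNReal.ofReal (2 ^ (n : ℝ)) * C * ENNReal.ofReal (2 ^ q + 1) *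
        ((∫⁻ z, kin n (v - u) q e z ∂(μ.prod μ)) +
          (∫⁻ z, {z | dist z.1 z.2 < δ}.indicator (kin n u q e) z ∂(μ.prod μ)) +
          ENNReal.ofReal (δ ^ (-e)) * (2 * μ Set.univ *
            ∫⁻ x, ENNReal.ofReal (‖(v - u) x‖ ^ q) ∂μ)) := by
  rw [lintegral_lintegral_swap (trip_meas n _ μ u v hu hv e)]
  refine (lintegral_mono fun z => Pr_pt n q R e δ hq he hδ C hC u v z).trans (le_of_eq ?_)
  have hw : AEMeasurable (v - u) μ := hv.sub hu
  have hw' : AEMeasurable (fun x => ENNReal.ofReal (‖(v - u) x‖ ^ q)) μ := by fun_prop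
  have hset : MeasurableSet {z : Euc n × Euc n | dist z.1 z.2 < δ} :=
    measurableSet_lt (by fun_prop) (by fun_prop)
  have mk1 := kin_meas n μ (v - u) hw q e
  have mk2 := (kin_meas n μ u hu q e).indicator hset
  have mk3 : AEMeasurable (fun z => kin n (v - u) q e z +
      {z : Euc n × Euc n | dist z.1 z.2 < δ}.indicator (kin n u q e) z) (μ.prod μ) := mk1.add mk2
  have i1 : ∫⁻ z : Euc n × Euc n, ENNReal.ofReal (‖(v - u) z.1‖ ^ q) ∂(μ.prod μ) =
      μ Set.univ * ∫⁻ x, ENNReal.ofReal (‖(v - u) x‖ ^ q) ∂μ := by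
    rw [lintegral_prod _ (hw'.comp_fst (ν := μ))]
    simp only [lintegral_const]
    rw [lintegral_mul_const' _ _ (measure_ne_top μ _), mul_comm]
  have i2 : ∫⁻ z : Euc n × Euc n, ENNReal.ofReal (‖(v - u) z.2‖ ^ q) ∂(μ.prod μ) =
      μ Set.univ * ∫⁻ x, ENNReal.ofReal (‖(v - u) x‖ ^ q) ∂μ := by
    rw [lintegral_prod _ (hw'.comp_snd (μ := μ))]
    simp only [lintegral_const]
    rw [mul_comm]
  have hK : ENNReal.ofReal (2 ^ (n : ℝ)) * C * ENNReal.ofReal (2 ^ q + 1) ≠ ⊤ :=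
    ENNReal.mul_ne_top (ENNReal.mul_ne_top ENNReal.ofReal_ne_top hCt) ENNReal.ofReal_ne_top
  rw [lintegral_const_mul' _ _ hK, lintegral_add_left' mk3, lintegral_add_left' mk1,
    lintegral_const_mul' _ _ ENNReal.ofReal_ne_top,
    lintegral_add_left' (hw'.comp_fst (ν := μ)), i1, i2]
  ring

lemma bound_zero (n : ℕ) (q R : ℝ) (C : ℝ≥0∞)
    (hCt : C ≠ ⊤) (hC : ∀ X Y : Euc n,
      ∫⁻ a in ball (0 : Euc n) R, ENNReal.ofReal (‖Pr n X a - Pr n Y a‖ ^ (n : ℝ)) ≤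
        C * ENNReal.ofReal (‖X - Y‖ ^ q)) (u v : Euc n → Euc n)
    (μ : Measure (Euc n)) [IsFiniteMeasure μ]
    (hu : AEMeasurable u μ) (hv : AEMeasurable v μ) :
    ∫⁻ a in ball (0 : Euc n) R, ∫⁻ x, ENNReal.ofReal
      (‖Pr n (v x) a - Pr n (u x) a‖ ^ (n : ℝ)) ∂μ ≤
      C * ∫⁻ x, ENNReal.ofReal (‖(v - u) x‖ ^ q) ∂μ := by
  rw [lintegral_lintegral_swap (duo_meas n _ μ u v hu hv), ← lintegral_const_mul' _ _ hCt]
  exact lintegral_mono fun x => hC _ _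

lemma ind_tend (n : ℕ) (μ : Measure (Euc n)) [IsFiniteMeasure μ] (u : Euc n → Euc n)
    (hu : AEMeasurable u μ) (q e : ℝ) (hq : 0 < q)
    (hfin : ∫⁻ z, kin n u q e z ∂(μ.prod μ) ≠ ⊤) :
    Tendsto (fun j : ℕ => ∫⁻ z, {z : Euc n × Euc n | dist z.1 z.2 < 1 / ((j : ℝ) + 1)}.indicator
      (kin n u q e) z ∂(μ.prod μ)) atTop (𝓝 0) := by
  have h := tendsto_lintegral_of_dominated_convergence' (μ := μ.prod μ)
    (F := fun (j : ℕ) z => {z : Euc n × Euc n | dist z.1 z.2 < 1 / ((j : ℝ) + 1)}.indicator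
      (kin n u q e) z) (f := fun _ => 0) (kin n u q e)
    (fun j => (kin_meas n μ u hu q e).indicator (measurableSet_lt (by fun_prop) (by fun_prop)))
    (fun j => Filter.Eventually.of_forall fun z => Set.indicator_le_self _ _ _) hfin
    (Filter.Eventually.of_forall fun z => ?_)
  · simpa using h
  · rcases (dist_nonneg (x := z.1) (y := z.2)).eq_or_lt with h0 | h0
    · have : kin n u q e z = 0 := by
        unfold kin
        rw [dist_eq_zero.mp h0.symm]; simp [Real.zero_rpow hq.ne']
      simp [Set.indicator, this]
    · refine tendsto_const_nhds.congr' ?_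
      have h1 := (tendsto_one_div_add_atTop_nhds_zero_nat (𝕜 := ℝ)).eventually_lt_const h0
      filter_upwards [h1] with j hj
      rw [Set.indicator_of_notMem]
      simp only [Set.mem_ofPred_eq, not_lt]
      exact hj.le

lemma memWsp_sub (n : ℕ) (s p : ℝ) (hp : 0 ≤ p) (Ω : Set (Euc n)) (u v : Euc n → Euc n)
    (hu : MemWsp n s p Ω u) (hv : MemWsp n s p Ω v) : MemWsp n s p Ω (v - u) := by
  obtain ⟨hu1, hu2, hu3⟩ := hu
  obtain ⟨hv1, hv2, hv3⟩ := hv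
  have hw : AEMeasurable (v - u) (volume.restrict Ω) := (hv1.sub hu1).aemeasurable
  refine ⟨hv1.sub hu1, ?_, ?_⟩
  · refine ((hv2.add hu2).const_mul (2 ^ p)).mono' ?_ (Filter.Eventually.of_forall fun x => ?_)
    · exact AEMeasurable.aestronglyMeasurable (by fun_prop)
    · rw [Real.norm_of_nonneg (by positivity)]
      exact aux_rpow_le _ _ _ p hp (norm_sub_le _ _)
  · refine ((hv3.add hu3).const_mul (2 ^ p)).mono' ?_ (Filter.Eventually.of_forall fun z => ?_)
    · have h1 : AEMeasurable (fun z : Euc n × Euc n => (v - u) z.1)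
        ((volume.restrict Ω).prod (volume.restrict Ω)) := hw.comp_fst
      have h2 : AEMeasurable (fun z : Euc n × Euc n => (v - u) z.2)
        ((volume.restrict Ω).prod (volume.restrict Ω)) := hw.comp_snd
      exact AEMeasurable.aestronglyMeasurable (by fun_prop)
    · rw [Real.norm_of_nonneg (by positivity)]
      simp only [Pi.add_apply]
      rw [← add_div, ← mul_div_assoc]
      gcongr
      have e : (v - u) z.1 - (v - u) z.2 = (v z.1 - v z.2) - (u z.1 - u z.2) := by
        simp only [Pi.sub_apply]; abel
      rw [e]
      exact aux_rpow_le _ _ _ p hp (norm_sub_le _ _)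

lemma lint_le_norm (n : ℕ) (s p : ℝ) (hp : 0 < p) (Ω : Set (Euc n)) (w : Euc n → Euc n)
    (hw : MemWsp n s p Ω w) :
    ∫⁻ x in Ω, ENNReal.ofReal (‖w x‖ ^ p) ≤ ENNReal.ofReal (sobNorm n s p Ω w ^ p) ∧
    ∫⁻ z, kin n w p ((n : ℝ) + s * p) z ∂((volume.restrict Ω).prod (volume.restrict Ω)) ≤
      ENNReal.ofReal (sobNorm n s p Ω w ^ p) := by
  obtain ⟨h1, h2, h3⟩ := hw
  have i1 : 0 ≤ ∫ x in Ω, ‖w x‖ ^ p := integral_nonneg fun x => by positivity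
  have i2 : 0 ≤ ∫ x in Ω, ∫ y in Ω, ‖w x - w y‖ ^ p / dist x y ^ ((n : ℝ) + s * p) :=
    integral_nonneg fun x => integral_nonneg fun y => by positivity
  have pw : ∀ t : ℝ, 0 ≤ t → (t ^ (1 / p)) ^ p = t := fun t ht => by
    rw [← Real.rpow_mul ht, one_div, inv_mul_cancel₀ hp.ne', Real.rpow_one]
  constructor
  · rw [← ofReal_integral_eq_lintegral_ofReal h2
      (Filter.Eventually.of_forall fun x => by positivity)]
    apply ENNReal.ofReal_le_ofReal
    rw [← pw _ i1]
    apply Real.rpow_le_rpow (by positivity) _ hp.le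
    unfold sobNorm sobSemi
    have := Real.rpow_nonneg i2 (1 / p)
    linarith
  · unfold kin
    rw [← ofReal_integral_eq_lintegral_ofReal h3
      (Filter.Eventually.of_forall fun x => by positivity)]
    apply ENNReal.ofReal_le_ofReal
    rw [integral_prod _ h3]
    dsimp only
    rw [← pw _ i2]
    apply Real.rpow_le_rpow (by positivity) _ hp.le
    unfold sobNorm sobSemi
    have := Real.rpow_nonneg i1 (1 / p)
    linarith

lemma sobNorm_pow_le (n : ℕ) (hn : 2 ≤ n) (Ω : Set (Euc n)) (w : Euc n → Euc n)
    (hw : AEMeasurable w (volume.restrict Ω)) (s : ℝ) :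
    ‖sobNorm n s n Ω w ^ n‖ₑ ≤ ENNReal.ofReal (2 ^ (n - 1)) *
      ((∫⁻ x in Ω, ENNReal.ofReal (‖w x‖ ^ (n : ℝ))) +
        ∫⁻ z, kin n w n ((n : ℝ) + s * n) z ∂((volume.restrict Ω).prod (volume.restrict Ω))) := by
  have i1 : 0 ≤ ∫ x in Ω, ‖w x‖ ^ (n : ℝ) := integral_nonneg fun x => by positivity
  have i2 : 0 ≤ ∫ x in Ω, ∫ y in Ω, ‖w x - w y‖ ^ (n : ℝ) / dist x y ^ ((n : ℝ) + s * n) :=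
    integral_nonneg fun x => integral_nonneg fun y => by positivity
  have hn0 : (n : ℝ) ≠ 0 := by positivity
  have pw : ∀ t : ℝ, 0 ≤ t → (t ^ (1 / (n : ℝ))) ^ n = t := fun t ht => by
    rw [← Real.rpow_natCast, ← Real.rpow_mul ht, one_div, inv_mul_cancel₀ hn0, Real.rpow_one]
  have h0 : 0 ≤ sobNorm n s n Ω w := by
    unfold sobNorm sobSemi; positivity
  rw [Real.enorm_of_nonneg (by positivity)]
  have h1 : sobNorm n s n Ω w ^ n ≤ 2 ^ (n - 1) * ((∫ x in Ω, ‖w x‖ ^ (n : ℝ)) +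
      ∫ x in Ω, ∫ y in Ω, ‖w x - w y‖ ^ (n : ℝ) / dist x y ^ ((n : ℝ) + s * n)) := by
    have := add_pow_le (Real.rpow_nonneg i1 (1 / (n : ℝ))) (Real.rpow_nonneg i2 (1 / (n : ℝ))) n
    rw [pw _ i1, pw _ i2] at this
    exact this
  refine (ENNReal.ofReal_le_ofReal h1).trans ?_
  rw [ENNReal.ofReal_mul (by positivity), ENNReal.ofReal_add i1 i2]
  gcongr
  · rw [← Real.enorm_of_nonneg i1]
    refine (enorm_integral_le_lintegral_enorm _).trans (le_of_eq ?_)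
    exact lintegral_congr fun x => Real.enorm_of_nonneg (by positivity)
  · rw [← Real.enorm_of_nonneg i2, lintegral_prod _ (kin_meas n _ w hw _ _)]
    refine (enorm_integral_le_lintegral_enorm _).trans ?_
    refine lintegral_mono fun x => ?_
    refine (enorm_integral_le_lintegral_enorm _).trans (le_of_eq ?_)
    exact lintegral_congr fun y => Real.enorm_of_nonneg (by positivity)

lemma mem_ae (n : ℕ) (hn : 2 ≤ n) (q e : ℝ) (hq : 0 < q) (hqn : q < n)
    (Ω : Set (Euc n)) (u : Euc n → Euc n) (s' : ℝ) (he : (n : ℝ) + s' * n = e)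
    (hμ : volume Ω < ⊤)
    (hu : AEMeasurable u (volume.restrict Ω))
    (hfin : ∫⁻ z, kin n u q e z ∂((volume.restrict Ω).prod (volume.restrict Ω)) < ⊤) :
    ∀ᵐ a : Euc n, MemWsp n s' n Ω (proj n u a) := by
  have : IsFiniteMeasure (volume.restrict Ω) := ⟨by simpa using hμ⟩
  have key : ∀ j : ℕ, ∀ᵐ a : Euc n, a ∈ ball (0 : Euc n) j → MemWsp n s' n Ω (proj n u a) := by
    intro j
    obtain ⟨C, hCt, hC⟩ := Pr_lint n hn q j hq hqn
    rw [← ae_restrict_iff' measurableSet_ball]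
    have hm : AEMeasurable (fun t : Euc n × (Euc n × Euc n) =>
        ENNReal.ofReal (‖Pr n (u t.2.1) t.1 - Pr n (u t.2.2) t.1‖ ^ (n : ℝ) /
          dist t.2.1 t.2.2 ^ e))
        ((volume.restrict (ball (0 : Euc n) j)).prod
          ((volume.restrict Ω).prod (volume.restrict Ω))) := by
      have h := trip_meas n (volume.restrict (ball (0 : Euc n) j)) (volume.restrict Ω)
        (fun _ => 0) u aemeasurable_const hu e
      simpa using h
    have hle : ∫⁻ a in ball (0 : Euc n) j, ∫⁻ z, ENNReal.ofReal
        (‖Pr n (u z.1) a - Pr n (u z.2) a‖ ^ (n : ℝ) / dist z.1 z.2 ^ e)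
          ∂((volume.restrict Ω).prod (volume.restrict Ω)) ≤
        C * ∫⁻ z, kin n u q e z ∂((volume.restrict Ω).prod (volume.restrict Ω)) := by
      rw [lintegral_lintegral_swap hm, ← lintegral_const_mul' _ _ hCt]
      refine lintegral_mono fun z => ?_
      simp only [div_eq_mul_inv, kin]
      rw [lintegral_congr (fun a => ENNReal.ofReal_mul (by positivity)),
        lintegral_mul_const' _ _ ENNReal.ofReal_ne_top, ENNReal.ofReal_mul (by positivity),
        ← mul_assoc]
      gcongr
      exact hC _ _
    have hlt := ae_lt_top' hm.lintegral_prod_right'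
      (hle.trans_lt (ENNReal.mul_lt_top hCt.lt_top hfin)).ne
    filter_upwards [hlt] with a ha
    have hpm : AEMeasurable (proj n u a) (volume.restrict Ω) := by
      unfold proj; fun_prop
    refine ⟨hpm.aestronglyMeasurable, ?_, ?_, ?_⟩
    · refine (integrable_const (1 : ℝ)).mono' ?_ (Filter.Eventually.of_forall fun x => ?_)
      · exact AEMeasurable.aestronglyMeasurable (by fun_prop)
      · rw [Real.norm_of_nonneg (by positivity)]
        exact Real.rpow_le_one (norm_nonneg _) (Pr_norm_le n (u x) a) (Nat.cast_nonneg n)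
    · have h1 : AEMeasurable (fun z : Euc n × Euc n => proj n u a z.1)
        ((volume.restrict Ω).prod (volume.restrict Ω)) := hpm.comp_fst
      have h2 : AEMeasurable (fun z : Euc n × Euc n => proj n u a z.2)
        ((volume.restrict Ω).prod (volume.restrict Ω)) := hpm.comp_snd
      exact AEMeasurable.aestronglyMeasurable (by fun_prop)
    · rw [hasFiniteIntegral_iff_ofReal (Filter.Eventually.of_forall fun z => by positivity), he]
      exact ha
  filter_upwards [ae_all_iff.mpr key] with a ha
  obtain ⟨j, hj⟩ := exists_nat_gt ‖a‖
  exact ha j (by simpa using hj)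

/-- Continuity of `u ↦ u^a` (Lemma `u^a` continuity): if `u_k → u` in
`W^{s,p}(Ω;ℝⁿ)` with `s ∈ ((n-1)/n, 1)` and `sp > n-1`, then
`a ↦ ‖u_k^a - u^a‖_{W^{(n-1)/n,n}(Ω)}^n → 0` in `L¹_loc(ℝⁿ)`. -/
theorem proj_continuity
    (n : ℕ) (hn : 2 ≤ n) (Ω : Set (Euc n)) (hΩo : IsOpen Ω)
    (hΩb : Bornology.IsBounded Ω) (hΩs : SmoothBoundary n Ω)
    (s p : ℝ) (hs₁ : ((n : ℝ) - 1) / n < s) (hs₂ : s < 1)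
    (hp : 1 ≤ p) (hsp : (n : ℝ) - 1 < s * p)
    (u : Euc n → Euc n) (uk : ℕ → Euc n → Euc n)
    (hu : MemWsp n s p Ω u) (huk : ∀ k, MemWsp n s p Ω (uk k))
    (hconv : Tendsto (fun k => sobNorm n s p Ω (uk k - u)) atTop (𝓝 0)) :
    (∀ᵐ a : Euc n, MemWsp n (((n : ℝ) - 1) / n) n Ω (proj n u a) ∧
        ∀ k, MemWsp n (((n : ℝ) - 1) / n) n Ω (proj n (uk k) a)) ∧
    ∀ R : ℝ, 0 < R →
      Tendsto
        (fun k => ∫ a in ball (0 : Euc n) R,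
          sobNorm n (((n : ℝ) - 1) / n) n Ω (proj n (uk k) a - proj n u a) ^ n)
        atTop (𝓝 0) := by

  have hn2 : (2 : ℝ) ≤ n := by exact_mod_cast hn
  have hn0 : (0 : ℝ) < n := by linarith
  have hp0 : 0 < p := by linarith
  have hs0 : 0 < s := lt_of_le_of_lt (div_nonneg (by linarith) hn0.le) hs₁
  have hμ : volume Ω < ⊤ := hΩb.measure_lt_top
  have hfm : IsFiniteMeasure (volume.restrict Ω) := ⟨by simpa using hμ⟩
  set μ := volume.restrict Ω with hμdef
  -- choice of the exponent
  obtain ⟨q, hq1, hq2⟩ : ∃ q, ((n : ℝ) - 1) / s < q ∧ q < min (n : ℝ) p := by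
    apply exists_between
    rw [lt_min_iff, div_lt_iff₀ hs0, div_lt_iff₀ hs0]
    rw [div_lt_iff₀ hn0] at hs₁
    constructor <;> linarith
  obtain ⟨hqn, hqp⟩ := lt_min_iff.mp hq2
  have hq0 : 0 < q := lt_of_le_of_lt (div_nonneg (by linarith) hs0.le) hq1
  rw [div_lt_iff₀ hs0] at hq1
  obtain ⟨e, he⟩ : ∃ e : ℝ, e = (n : ℝ) + (((n : ℝ) - 1) / n) * n := ⟨_, rfl⟩
  have he2 : e = 2 * n - 1 := by rw [he]; field_simp; ring
  have he0 : 0 ≤ e := by rw [he2]; linarith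
  have hb : e - ((n : ℝ) + s * p - e) / (p - q) * q < n := by
    have hpq : 0 < p - q := by linarith
    have : (n : ℝ) - 1 < ((n : ℝ) + s * p - e) / (p - q) * q := by
      rw [div_mul_eq_mul_div, lt_div_iff₀ hpq, he2]
      nlinarith [mul_pos hp0 (sub_pos.mpr hq1)]
    rw [he2] at this ⊢; linarith
  have hker := aux_kernel n hn Ω hΩb _ hb
  have hfin : ∀ v : Euc n → Euc n, MemWsp n s p Ω v →
      ∫⁻ z, kin n v q e z ∂(μ.prod μ) < ⊤ := by
    intro v hv
    refine (aux_interp n (μ.prod μ) v 1 q p e ((n : ℝ) + s * p) one_pos hq0 hqp).trans_lt ?_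
    refine ENNReal.add_lt_top.mpr ⟨ENNReal.mul_lt_top ENNReal.ofReal_lt_top hker,
      ENNReal.mul_lt_top ENNReal.ofReal_lt_top ?_⟩
    exact ((lint_le_norm n s p hp0 Ω v hv).2).trans_lt ENNReal.ofReal_lt_top
  refine ⟨?_, fun R hR => ?_⟩
  · have h1 := mem_ae n hn q e hq0 hqn Ω u _ he.symm hμ hu.1.aemeasurable (hfin u hu)
    have h2 := ae_all_iff.mpr fun k =>
      mem_ae n hn q e hq0 hqn Ω (uk k) _ he.symm hμ (huk k).1.aemeasurable (hfin _ (huk k))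
    filter_upwards [h1, h2] with a ha hb
    exact ⟨ha, hb⟩
  -- convergence
  have hw : ∀ k, MemWsp n s p Ω (uk k - u) := fun k => memWsp_sub n s p hp0.le Ω u (uk k) hu (huk k)
  have hN : Tendsto (fun k => ENNReal.ofReal (sobNorm n s p Ω (uk k - u) ^ p)) atTop (𝓝 0) := by
    have h1 := hconv.rpow_const (p := p) (Or.inr hp0.le)
    rw [Real.zero_rpow hp0.ne'] at h1
    simpa using ENNReal.tendsto_ofReal h1
  have hW0 : Tendsto (fun k => ∫⁻ x, ENNReal.ofReal (‖(uk k - u) x‖ ^ q) ∂μ) atTop (𝓝 0) :=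
    aux_tend0 n μ (fun k => uk k - u) q p hq0 hqp
      (tendsto_of_tendsto_of_tendsto_of_le_of_le tendsto_const_nhds hN (fun _ => zero_le)
        (fun k => (lint_le_norm n s p hp0 Ω _ (hw k)).1))
  have hW1 : Tendsto (fun k => ∫⁻ z, kin n (uk k - u) q e z ∂(μ.prod μ)) atTop (𝓝 0) :=
    aux_tend n (μ.prod μ) (fun k => uk k - u) q p e ((n : ℝ) + s * p) hq0 hqp hker
      (tendsto_of_tendsto_of_tendsto_of_le_of_le tendsto_const_nhds hN (fun _ => zero_le)
        (fun k => (lint_le_norm n s p hp0 Ω _ (hw k)).2))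
  obtain ⟨C, hCt, hC⟩ := Pr_lint n hn q R hq0 hqn
  obtain ⟨K, hK⟩ : ∃ K, K = ENNReal.ofReal (2 ^ (n : ℝ)) * C * ENNReal.ofReal (2 ^ q + 1) := ⟨_, rfl⟩
  have hKt : K ≠ ⊤ := by
    rw [hK]
    exact ENNReal.mul_ne_top (ENNReal.mul_ne_top ENNReal.ofReal_ne_top hCt) ENNReal.ofReal_ne_top
  have hum : AEMeasurable u μ := hu.1.aemeasurable
  have hT1 : Tendsto (fun k => ∫⁻ a in ball (0 : Euc n) R, ∫⁻ z, ENNReal.ofReal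
      (‖(Pr n (uk k z.1) a - Pr n (u z.1) a) - (Pr n (uk k z.2) a - Pr n (u z.2) a)‖
        ^ (n : ℝ) / dist z.1 z.2 ^ e) ∂(μ.prod μ)) atTop (𝓝 0) := by
    refine aux_squeeze _
      (fun k => (∫⁻ z, kin n (uk k - u) q e z ∂(μ.prod μ)) +
        ∫⁻ x, ENNReal.ofReal (‖(uk k - u) x‖ ^ q) ∂μ)
      (fun j : ℕ => K * ∫⁻ z, {z : Euc n × Euc n | dist z.1 z.2 < 1 / ((j : ℝ) + 1)}.indicator
        (kin n u q e) z ∂(μ.prod μ))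
      (fun j : ℕ => K * (1 + ENNReal.ofReal ((1 / ((j : ℝ) + 1)) ^ (-e)) * (2 * μ Set.univ)))
      ?_ ?_ ?_ ?_
    · have := ENNReal.Tendsto.const_mul (a := K) (ind_tend n μ u hum q e hq0 (hfin u hu).ne)
        (Or.inr hKt)
      simpa using this
    · simpa using hW1.add hW0
    · intro j
      refine ENNReal.mul_ne_top hKt (ENNReal.add_ne_top.mpr ⟨ENNReal.one_ne_top, ?_⟩)
      exact ENNReal.mul_ne_top ENNReal.ofReal_ne_top
        (ENNReal.mul_ne_top (by simp) (measure_ne_top μ _))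
    · intro j k
      refine (bound_one n q R e (1 / ((j : ℝ) + 1)) hq0 he0 (by positivity) C hCt hC u (uk k) μ
        hum (huk k).1.aemeasurable).trans ?_
      rw [← hK]
      generalize (∫⁻ z, kin n (uk k - u) q e z ∂(μ.prod μ)) = x1
      generalize (∫⁻ x, ENNReal.ofReal (‖(uk k - u) x‖ ^ q) ∂μ) = x2
      generalize (∫⁻ z, {z : Euc n × Euc n | dist z.1 z.2 < 1 / ((j : ℝ) + 1)}.indicator
        (kin n u q e) z ∂(μ.prod μ)) = x3
      generalize ENNReal.ofReal ((1 / ((j : ℝ) + 1)) ^ (-e)) = x4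
      generalize μ Set.univ = x5
      rw [← mul_assoc x4, mul_assoc K, ← mul_add]
      gcongr K * ?_
      calc x1 + x3 + x4 * (2 * x5) * x2 ≤ x1 + x3 + x4 * (2 * x5) * x2 +
            (x2 + x4 * (2 * x5) * x1) := le_self_add
        _ = _ := by ring
  have hT0 : Tendsto (fun k => ∫⁻ a in ball (0 : Euc n) R, ∫⁻ x, ENNReal.ofReal
      (‖Pr n (uk k x) a - Pr n (u x) a‖ ^ (n : ℝ)) ∂μ) atTop (𝓝 0) := by
    have h1 := ENNReal.Tendsto.const_mul (a := C) hW0 (Or.inr hCt)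
    rw [mul_zero] at h1
    exact tendsto_of_tendsto_of_tendsto_of_le_of_le tendsto_const_nhds h1 (fun _ => zero_le)
      (fun k => bound_zero n q R C hCt hC u (uk k) μ hum (huk k).1.aemeasurable)
  have hT := ENNReal.Tendsto.const_mul (a := ENNReal.ofReal (2 ^ (n - 1))) (hT0.add hT1)
    (Or.inr ENNReal.ofReal_ne_top)
  rw [add_zero, mul_zero] at hT
  rw [tendsto_iff_norm_sub_tendsto_zero]
  simp only [sub_zero]
  have hE : Tendsto (fun k => ‖∫ a in ball (0 : Euc n) R,
      sobNorm n (((n : ℝ) - 1) / n) n Ω (proj n (uk k) a - proj n u a) ^ n‖ₑ) atTop (𝓝 0) := by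
    refine tendsto_of_tendsto_of_tendsto_of_le_of_le tendsto_const_nhds hT (fun _ => zero_le)
      (fun k => ?_)
    refine (enorm_integral_le_lintegral_enorm _).trans ?_
    have hukm : AEMeasurable (uk k) μ := (huk k).1.aemeasurable
    have hm0 := (duo_meas n (volume.restrict (ball (0 : Euc n) R)) μ u (uk k) hum
      hukm).lintegral_prod_right'
    rw [← lintegral_add_left' hm0, ← lintegral_const_mul' _ _ ENNReal.ofReal_ne_top]
    refine lintegral_mono fun a => ?_
    have hpm : AEMeasurable (proj n (uk k) a - proj n u a) μ := by
      have h1 : AEMeasurable (proj n u a) μ := by unfold proj; fun_prop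
      have h2 : AEMeasurable (proj n (uk k) a) μ := by unfold proj; fun_prop
      exact h2.sub h1
    refine (sobNorm_pow_le n hn Ω _ hpm _).trans (le_of_eq ?_)
    rw [← he]
    rfl
  have := (ENNReal.tendsto_toReal ENNReal.zero_ne_top).comp hE
  refine this.congr fun k => ?_
  simp only [Function.comp_apply, toReal_enorm]

end
end

section
/- Let u ∈ W^{(n−1)/n,n}(Ω;ℝ^n), let ũ ∈ W^{(n−1)/n,n}(ℝ^n;ℝ^n) satisfy ũ = u almost everywhere on Ω, let η ∈ C^∞_c(ℝ^n) with ∫_{ℝ^n} η = 1 and η_t := t^{−n} η(·/t), let t_k ↓ 0, and set u_k := η_{t_k} * ũ (restricted to Ω). Then for almost every a ∈ ℝ^n the pairings ⟨Ju_k^a, ψ⟩ := −∫_Ω j u_k^a(x)·∇ψ(x) dx are well defined and finite for all ψ ∈ C^1_c(Ω), and ∫_{ℝ^n} ‖Ju_k^a − Ju_l^a‖_{W^{−1,1}(Ω)} da → 0 as k, l → ∞, where ‖T‖_{W^{−1,1}(Ω)} := sup{ ⟨T,ψ⟩ : ψ ∈ C^1_c(Ω) with Lipschitz constant at most 1 }.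 In particular, there is a family of distributions (T^a)_{a∈ℝ^n} with ∫_{ℝ^n} ‖Ju_k^a − T^a‖_{W^{−1,1}(Ω)} da → 0. -/
open MeasureTheory Metric Filter Topology

noncomputable section

open scoped ENNReal Convolution

section A1S

lemma det_updateRow_eq_sum {n : ℕ} (A : Matrix (Fin n) (Fin n) ℝ) (k : Fin n) (b : Fin n → ℝ) :
    (A.updateRow k b).det = ∑ m, A.adjugate m k * b m := by
  rw [← Matrix.cramer_transpose_apply, Matrix.cramer_eq_adjugate_mulVec,
    ← Matrix.adjugate_transpose]
  simp [Matrix.mulVec, dotProduct]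

lemma hasFDerivAt_det_aux {V : Type*} [NormedAddCommGroup V] [NormedSpace ℝ V] {n : ℕ}
    (M : V → Matrix (Fin n) (Fin n) ℝ) (M' : Fin n → Fin n → V →L[ℝ] ℝ) (p : V)
    (h : ∀ i j, HasFDerivAt (fun q => M q i j) (M' i j) p) :
    ∃ L : V →L[ℝ] ℝ, HasFDerivAt (fun q => (M q).det) L p ∧
      ∀ w, L w = ∑ k, ((M p).updateRow k (fun j => M' k j w)).det := by
  have := HasFDerivAt.fun_sum (u := Finset.univ) (fun (σ : Equiv.Perm (Fin n)) _ =>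
      (HasFDerivAt.finsetProd (u := Finset.univ) (fun i _ => h (σ i) i)).const_smul
        ((Equiv.Perm.sign σ : ℤ) : ℝ))
  have heq : (fun y => ∑ σ : Equiv.Perm (Fin n), ((((Equiv.Perm.sign σ : ℤ) : ℝ)) •
      fun x => ∏ i, M x (σ i) i) y) = fun q => (M q).det := by
    ext q
    simp [Matrix.det_apply']
  rw [heq] at this
  refine ⟨_, this, ?_⟩
  · intro w
    simp only [sum_apply, smul_apply,
      Matrix.det_apply']
    rw [Finset.sum_comm]
    refine Finset.sum_congr rfl fun σ _ => ?_
    rw [← Finset.mul_sum, smul_eq_mul]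
    congr 1
    symm
    rw [← Equiv.sum_comp σ]
    refine Finset.sum_congr rfl fun i _ => ?_
    rw [← Finset.mul_prod_erase _ _ (Finset.mem_univ i)]
    simp only [Matrix.updateRow_self, smul_eq_mul]
    rw [mul_comm]
    congr 1
    refine Finset.prod_congr rfl fun j hj => ?_
    rw [Matrix.updateRow_ne]
    simpa using (Finset.ne_of_mem_erase hj)

/-- partial Jacobian matrix along directions `e`. -/
def dirJac {V : Type*} [NormedAddCommGroup V] [NormedSpace ℝ V] {n : ℕ}
    (U : V → Euc n) (e : Fin n → V) (q : V) : Matrix (Fin n) (Fin n) ℝ :=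
  Matrix.of fun m j => fderiv ℝ U q (e j) m

lemma hasFDerivAt_dirJac {V : Type*} [NormedAddCommGroup V] [NormedSpace ℝ V] {n : ℕ}
    (U : V → Euc n) (e : Fin n → V) (p : V) (hU : ContDiffAt ℝ 2 U p) (m j : Fin n) :
    ∃ L : V →L[ℝ] ℝ, HasFDerivAt (fun q => dirJac U e q m j) L p ∧
      ∀ w, L w = fderiv ℝ (fderiv ℝ U) p w (e j) m := by
  have h1 : DifferentiableAt ℝ (fderiv ℝ U) p :=
    (hU.fderiv_right (m := 1) (by norm_num)).differentiableAt (by norm_num)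
  have h2 := ((EuclideanSpace.proj (𝕜 := ℝ) m).hasFDerivAt
    (x := fderiv ℝ U p (e j))).comp p
      (((ContinuousLinearMap.apply ℝ (Euc n) (e j)).hasFDerivAt (x := fderiv ℝ U p)).comp p
        h1.hasFDerivAt)
  exact ⟨_, h2, fun w => by simp⟩

lemma det_two_rows_anti {n : ℕ} (R : Matrix (Fin n) (Fin n) ℝ) (j k : Fin n) (hjk : k ≠ j)
    (b c : Fin n → ℝ) : ((R.updateRow j b).updateRow k c).det
      = - ((R.updateRow j c).updateRow k b).det := by
  have : ((R.updateRow j b).updateRow k c)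
      = ((R.updateRow j c).updateRow k b).submatrix (Equiv.swap j k) id := by
    ext x y
    simp only [Matrix.submatrix_apply, id]
    by_cases hxj : x = j
    · subst hxj
      rw [Equiv.swap_apply_left, Matrix.updateRow_ne hjk.symm, Matrix.updateRow_self,
        Matrix.updateRow_self]
    · by_cases hxk : x = k
      · subst hxk
        rw [Equiv.swap_apply_right, Matrix.updateRow_self, Matrix.updateRow_ne hjk.symm,
          Matrix.updateRow_self]
      · rw [Equiv.swap_apply_of_ne_of_ne hxj hxk, Matrix.updateRow_ne hxk,
          Matrix.updateRow_ne hxj, Matrix.updateRow_ne hxk, Matrix.updateRow_ne hxj]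
  rw [this, Matrix.det_permute, Equiv.Perm.sign_swap hjk.symm]
  simp

lemma adj_hasFDerivAt {V : Type*} [NormedAddCommGroup V] [NormedSpace ℝ V] {n : ℕ}
    (U : V → Euc n) (e : Fin n → V) (p : V) (hU : ContDiffAt ℝ 2 U p) :
    ∃ L : Fin n → Fin n → V →L[ℝ] ℝ,
      (∀ i j, HasFDerivAt (fun q => (dirJac U e q).adjugate i j) (L i j) p) ∧
      ∀ j, ∑ i, L i j (e i) = 0 := by
  choose D hD hD' using fun m j => hasFDerivAt_dirJac U e p hU m j
  have key : ∀ i j, ∃ L : V →L[ℝ] ℝ,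
      HasFDerivAt (fun q => (dirJac U e q).adjugate i j) L p ∧
      ∀ w, L w = ∑ k, (((dirJac U e p).updateRow j (Pi.single i 1)).updateRow k
        (fun m => (if k = j then (0 : V →L[ℝ] ℝ) else D k m) w)).det := by
    intro i j
    have := hasFDerivAt_det_aux (fun q => (dirJac U e q).updateRow j (Pi.single i 1))
      (fun k m => if k = j then (0 : V →L[ℝ] ℝ) else D k m) p (by
        intro k m
        by_cases hk : k = j
        · subst hk
          simp only [Matrix.updateRow_self, if_true]
          exact hasFDerivAt_const _ _
        · simp only [Matrix.updateRow_ne hk, if_neg hk]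
          exact hD k m)
    simpa only [Matrix.adjugate_apply] using this
  choose L hL hL' using key
  refine ⟨L, hL, fun j => ?_⟩
  simp only [hL']
  rw [Finset.sum_comm]
  refine Finset.sum_eq_zero fun k _ => ?_
  by_cases hk : k = j
  · refine Finset.sum_eq_zero fun i _ => ?_
    apply Matrix.det_eq_zero_of_row_eq_zero k
    intro m
    simp [hk]
  · simp only [if_neg hk]
    have h2 : ∀ i, ((((dirJac U e p).updateRow j (Pi.single i 1)).updateRow k
        (fun m => (D k m) (e i))).det)
        = ∑ m, (((dirJac U e p).updateRow j (Pi.single i 1)).updateRow k (Pi.single m 1)).det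
          * D k m (e i) := by
      intro i
      rw [det_updateRow_eq_sum]
      simp only [Matrix.adjugate_apply]
    simp only [h2]
    have hsymm : ∀ i m, D k m (e i) = D k i (e m) := by
      intro i m
      rw [hD', hD']
      have := (hU.isSymmSndFDerivAt (by simp)).eq (e i) (e m)
      rw [this]
    set g : Fin n → Fin n → ℝ := fun i m =>
      (((dirJac U e p).updateRow j (Pi.single i 1)).updateRow k (Pi.single m 1)).det
    have hg : ∀ i m, g i m = - g m i := fun i m => det_two_rows_anti _ _ _ hk _ _
    have : ∑ i, ∑ m, g i m * D k m (e i) = - ∑ i, ∑ m, g i m * D k m (e i) := by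
      conv_lhs => rw [Finset.sum_comm]
      rw [← Finset.sum_neg_distrib]
      refine Finset.sum_congr rfl fun m _ => ?_
      rw [← Finset.sum_neg_distrib]
      refine Finset.sum_congr rfl fun i _ => ?_
      rw [hg i m, hsymm i m]; ring
    change ∑ i, ∑ m, g i m * D k m (e i) = 0
    linarith

/-- Jacobi formula -/
lemma det_hasFDerivAt {V : Type*} [NormedAddCommGroup V] [NormedSpace ℝ V] {n : ℕ}
    (U : V → Euc n) (e : Fin n → V) (p : V) (hU : ContDiffAt ℝ 2 U p) :
    ∃ L : V →L[ℝ] ℝ, HasFDerivAt (fun q => (dirJac U e q).det) L p ∧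
      ∀ w, L w = ∑ k, ∑ m, (dirJac U e p).adjugate m k * fderiv ℝ (fderiv ℝ U) p w (e m) k := by
  choose D hD hD' using fun m j => hasFDerivAt_dirJac U e p hU m j
  obtain ⟨L, hL, hL'⟩ := hasFDerivAt_det_aux _ _ p hD
  refine ⟨L, hL, fun w => ?_⟩
  rw [hL']
  simp only [det_updateRow_eq_sum, hD']

end A1S

section A2S

lemma euc_eq_sum {n : ℕ} (y : Euc n) : y = ∑ m, y m • EuclideanSpace.single m (1:ℝ) := by
  ext i
  simp [Finset.sum_apply, Pi.single_apply]

lemma adj_contract {V : Type*} [NormedAddCommGroup V] [NormedSpace ℝ V] {n : ℕ}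
    (U : V → Euc n) (e : Fin n → V) (p : V) (l : Euc n →L[ℝ] ℝ) (j : Fin n) :
    ∑ i, (dirJac U e p).adjugate i j * l (fderiv ℝ U p (e i))
      = (dirJac U e p).det * l (EuclideanSpace.single j 1) := by
  have h1 : ∀ i, l (fderiv ℝ U p (e i))
      = ∑ m, dirJac U e p m i * l (EuclideanSpace.single m 1) := by
    intro i
    conv_lhs => rw [euc_eq_sum (fderiv ℝ U p (e i))]
    simp [dirJac, map_sum]
  simp only [h1, Finset.mul_sum]
  rw [Finset.sum_comm]
  have h2 : ∀ m, ∑ i, (dirJac U e p).adjugate i j * (dirJac U e p m i *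
      l (EuclideanSpace.single m 1)) = (if m = j then (dirJac U e p).det else 0) *
        l (EuclideanSpace.single m 1) := by
    intro m
    have := congrFun (congrFun (Matrix.mul_adjugate (dirJac U e p)) m) j
    rw [Matrix.mul_apply] at this
    have h3 : ((dirJac U e p).det • (1 : Matrix (Fin n) (Fin n) ℝ)) m j
        = if m = j then (dirJac U e p).det else 0 := by
      simp [Matrix.one_apply]
    rw [← h3, ← this, Finset.sum_mul]
    refine Finset.sum_congr rfl fun i _ => by ring
  simp only [h2]
  simp

lemma div_adj {V : Type*} [NormedAddCommGroup V] [NormedSpace ℝ V] {n : ℕ}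
    (U : V → Euc n) (e : Fin n → V) (p : V) (hU : ContDiffAt ℝ 2 U p)
    (g : Fin n → V → ℝ) (g' : Fin n → V →L[ℝ] ℝ) (hg : ∀ j, HasFDerivAt (g j) (g' j) p) :
    ∑ i, fderiv ℝ (fun q => ∑ j, (dirJac U e q).adjugate i j * g j q) p (e i)
      = ∑ j, ∑ i, (dirJac U e p).adjugate i j * g' j (e i) := by
  obtain ⟨L, hL, hL0⟩ := adj_hasFDerivAt U e p hU
  have h1 : ∀ i, fderiv ℝ (fun q => ∑ j, (dirJac U e q).adjugate i j * g j q) p (e i)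
      = ∑ j, ((dirJac U e p).adjugate i j * g' j (e i) + g j p * L i j (e i)) := by
    intro i
    have := HasFDerivAt.fun_sum (u := Finset.univ) (fun j _ => (hL i j).fun_mul (hg j))
    rw [this.fderiv]
    simp
  simp only [h1]
  rw [Finset.sum_comm]
  refine Finset.sum_congr rfl fun j _ => ?_
  rw [Finset.sum_add_distrib, ← Finset.mul_sum, hL0 j]
  simp

lemma div_jac_one {V : Type*} [NormedAddCommGroup V] [NormedSpace ℝ V] {n : ℕ}
    (U : V → Euc n) (e : Fin n → V) (p : V) (hU : ContDiffAt ℝ 2 U p)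
    (K : Euc n → Euc n) (hK : DifferentiableAt ℝ K (U p)) :
    ∑ i, fderiv ℝ (fun q => ∑ j, (dirJac U e q).adjugate i j * K (U q) j) p (e i)
      = (∑ j, fderiv ℝ K (U p) (EuclideanSpace.single j 1) j) * (dirJac U e p).det := by
  have hUd : HasFDerivAt U (fderiv ℝ U p) p := (hU.differentiableAt (by norm_num)).hasFDerivAt
  have := div_adj U e p hU (fun j q => K (U q) j)
    (fun j => (EuclideanSpace.proj (𝕜 := ℝ) j).comp ((fderiv ℝ K (U p)).comp (fderiv ℝ U p)))
    (fun j => by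
      have h1 := (EuclideanSpace.proj (𝕜 := ℝ) j).hasFDerivAt (x := K (U p))
      exact h1.comp p (hK.hasFDerivAt.comp p hUd))
  rw [this, Finset.sum_mul]
  refine Finset.sum_congr rfl fun j _ => ?_
  have := adj_contract U e p ((EuclideanSpace.proj (𝕜 := ℝ) j).comp (fderiv ℝ K (U p))) j
  simp only [ContinuousLinearMap.comp_apply] at this ⊢
  rw [this, mul_comm]
  simp

lemma div_jac_two {V : Type*} [NormedAddCommGroup V] [NormedSpace ℝ V] {n : ℕ}
    (U : V → Euc n) (e : Fin n → V) (τ : V) (p : V) (hU : ContDiffAt ℝ 2 U p)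
    (χ : Euc n → ℝ) (hχ : DifferentiableAt ℝ χ (U p)) :
    fderiv ℝ (fun q => χ (U q) * (dirJac U e q).det) p τ =
    ∑ i, fderiv ℝ (fun q => ∑ j, (dirJac U e q).adjugate i j * (χ (U q) * fderiv ℝ U q τ j)) p (e i)
      := by
  have hUd : HasFDerivAt U (fderiv ℝ U p) p := (hU.differentiableAt (by norm_num)).hasFDerivAt
  have hχU : HasFDerivAt (fun q => χ (U q)) _ p := hχ.hasFDerivAt.comp p hUd
  obtain ⟨L, hL, hL'⟩ := det_hasFDerivAt U e p hU
  choose D hD hD' using fun j => hasFDerivAt_dirJac U (fun _ => τ) p hU j j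
  have := div_adj U e p hU (fun j q => χ (U q) * fderiv ℝ U q τ j) _
    (fun j => hχU.fun_mul (hD j))
  rw [this, (hχU.fun_mul hL).fderiv]
  simp only [add_apply, smul_apply, smul_eq_mul,
    Function.comp_apply, hL', hD', ContinuousLinearMap.comp_apply, mul_add, Finset.sum_add_distrib]
  rw [add_comm]
  have hsymm : ∀ i, fderiv ℝ (fderiv ℝ U) p (e i) τ = fderiv ℝ (fderiv ℝ U) p τ (e i) := 
    fun i => (hU.isSymmSndFDerivAt (by simp)).eq (e i) τ
  have h1 : (dirJac U e p).det * (fderiv ℝ χ (U p)) (fderiv ℝ U p τ)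
      = ∑ j, ∑ i, (dirJac U e p).adjugate i j *
        (dirJac U (fun _ => τ) p j j * (fderiv ℝ χ (U p)) (fderiv ℝ U p (e i))) := by
    conv_lhs => rw [euc_eq_sum (fderiv ℝ U p τ)]
    rw [map_sum, Finset.mul_sum]
    refine Finset.sum_congr rfl fun j _ => ?_
    have := adj_contract U e p (fderiv ℝ χ (U p)) j
    rw [map_smul, smul_eq_mul, mul_left_comm, ← this, Finset.mul_sum]
    refine Finset.sum_congr rfl fun i _ => ?_
    simp only [dirJac, Matrix.of_apply]
    ring
  rw [h1, add_comm]
  congr 1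
  rw [Finset.mul_sum]
  refine Finset.sum_congr rfl fun j _ => ?_
  rw [Finset.mul_sum]
  refine Finset.sum_congr rfl fun i _ => ?_
  rw [hsymm]; ring

end A2S

section A3S

lemma fderiv_zero_off {n : ℕ} {ψ : Euc n → ℝ} {x : Euc n} (hx : x ∉ tsupport ψ) :
    fderiv ℝ ψ x = 0 := by
  by_contra h
  exact hx (support_fderiv_subset ℝ h)

lemma ibp_jac {n : ℕ} (X : Fin n → Euc n → ℝ) (hX : ∀ i, ContDiff ℝ 1 (X i)) (ψ : Euc n → ℝ)
    (hψ : ContDiff ℝ 1 ψ) (hc : HasCompactSupport ψ) :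
    ∫ x, ∑ i, X i x * fderiv ℝ ψ x (EuclideanSpace.single i 1)
      = - ∫ x, (∑ i, fderiv ℝ (X i) x (EuclideanSpace.single i 1)) * ψ x := by
  have hψ' : ∀ v, Continuous fun x => fderiv ℝ ψ x v := fun v =>
    (hψ.continuous_fderiv (by norm_num)).clm_apply continuous_const
  have hX' : ∀ i v, Continuous fun x => fderiv ℝ (X i) x v := fun i v =>
    ((hX i).continuous_fderiv (by norm_num)).clm_apply continuous_const
  have i1 : ∀ i v, Integrable fun x => X i x * fderiv ℝ ψ x v := fun i v =>
    ((hX i).continuous.mul (hψ' v)).integrable_of_hasCompactSupport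
      ((hc.fderiv_apply (𝕜 := ℝ) v).mul_left)
  have i2 : ∀ i v, Integrable fun x => fderiv ℝ (X i) x v * ψ x := fun i v =>
    ((hX' i v).mul hψ.continuous).integrable_of_hasCompactSupport hc.mul_left
  have i3 : ∀ i, Integrable fun x => X i x * ψ x := fun i =>
    ((hX i).continuous.mul hψ.continuous).integrable_of_hasCompactSupport hc.mul_left
  simp only [Finset.sum_mul]
  rw [integral_finsetSum _ (fun i _ => i1 i _), integral_finsetSum _ (fun i _ => i2 i _),
    ← Finset.sum_neg_distrib]
  refine Finset.sum_congr rfl fun i _ => ?_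
  exact integral_mul_fderiv_eq_neg_fderiv_mul_of_integrable (i2 i _) (i1 i _) (i3 i)
    (fun x _ => (hX i).differentiable (by norm_num) x) (fun x _ => hψ.differentiable (by norm_num) x)

lemma slab_isOpen {n : ℕ} (T : ℝ) : IsOpen (Set.Ioo 0 T ×ˢ (Set.univ : Set (Euc n))) :=
  isOpen_Ioo.prod isOpen_univ

lemma slice_contDiff {n : ℕ} {T : ℝ} {F : Type*} [NormedAddCommGroup F] [NormedSpace ℝ F]
    {m : WithTop ℕ∞} (Y : ℝ × Euc n → F)
    (hY : ContDiffOn ℝ m Y (Set.Ioo 0 T ×ˢ Set.univ)) {t : ℝ} (ht : t ∈ Set.Ioo 0 T) :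
    ContDiff ℝ m (fun x => Y (t, x)) := by
  have h : ContDiff ℝ m (fun x : Euc n => (t, x)) := contDiff_const.prodMk contDiff_id
  rw [← contDiffOn_univ]
  exact hY.comp h.contDiffOn (fun x _ => ⟨ht, trivial⟩)

lemma slice_fderiv {n : ℕ} {T : ℝ} {F : Type*} [NormedAddCommGroup F] [NormedSpace ℝ F]
    (Y : ℝ × Euc n → F)
    (hY : ContDiffOn ℝ 1 Y (Set.Ioo 0 T ×ˢ Set.univ)) {t : ℝ} (ht : t ∈ Set.Ioo 0 T)
    (x v : Euc n) :
    fderiv ℝ (fun x => Y (t, x)) x v = fderiv ℝ Y (t, x) (0, v) := by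
  have hd : DifferentiableAt ℝ Y (t, x) :=
    (hY.contDiffAt ((slab_isOpen T).mem_nhds ⟨ht, trivial⟩)).differentiableAt (by norm_num)
  have h : HasFDerivAt (fun x : Euc n => (t, x)) (ContinuousLinearMap.inr ℝ ℝ (Euc n)) x :=
    hasFDerivAt_prodMk_right t x
  have h2 : HasFDerivAt (fun x => Y (t, x)) _ x := hd.hasFDerivAt.comp x h
  rw [h2.fderiv]
  simp

lemma time_deriv {n : ℕ} {T : ℝ} (F : ℝ × Euc n → ℝ)
    (hF : ContDiffOn ℝ 1 F (Set.Ioo 0 T ×ˢ Set.univ)) {t : ℝ} (ht : t ∈ Set.Ioo 0 T)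
    (x : Euc n) : HasDerivAt (fun t => F (t, x)) (fderiv ℝ F (t, x) (1, 0)) t := by
  have hd : DifferentiableAt ℝ F (t, x) :=
    (hF.contDiffAt ((slab_isOpen T).mem_nhds ⟨ht, trivial⟩)).differentiableAt (by norm_num)
  have h : HasFDerivAt (fun t : ℝ => (t, x)) (ContinuousLinearMap.inl ℝ ℝ (Euc n)) t :=
    hasFDerivAt_prodMk_left t x
  have h2 : HasFDerivAt (fun t => F (t, x)) _ t := hd.hasFDerivAt.comp t h
  have := h2.hasDerivAt
  simpa using this

/-- spatial directions in space-time -/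
def sdir (n : ℕ) (i : Fin n) : ℝ × Euc n := (0, EuclideanSpace.single i 1)

lemma ibp_slice {n : ℕ} {T : ℝ} (Y : Fin n → ℝ × Euc n → ℝ)
    (hY : ∀ i, ContDiffOn ℝ 1 (Y i) (Set.Ioo 0 T ×ˢ Set.univ)) {t : ℝ} (ht : t ∈ Set.Ioo 0 T)
    (ψ : Euc n → ℝ) (hψ : ContDiff ℝ 1 ψ) (hc : HasCompactSupport ψ) :
    ∫ x, ∑ i, Y i (t, x) * fderiv ℝ ψ x (EuclideanSpace.single i 1)
      = - ∫ x, (∑ i, fderiv ℝ (Y i) (t, x) (sdir n i)) * ψ x := by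
  rw [ibp_jac (fun i x => Y i (t, x)) (fun i => slice_contDiff _ (hY i) ht) ψ hψ hc]
  simp only [slice_fderiv _ (hY _) ht, sdir]

lemma time_evol {n : ℕ} {T : ℝ} (F : ℝ × Euc n → ℝ) (Y : Fin n → ℝ × Euc n → ℝ)
    (hF : ContDiffOn ℝ 1 F (Set.Ioo 0 T ×ˢ Set.univ))
    (hY : ∀ i, ContDiffOn ℝ 1 (Y i) (Set.Ioo 0 T ×ˢ Set.univ))
    (hFY : ∀ p ∈ Set.Ioo 0 T ×ˢ Set.univ, fderiv ℝ F p (1, 0) = ∑ i, fderiv ℝ (Y i) p (sdir n i))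
    {t₁ t₂ : ℝ} (h₁ : t₁ ∈ Set.Ioo 0 T) (h₂ : t₂ ∈ Set.Ioo 0 T) (h12 : t₁ ≤ t₂)
    (ψ : Euc n → ℝ) (hψ : ContDiff ℝ 1 ψ) (hc : HasCompactSupport ψ) :
    (∫ x, F (t₂, x) * ψ x) - ∫ x, F (t₁, x) * ψ x
      = - ∫ t in Set.Ioc t₁ t₂, ∫ x, ∑ i, Y i (t, x) * fderiv ℝ ψ x (EuclideanSpace.single i 1)
      := by
  have hsub : Set.Icc t₁ t₂ ⊆ Set.Ioo 0 T := fun t ht => ⟨h₁.1.trans_le ht.1, ht.2.trans_lt h₂.2⟩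
  have hdF : ContinuousOn (fun p => fderiv ℝ F p (1, 0)) (Set.Ioo 0 T ×ˢ Set.univ) :=
    (hF.continuousOn_fderiv_of_isOpen (slab_isOpen T) (by norm_num)).clm_apply continuousOn_const
  have iF : ∀ t ∈ Set.Ioo 0 T, Integrable fun x => F (t, x) * ψ x := fun t ht =>
    ((slice_contDiff F hF ht).continuous.mul hψ.continuous).integrable_of_hasCompactSupport
      hc.mul_left
  rw [← integral_sub (iF _ h₂) (iF _ h₁)]
  have e1 : ∀ x, F (t₂, x) * ψ x - F (t₁, x) * ψ x
      = ∫ t in Set.Ioc t₁ t₂, fderiv ℝ F (t, x) (1, 0) * ψ x := by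
    intro x
    have hcont : ContinuousOn (fun t => fderiv ℝ F (t, x) (1, 0)) (Set.uIcc t₁ t₂) := by
      rw [Set.uIcc_of_le h12]
      exact hdF.comp (by fun_prop) (fun t ht => ⟨hsub ht, trivial⟩)
    have := intervalIntegral.integral_eq_sub_of_hasDerivAt (f := fun t => F (t, x))
      (a := t₁) (b := t₂) (fun t ht => time_deriv F hF (hsub (by rwa [Set.uIcc_of_le h12] at ht)) x)
      hcont.intervalIntegrable
    rw [intervalIntegral.integral_of_le h12] at this
    rw [integral_mul_const, this]
    ring
  simp only [e1]
  rw [integral_integral_swap]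
  · rw [← integral_neg]
    refine setIntegral_congr_fun measurableSet_Ioc fun t ht => ?_
    have ht' := hsub ⟨ht.1.le, ht.2⟩
    rw [ibp_slice Y hY ht' ψ hψ hc, neg_neg]
    refine integral_congr_ae (Eventually.of_forall fun x => ?_)
    simp only
    rw [hFY (t, x) ⟨ht', trivial⟩]
  · have : (volume : Measure (Euc n)).prod (volume.restrict (Set.Ioc t₁ t₂))
        = (volume.prod volume).restrict (Set.univ ×ˢ Set.Ioc t₁ t₂) := by
      rw [← Measure.prod_restrict, Measure.restrict_univ]
    rw [this]
    have hK : IsCompact (tsupport ψ ×ˢ Set.Icc t₁ t₂) := IsCompact.prod hc isCompact_Icc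
    have hI : IntegrableOn (Function.uncurry fun (x : Euc n) (t : ℝ) =>
        fderiv ℝ F (t, x) (1, 0) * ψ x) (tsupport ψ ×ˢ Set.Icc t₁ t₂)
        ((volume : Measure (Euc n)).prod (volume : Measure ℝ)) := by
      apply ContinuousOn.integrableOn_compact hK
      apply ContinuousOn.mul
      · exact hdF.comp (f := fun z : Euc n × ℝ => (z.2, z.1)) (by fun_prop)
          (fun z hz => ⟨hsub hz.2, trivial⟩)
      · exact (hψ.continuous.comp continuous_fst).continuousOn
    refine (hI.of_forall_sdiff_eq_zero (t := Set.univ ×ˢ Set.Icc t₁ t₂)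
      (MeasurableSet.univ.prod measurableSet_Icc) ?_).mono_set
      (Set.prod_mono le_rfl Set.Ioc_subset_Icc_self)
    rintro ⟨x, t⟩ ⟨h1, h2⟩
    have : x ∉ tsupport ψ := fun h => h2 ⟨h, h1.2⟩
    simp [Function.uncurry, image_eq_zero_of_notMem_tsupport this]

end A3S

section A4S

lemma adj_mul_bound {n : ℕ} (hn : 2 ≤ n) (A : Matrix (Fin n) (Fin n) ℝ) (w d : ℝ) (hd : 0 ≤ d)
    (hA : ∀ i j, |A i j| ≤ d) (hw : |w| ≤ d) (i j : Fin n) :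
    |A.adjugate i j * w| ≤ (n.factorial : ℝ) * d ^ n := by
  rcases hd.eq_or_lt with h0 | h0
  · subst h0
    have : w = 0 := by simpa using hw
    subst this
    simp [show n ≠ 0 by omega]
  · set B : Matrix (Fin n) (Fin n) ℝ := d⁻¹ • A with hB
    have hAB : A = d • B := by
      rw [hB, smul_smul, mul_inv_cancel₀ h0.ne', one_smul]
    have hB1 : ∀ i j, |B i j| ≤ 1 := by
      intro i j
      rw [hB, Matrix.smul_apply, smul_eq_mul, abs_mul, abs_inv, abs_of_pos h0]
      rw [inv_mul_le_iff₀ h0]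
      simpa using hA i j
    have hadj : |B.adjugate i j| ≤ n.factorial := by
      rw [Matrix.adjugate_apply]
      have := Matrix.det_le (R := ℝ) (S := ℝ) (A := B.updateRow j (Pi.single i 1))
        (abv := AbsoluteValue.abs) (x := 1) (by
          intro x y
          by_cases hx : x = j
          · subst hx
            rw [Matrix.updateRow_self]
            by_cases hy : y = i
            · subst hy; simp
            · simp [Pi.single_apply, hy]
          · rw [Matrix.updateRow_ne hx]
            simpa using hB1 x y)
      simpa using this
    rw [hAB, Matrix.adjugate_smul, Matrix.smul_apply, smul_eq_mul, Fintype.card_fin, abs_mul,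
      abs_mul, abs_of_nonneg (pow_nonneg hd _)]
    calc d ^ (n - 1) * |B.adjugate i j| * |w| ≤ d ^ (n - 1) * n.factorial * d := by gcongr
      _ = n.factorial * (d ^ (n - 1) * d) := by ring
      _ = n.factorial * d ^ n := by rw [pow_sub_one_mul (by omega)]

lemma contDiffOn_dirJac {n : ℕ} {T : ℝ} (U : ℝ × Euc n → Euc n)
    (hU : ContDiffOn ℝ 2 U (Set.Ioo 0 T ×ˢ Set.univ)) (e : Fin n → ℝ × Euc n) (i j : Fin n) :
    ContDiffOn ℝ 1 (fun q => dirJac U e q i j) (Set.Ioo 0 T ×ˢ Set.univ) := by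
  have h1 : ContDiffOn ℝ 1 (fun q => fderiv ℝ U q (e j)) (Set.Ioo 0 T ×ˢ Set.univ) :=
    (hU.fderiv_of_isOpen (slab_isOpen T) (by norm_num)).clm_apply contDiffOn_const
  exact (EuclideanSpace.proj (𝕜 := ℝ) i).contDiff.comp_contDiffOn h1

lemma contDiffOn_det_of {V : Type*} [NormedAddCommGroup V] [NormedSpace ℝ V] {n : ℕ} {s : Set V}
    (M : V → Matrix (Fin n) (Fin n) ℝ) (h : ∀ i j, ContDiffOn ℝ 1 (fun q => M q i j) s) :
    ContDiffOn ℝ 1 (fun q => (M q).det) s := by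
  simp only [Matrix.det_apply']
  refine ContDiffOn.sum fun σ _ => contDiffOn_const.mul (contDiffOn_prod fun i _ => h _ _)

lemma contDiffOn_adj_of {V : Type*} [NormedAddCommGroup V] [NormedSpace ℝ V] {n : ℕ} {s : Set V}
    (M : V → Matrix (Fin n) (Fin n) ℝ) (h : ∀ i j, ContDiffOn ℝ 1 (fun q => M q i j) s)
    (i j : Fin n) :
    ContDiffOn ℝ 1 (fun q => (M q).adjugate i j) s := by
  simp only [Matrix.adjugate_apply]
  refine contDiffOn_det_of _ fun k m => ?_
  by_cases hk : k = j
  · subst hk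
    simp only [Matrix.updateRow_self]
    exact contDiffOn_const
  · simp only [Matrix.updateRow_ne hk]
    exact h k m

/-- the regularized pairing at time `t` -/
def regP (n : ℕ) (U : ℝ × Euc n → Euc n) (K : Euc n → Euc n) (ψ : Euc n → ℝ) (t : ℝ) : ℝ :=
  ∫ x, ∑ i, (∑ j, (dirJac U (sdir n) (t, x)).adjugate i j * K (U (t, x)) j) *
    fderiv ℝ ψ x (EuclideanSpace.single i 1)

/-- the flux in the time derivative -/
def fluxY (n : ℕ) (U : ℝ × Euc n → Euc n) (χ : Euc n → ℝ) (i : Fin n) (q : ℝ × Euc n) : ℝ :=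
  ∑ j, (dirJac U (sdir n) q).adjugate i j * (χ (U q) * fderiv ℝ U q (1, 0) j)

lemma regP_diff {n : ℕ} {T : ℝ} (U : ℝ × Euc n → Euc n)
    (hU : ContDiffOn ℝ 2 U (Set.Ioo 0 T ×ˢ Set.univ)) (K : Euc n → Euc n) (χ : Euc n → ℝ)
    (hK : ContDiff ℝ 1 K) (hχ : ContDiff ℝ 1 χ)
    (hdiv : ∀ y, ∑ j, fderiv ℝ K y (EuclideanSpace.single j 1) j = χ y)
    {t₁ t₂ : ℝ} (h₁ : t₁ ∈ Set.Ioo 0 T) (h₂ : t₂ ∈ Set.Ioo 0 T) (h12 : t₁ ≤ t₂)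
    (ψ : Euc n → ℝ) (hψ : ContDiff ℝ 1 ψ) (hc : HasCompactSupport ψ) :
    regP n U K ψ t₂ - regP n U K ψ t₁
      = ∫ t in Set.Ioc t₁ t₂, ∫ x, ∑ i, fluxY n U χ i (t, x) *
          fderiv ℝ ψ x (EuclideanSpace.single i 1) := by
  have hU1 : ContDiffOn ℝ 1 U (Set.Ioo 0 T ×ˢ Set.univ) := hU.of_le (by norm_num)
  have hadj := contDiffOn_adj_of (fun q => dirJac U (sdir n) q)
    (contDiffOn_dirJac U hU (sdir n))
  have hat : ∀ p ∈ Set.Ioo 0 T ×ˢ (Set.univ : Set (Euc n)), ContDiffAt ℝ 2 U p := fun p hp =>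
    hU.contDiffAt ((slab_isOpen T).mem_nhds hp)
  have hX : ∀ i, ContDiffOn ℝ 1 (fun q => ∑ j, (dirJac U (sdir n) q).adjugate i j * K (U q) j)
      (Set.Ioo 0 T ×ˢ Set.univ) := fun i => ContDiffOn.sum fun j _ => (hadj i j).mul
        (((EuclideanSpace.proj (𝕜 := ℝ) j).contDiff.comp hK).comp_contDiffOn hU1)
  have hY : ∀ i, ContDiffOn ℝ 1 (fluxY n U χ i) (Set.Ioo 0 T ×ˢ Set.univ) := fun i =>
    ContDiffOn.sum fun j _ => (hadj i j).mul ((hχ.comp_contDiffOn hU1).mul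
      (contDiffOn_dirJac U hU (fun _ => (1, 0)) j j))
  have hF : ContDiffOn ℝ 1 (fun q => χ (U q) * (dirJac U (sdir n) q).det)
      (Set.Ioo 0 T ×ˢ Set.univ) := (hχ.comp_contDiffOn hU1).mul
        (contDiffOn_det_of _ (contDiffOn_dirJac U hU (sdir n)))
  have hP : ∀ t ∈ Set.Ioo 0 T, regP n U K ψ t
      = - ∫ x, (χ (U (t, x)) * (dirJac U (sdir n) (t, x)).det) * ψ x := by
    intro t ht
    rw [regP, ibp_slice _ hX ht ψ hψ hc]
    congr 2
    ext x
    rw [div_jac_one U (sdir n) (t, x) (hat _ ⟨ht, trivial⟩) K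
      (hK.differentiable (by norm_num) _), hdiv]
  have := time_evol _ (fluxY n U χ) hF hY (fun p hp => div_jac_two U (sdir n) (1, 0) p (hat p hp) χ
    (hχ.differentiable (by norm_num) _)) h₁ h₂ h12 ψ hψ hc
  rw [hP _ h₁, hP _ h₂]
  linarith

lemma flux_bound {n : ℕ} (hn : 2 ≤ n) (U : ℝ × Euc n → Euc n) (χ : Euc n → ℝ)
    (hχ0 : ∀ y, 0 ≤ χ y) (ψ : Euc n → ℝ) (M : ℝ)
    (hM : ∀ x i, |fderiv ℝ ψ x (EuclideanSpace.single i 1)| ≤ M) (t : ℝ) (x : Euc n) :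
    |∑ i, fluxY n U χ i (t, x) * fderiv ℝ ψ x (EuclideanSpace.single i 1)|
      ≤ (M * (n * (n * n.factorial))) * (χ (U (t, x)) * ‖fderiv ℝ U (t, x)‖ ^ n) := by
  have hcoord : ∀ v : Euc n, ∀ j, |v j| ≤ ‖v‖ := fun v j => by
    simpa using PiLp.norm_apply_le v j
  have hJ : ∀ i j, |dirJac U (sdir n) (t, x) i j| ≤ ‖fderiv ℝ U (t, x)‖ := by
    intro i j
    refine (hcoord _ i).trans ?_
    refine (ContinuousLinearMap.le_opNorm _ _).trans ?_
    have : ‖sdir n j‖ = 1 := by simp [sdir, Prod.norm_def]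
    rw [this, mul_one]
  have hτ : ∀ j, |fderiv ℝ U (t, x) (1, 0) j| ≤ ‖fderiv ℝ U (t, x)‖ := by
    intro j
    refine (hcoord _ j).trans ?_
    refine (ContinuousLinearMap.le_opNorm _ _).trans ?_
    have : ‖((1, 0) : ℝ × Euc n)‖ = 1 := by simp [Prod.norm_def]
    rw [this, mul_one]
  have hM0 : 0 ≤ M := (abs_nonneg _).trans (hM x ⟨0, by omega⟩)
  set d := ‖fderiv ℝ U (t, x)‖
  set c := χ (U (t, x)) with hc
  have hc0 : 0 ≤ c := hχ0 _
  have hY : ∀ i, |fluxY n U χ i (t, x)| ≤ n * (n.factorial * d ^ n * c) := by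
    intro i
    unfold fluxY
    refine (Finset.abs_sum_le_sum_abs _ _).trans ?_
    have : ∀ j ∈ (Finset.univ : Finset (Fin n)), |(dirJac U (sdir n) (t, x)).adjugate i j *
        (χ (U (t, x)) * fderiv ℝ U (t, x) (1, 0) j)| ≤ n.factorial * d ^ n * c := by
      intro j _
      have h1 := adj_mul_bound hn _ _ d (norm_nonneg _) hJ (hτ j) i j
      rw [mul_left_comm, abs_mul, abs_of_nonneg hc0, mul_comm]
      gcongr
    refine (Finset.sum_le_sum this).trans ?_
    simp
  refine (Finset.abs_sum_le_sum_abs _ _).trans ?_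
  have : ∀ i ∈ (Finset.univ : Finset (Fin n)), |fluxY n U χ i (t, x) *
      fderiv ℝ ψ x (EuclideanSpace.single i 1)| ≤ n * (n.factorial * d ^ n * c) * M := by
    intro i _
    rw [abs_mul]
    have := hY i
    have := hM x i
    gcongr
  refine (Finset.sum_le_sum this).trans ?_
  simp only [Finset.sum_const, Finset.card_univ, Fintype.card_fin, nsmul_eq_mul]
  apply le_of_eq; ring

lemma regP_bound {n : ℕ} (hn : 2 ≤ n) {T : ℝ} (Ω : Set (Euc n)) (U : ℝ × Euc n → Euc n)
    (hUm : Measurable U)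
    (hU : ContDiffOn ℝ 2 U (Set.Ioo 0 T ×ˢ Set.univ)) (K : Euc n → Euc n) (χ : Euc n → ℝ)
    (hK : ContDiff ℝ 1 K) (hχ : ContDiff ℝ 1 χ) (hχ0 : ∀ y, 0 ≤ χ y)
    (hdiv : ∀ y, ∑ j, fderiv ℝ K y (EuclideanSpace.single j 1) j = χ y)
    {t₁ t₂ s : ℝ} (h₁ : t₁ ∈ Set.Ioo 0 T) (h₂ : t₂ ∈ Set.Ioo 0 T) (h1s : t₁ ≤ s) (h2s : t₂ ≤ s)
    (ψ : Euc n → ℝ) (hψ : Cc1 n Ω ψ) (M : ℝ)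
    (hM : ∀ x i, |fderiv ℝ ψ x (EuclideanSpace.single i 1)| ≤ M) :
    ENNReal.ofReal |regP n U K ψ t₂ - regP n U K ψ t₁| ≤
      ENNReal.ofReal (M * (n * (n * n.factorial))) *
        ∫⁻ p, ENNReal.ofReal (χ (U p)) * ‖fderiv ℝ U p‖ₑ ^ n
          ∂((volume.restrict (Set.Ioc 0 s)).prod (volume.restrict Ω)) := by
  wlog h12 : t₁ ≤ t₂ generalizing t₁ t₂
  · rw [abs_sub_comm]
    exact this h₂ h₁ h2s h1s (le_of_not_ge h12)
  have hM0 : 0 ≤ M := (abs_nonneg _).trans (hM 0 ⟨0, by omega⟩)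
  rw [regP_diff U hU K χ hK hχ hdiv h₁ h₂ h12 ψ hψ.1 hψ.2.1, ← Real.enorm_eq_ofReal_abs]
  have hmeas : Measurable fun p => ENNReal.ofReal (χ (U p)) * ‖fderiv ℝ U p‖ₑ ^ n :=
    ((hχ.continuous.measurable.comp hUm).ennreal_ofReal).mul
      ((measurable_fderiv ℝ U).enorm.pow_const n)
  rw [lintegral_prod _ hmeas.aemeasurable, ← lintegral_const_mul' _ _ ENNReal.ofReal_ne_top]
  refine (enorm_integral_le_lintegral_enorm _).trans ?_
  refine (lintegral_mono_set (Set.Ioc_subset_Ioc h₁.1.le h2s)).trans ?_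
  refine lintegral_mono fun t => ?_
  rw [← lintegral_const_mul' _ _ ENNReal.ofReal_ne_top]
  refine (enorm_integral_le_lintegral_enorm _).trans ?_
  have hsupp : ∀ x, x ∉ Ω → ‖∑ i, fluxY n U χ i (t, x) *
      fderiv ℝ ψ x (EuclideanSpace.single i 1)‖ₑ = 0 := by
    intro x hx
    have : x ∉ tsupport ψ := fun h => hx (hψ.2.2 h)
    simp [fderiv_zero_off this]
  have : ∫⁻ x, ‖∑ i, fluxY n U χ i (t, x) * fderiv ℝ ψ x (EuclideanSpace.single i 1)‖ₑ
      ≤ ∫⁻ x in Ω, ‖∑ i, fluxY n U χ i (t, x) * fderiv ℝ ψ x (EuclideanSpace.single i 1)‖ₑ := by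
    rw [setLIntegral_eq_of_support_subset]
    intro x hx
    by_contra h
    exact hx (hsupp x h)
  refine this.trans (lintegral_mono fun x => ?_)
  rw [Real.enorm_eq_ofReal_abs]
  refine (ENNReal.ofReal_le_ofReal (flux_bound hn U χ hχ0 ψ M hM t x)).trans ?_
  rw [ENNReal.ofReal_mul (by positivity), ENNReal.ofReal_mul (hχ0 _),
    ENNReal.ofReal_pow (norm_nonneg _), ofReal_norm]

end A4S

section A5S

/-- regularised kernel -/
def kerK (n : ℕ) (ε : ℝ) (a : Euc n) (y : Euc n) : Euc n :=
  ((n : ℝ)⁻¹ * (‖y - a‖ ^ 2 + ε ^ 2) ^ (-(n : ℝ) / 2)) • (y - a)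

/-- its divergence -/
def kerX (n : ℕ) (ε : ℝ) (a : Euc n) (y : Euc n) : ℝ :=
  ε ^ 2 * (‖y - a‖ ^ 2 + ε ^ 2) ^ (-(n : ℝ) / 2 - 1)

/-- singular kernel -/
def kerZ (n : ℕ) (y : Euc n) : Euc n := ((n : ℝ)⁻¹ * (‖y‖ ^ n)⁻¹) • y

lemma ker_pos {n : ℕ} {ε : ℝ} (hε : 0 < ε) (a y : Euc n) : 0 < ‖y - a‖ ^ 2 + ε ^ 2 := by
  positivity

lemma kerK_contDiff {n : ℕ} {ε : ℝ} (hε : 0 < ε) (a : Euc n) : ContDiff ℝ 1 (kerK n ε a) := by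
  unfold kerK
  have h1 : ContDiff ℝ 1 (fun y : Euc n => ‖y - a‖ ^ 2 + ε ^ 2) :=
    ((contDiff_id.sub contDiff_const).norm_sq ℝ).add contDiff_const
  exact (contDiff_const.mul (h1.rpow_const_of_ne fun y => (ker_pos hε a y).ne')).smul
    (contDiff_id.sub contDiff_const)

lemma kerX_contDiff {n : ℕ} {ε : ℝ} (hε : 0 < ε) (a : Euc n) : ContDiff ℝ 1 (kerX n ε a) := by
  unfold kerX
  have h1 : ContDiff ℝ 1 (fun y : Euc n => ‖y - a‖ ^ 2 + ε ^ 2) :=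
    ((contDiff_id.sub contDiff_const).norm_sq ℝ).add contDiff_const
  exact contDiff_const.mul (h1.rpow_const_of_ne fun y => (ker_pos hε a y).ne')

lemma kerX_nonneg (n : ℕ) (ε : ℝ) (a y : Euc n) : 0 ≤ kerX n ε a y := by
  unfold kerX; positivity

lemma kerK_div {n : ℕ} (hn : 2 ≤ n) {ε : ℝ} (hε : 0 < ε) (a y : Euc n) :
    ∑ j, fderiv ℝ (kerK n ε a) y (EuclideanSpace.single j 1) j = kerX n ε a y := by
  have hn0 : (n : ℝ) ≠ 0 := by positivity
  have hg := ker_pos hε a y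
  set g := ‖y - a‖ ^ 2 + ε ^ 2 with hgd
  have h1 : HasFDerivAt (fun y : Euc n => ‖y - a‖ ^ 2 + ε ^ 2)
      ((2 : ℕ) • (innerSL ℝ (y - a))) y := by
    have := ((hasFDerivAt_id y).sub_const a).norm_sq
    simpa using this.add_const (ε ^ 2)
  have h2 : HasFDerivAt (fun y : Euc n => (‖y - a‖ ^ 2 + ε ^ 2) ^ (-(n : ℝ) / 2))
      (((-(n : ℝ) / 2) * g ^ (-(n : ℝ) / 2 - 1)) • ((2 : ℕ) • (innerSL ℝ (y - a)))) y :=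
    h1.rpow_const (Or.inl hg.ne')
  have h3 := (h2.const_mul ((n : ℝ)⁻¹)).fun_smul ((hasFDerivAt_id y).sub_const a)
  have h4 : HasFDerivAt (kerK n ε a) _ y := h3
  rw [h4.fderiv]
  have e1 : ∀ j : Fin n, inner ℝ (y - a) (EuclideanSpace.single j (1:ℝ)) = (y - a) j := by
    intro j; simp [EuclideanSpace.inner_single_right]
  have hsum : ∑ j, (y - a) j * (y - a) j = ‖y - a‖ ^ 2 := by
    rw [EuclideanSpace.norm_sq_eq]; simp [sq]
  have key : ∀ j : Fin n, ((((n : ℝ)⁻¹ * g ^ (-(n : ℝ) / 2)) • ContinuousLinearMap.id ℝ (Euc n) + ((n : ℝ)⁻¹ • (((-(n : ℝ) / 2) * g ^ (-(n : ℝ) / 2 - 1)) • ((2 : ℕ) • (innerSL ℝ (y - a))))).smulRight (y - a)) (EuclideanSpace.single j (1:ℝ))) j = (n:ℝ)⁻¹ * g ^ (-(n : ℝ) / 2) - g ^ (-(n : ℝ) / 2 - 1) * ((y-a) j * (y-a) j) := by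
    intro j
    have := e1 j
    simp only [add_apply, smul_apply, ContinuousLinearMap.smulRight_apply, innerSL_apply_apply, this, ContinuousLinearMap.id_apply, PiLp.add_apply, PiLp.smul_apply, smul_eq_mul, nsmul_eq_mul]
    simp
    field_simp
    ring
  have key2 := Finset.sum_congr (rfl : (Finset.univ : Finset (Fin n)) = Finset.univ) (fun j _ => key j)
  refine Eq.trans ?_ (key2.trans ?_)
  · rfl
  · rw [Finset.sum_sub_distrib, ← Finset.mul_sum, ← Finset.mul_sum, hsum]
    simp only [Finset.sum_const, Finset.card_univ, Fintype.card_fin, nsmul_eq_mul]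
    have : g ^ (-(n : ℝ) / 2) = g ^ (-(n : ℝ) / 2 - 1) * g := by
      rw [← Real.rpow_add_one hg.ne']; congr 1; ring
    unfold kerX
    have h5 : ‖y - a‖ ^ 2 = g - ε ^ 2 := by rw [hgd]; ring
    rw [← hgd, this, inv_mul_cancel_left₀ hn0, h5]
    ring

lemma kerX_scale {n : ℕ} {ε : ℝ} (hε : 0 < ε) (z : Euc n) :
    kerX n ε 0 z = (ε ^ n)⁻¹ * kerX n 1 0 (ε⁻¹ • z) := by
  unfold kerX
  have : ‖z - 0‖ ^ 2 + ε ^ 2 = ε ^ 2 * (‖ε⁻¹ • z - 0‖ ^ 2 + 1 ^ 2) := by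
    rw [sub_zero, sub_zero, norm_smul, norm_inv, Real.norm_of_nonneg hε.le]
    field_simp
  rw [this, Real.mul_rpow (by positivity) (by positivity)]
  have : (ε ^ 2) ^ (-(n : ℝ) / 2 - 1) = (ε ^ n)⁻¹ * (ε ^ 2)⁻¹ := by
    rw [Real.rpow_sub_one (by positivity), ← Real.rpow_natCast ε 2, ← Real.rpow_mul hε.le,
      ← Real.rpow_natCast ε n, ← Real.rpow_neg hε.le, div_eq_mul_inv]
    congr 2; push_cast; ring
  rw [this]
  field_simp

lemma kerX_lintegral_one (n : ℕ) : ∫⁻ z, ENNReal.ofReal (kerX n 1 0 z) < ∞ := by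
  have h := integrable_rpow_neg_one_add_norm_sq (E := Euc n) (μ := volume) (r := n + 2) (by simp)
  have h2 : Integrable (kerX n 1 0) := by
    refine h.congr (Eventually.of_forall fun z => ?_)
    unfold kerX
    simp only [sub_zero, one_pow, one_mul]
    rw [add_comm]; congr 1; ring
  have := h2.hasFiniteIntegral
  rw [hasFiniteIntegral_iff_enorm] at this
  refine lt_of_eq_of_lt (lintegral_congr fun z => ?_) this
  rw [Real.enorm_of_nonneg (kerX_nonneg _ _ _ _)]

lemma kerX_lintegral {n : ℕ} {ε : ℝ} (hε : 0 < ε) (y : Euc n) :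
    ∫⁻ a, ENNReal.ofReal (kerX n ε a y) = ∫⁻ z, ENNReal.ofReal (kerX n 1 0 z) := by
  have h1 : ∀ a, kerX n ε a y = kerX n ε 0 (y - a) := by intro a; simp [kerX]
  simp_rw [h1]
  rw [lintegral_sub_left_eq_self (fun z => ENNReal.ofReal (kerX n ε 0 z)) y]
  simp_rw [kerX_scale hε]
  have hε' : ε⁻¹ ≠ 0 := by positivity
  have hm : Measurable (fun z : Euc n => ENNReal.ofReal (kerX n 1 0 z)) :=
    ENNReal.measurable_ofReal.comp (kerX_contDiff one_pos 0).continuous.measurable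
  have h2 : ∫⁻ z, ENNReal.ofReal (kerX n 1 0 (ε⁻¹ • z)) =
      ENNReal.ofReal (ε ^ n) * ∫⁻ z, ENNReal.ofReal (kerX n 1 0 z) := by
    rw [← lintegral_map (f := fun z : Euc n => ENNReal.ofReal (kerX n 1 0 z)) hm
      (measurable_const_smul ε⁻¹), Measure.map_addHaar_smul volume hε', lintegral_smul_measure]
    simp [abs_of_pos hε]
  have hm2 : Measurable (fun z : Euc n => ENNReal.ofReal (kerX n 1 0 (ε⁻¹ • z))) :=
    hm.comp (measurable_const_smul ε⁻¹)
  simp_rw [ENNReal.ofReal_mul (inv_nonneg.2 (pow_nonneg hε.le n))]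
  rw [lintegral_const_mul _ hm2, h2, ← mul_assoc, ← ENNReal.ofReal_mul (by positivity),
    inv_mul_cancel₀ (by positivity)]
  simp

lemma kerK_tendsto {n : ℕ} {a y : Euc n} (h : y ≠ a) :
    Tendsto (fun m : ℕ => kerK n (1 / ((m : ℝ) + 1)) a y) atTop (𝓝 (kerZ n (y - a))) := by
  have h0 : 0 < ‖y - a‖ := norm_pos_iff.2 (sub_ne_zero.2 h)
  unfold kerK kerZ
  refine Tendsto.smul_const (Tendsto.const_mul _ ?_) _
  have e1 : Tendsto (fun m : ℕ => ‖y - a‖ ^ 2 + (1 / ((m : ℝ) + 1)) ^ 2) atTop (𝓝 (‖y - a‖ ^ 2)) := by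
    have := (tendsto_one_div_add_atTop_nhds_zero_nat (𝕜 := ℝ)).pow 2
    simpa using this.const_add (‖y - a‖ ^ 2)
  have e2 := e1.rpow_const (p := -(n : ℝ) / 2) (Or.inl (by positivity))
  convert e2 using 2
  rw [← Real.rpow_natCast _ 2, ← Real.rpow_mul h0.le, ← Real.rpow_natCast _ n, ← Real.rpow_neg h0.le]
  congr 1; push_cast; ring

lemma kerK_bound {n : ℕ} (hn : 2 ≤ n) {ε : ℝ} {a y : Euc n} (h : y ≠ a) :
    ‖kerK n ε a y‖ ≤ (‖y - a‖ ^ (n - 1))⁻¹ := by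
  have h0 : 0 < ‖y - a‖ := norm_pos_iff.2 (sub_ne_zero.2 h)
  have hn1 : (n : ℝ)⁻¹ ≤ 1 := inv_le_one_of_one_le₀ (by exact_mod_cast (by omega : 1 ≤ n))
  unfold kerK
  rw [norm_smul, Real.norm_of_nonneg (by positivity)]
  have e1 : (‖y - a‖ ^ 2 + ε ^ 2) ^ (-(n : ℝ) / 2) ≤ (‖y - a‖ ^ n)⁻¹ := by
    have : (‖y - a‖ ^ 2) ^ (-(n : ℝ) / 2) = (‖y - a‖ ^ n)⁻¹ := by
      rw [← Real.rpow_natCast _ 2, ← Real.rpow_mul h0.le, ← Real.rpow_natCast _ n,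
        ← Real.rpow_neg h0.le]
      congr 1; push_cast; ring
    rw [← this]
    apply Real.rpow_le_rpow_of_nonpos (by positivity) (by nlinarith [sq_nonneg ε])
    have : (0:ℝ) ≤ n := by positivity
    linarith
  calc (n : ℝ)⁻¹ * (‖y - a‖ ^ 2 + ε ^ 2) ^ (-(n : ℝ) / 2) * ‖y - a‖
      ≤ 1 * (‖y - a‖ ^ n)⁻¹ * ‖y - a‖ := by gcongr
    _ = (‖y - a‖ ^ (n - 1))⁻¹ := by
      obtain ⟨m, rfl⟩ : ∃ m, n = m + 1 := ⟨n - 1, by omega⟩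
      simp only [Nat.add_sub_cancel, pow_succ]
      field_simp
end A5S

section A6S

lemma adj_rank_one {n : ℕ} (f c : ℝ) (y : Fin n → ℝ) :
    ((f • (1 : Matrix (Fin n) (Fin n) ℝ) - c • Matrix.vecMulVec y y).adjugate).mulVec y =
      f ^ (n - 1) • y := by
  rw [← Matrix.cramer_eq_adjugate_mulVec]
  have h : (f ^ (n - 1) • y) = Matrix.cramer (f • (1 : Matrix (Fin n) (Fin n) ℝ)) y := by
    rw [Matrix.cramer_eq_adjugate_mulVec, Matrix.adjugate_smul]
    simp [Matrix.smul_mulVec]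
  rw [h]
  funext i
  rw [Matrix.cramer_apply, Matrix.cramer_apply, ← Matrix.det_transpose,
    ← Matrix.det_transpose ((f • (1 : Matrix (Fin n) (Fin n) ℝ)).updateCol i y)]
  refine Matrix.det_eq_of_forall_row_eq_smul_add_const
    (fun k => if k = i then 0 else - c * y k) i (by simp) ?_
  intro k j
  by_cases hk : k = i
  · subst hk; simp [Matrix.transpose_apply]
  · simp [Matrix.transpose_apply, hk, Matrix.vecMulVec_apply]
    ring

/-- Jacobian matrix of the radial projection -/
def projMat (n : ℕ) (y : Euc n) : Matrix (Fin n) (Fin n) ℝ :=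
  ‖y‖⁻¹ • (1 : Matrix (Fin n) (Fin n) ℝ) - (‖y‖ ^ 3)⁻¹ • Matrix.vecMulVec (fun j => y j) (fun j => y j)

lemma proj_jacMat {n : ℕ} (u : Euc n → Euc n) (a x : Euc n) (hd : DifferentiableAt ℝ u x)
    (hx : u x ≠ a) : jacMat n (proj n u a) x = projMat n (u x - a) * jacMat n u x := by
  have h0 : 0 < ‖u x - a‖ := norm_pos_iff.2 (sub_ne_zero.2 hx)
  set y := u x - a with hy
  have hu : HasFDerivAt (fun x => u x - a) (fderiv ℝ u x) x := hd.hasFDerivAt.sub_const a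
  have h1 : HasFDerivAt (fun x => ‖u x - a‖ ^ 2) ((2 : ℕ) • (innerSL ℝ y).comp (fderiv ℝ u x)) x :=
    hu.norm_sq
  have h2 : HasFDerivAt (fun x => (‖u x - a‖ ^ 2) ^ (-(1:ℝ)/2)) (((-(1:ℝ)/2) * (‖y‖ ^ 2) ^ (-(1:ℝ)/2 - 1)) • ((2 : ℕ) • (innerSL ℝ y).comp (fderiv ℝ u x))) x :=
    h1.rpow_const (Or.inl (by positivity))
  have h3 := h2.fun_smul hu
  have e1 : ∀ r : ℝ, 0 ≤ r → (r ^ 2) ^ (-(1:ℝ)/2) = r⁻¹ := by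
    intro r hr
    rw [← Real.rpow_natCast r 2, ← Real.rpow_mul hr, ← Real.rpow_neg_one]; congr 1; norm_num
  have e2 : (‖y‖ ^ 2) ^ (-(1:ℝ)/2 - 1) = (‖y‖ ^ 3)⁻¹ := by
    rw [Real.rpow_sub_one (by positivity), e1 _ h0.le]; field_simp
  have h4 := h3.congr_of_eventuallyEq (f₁ := proj n u a) (Eventually.of_forall fun z => by
    simp only [proj]; rw [e1 _ (norm_nonneg _)])
  rw [e1 _ h0.le, e2] at h4
  ext i j
  have hin : ∀ w : Euc n, inner ℝ y w = ∑ k, y k * w k := by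
    intro w; simp [PiLp.inner_apply, mul_comm]
  simp only [jacMat, projMat, Matrix.of_apply, h4.fderiv]
  simp only [add_apply, smul_apply, ContinuousLinearMap.smulRight_apply, innerSL_apply_apply, PiLp.add_apply, PiLp.smul_apply, smul_eq_mul, nsmul_eq_mul, ContinuousLinearMap.comp_apply, hin]
  rw [Matrix.sub_mul, Matrix.smul_mul, Matrix.smul_mul, Matrix.one_mul]
  simp only [Matrix.sub_apply, Matrix.smul_apply, Matrix.of_apply, smul_eq_mul, Matrix.mul_apply, Matrix.vecMulVec_apply]
  simp only [mul_assoc, ← Finset.mul_sum]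
  rw [← hy]
  push_cast
  ring

lemma jvec_proj {n : ℕ} (hn : 2 ≤ n) (u : Euc n → Euc n) (a x : Euc n)
    (hd : DifferentiableAt ℝ u x) (hx : u x ≠ a) (i : Fin n) :
    jvec n (proj n u a) x i = ∑ j, (jacMat n u x).adjugate i j * kerZ n (u x - a) j := by
  have h0 : 0 < ‖u x - a‖ := norm_pos_iff.2 (sub_ne_zero.2 hx)
  unfold jvec
  rw [proj_jacMat u a x hd hx, Matrix.adjugate_mul_distrib, ← Matrix.mulVec_mulVec]
  have e : (fun j => (proj n u a x) j) = ‖u x - a‖⁻¹ • (fun j => (u x - a) j) := by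
    funext j; simp [proj]
  rw [e, Matrix.mulVec_smul]
  unfold projMat
  rw [adj_rank_one, Matrix.mulVec_smul, Matrix.mulVec_smul]
  simp only [Pi.smul_apply, smul_eq_mul, Matrix.mulVec, dotProduct, kerZ, PiLp.smul_apply,
    Finset.mul_sum]
  refine Finset.sum_congr rfl fun j _ => ?_
  have : (‖u x - a‖ ^ n)⁻¹ = ‖u x - a‖⁻¹ * ‖u x - a‖⁻¹ ^ (n - 1) := by
    rw [← pow_succ', show n - 1 + 1 = n by omega, inv_pow]
  rw [this]; ring

lemma jPair_proj {n : ℕ} (hn : 2 ≤ n) (u : Euc n → Euc n) (a x : Euc n)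
    (hd : DifferentiableAt ℝ u x) (hx : u x ≠ a) (ψ : Euc n → ℝ) :
    jPair n (proj n u a) ψ x = ∑ i, (∑ j, (jacMat n u x).adjugate i j * kerZ n (u x - a) j) *
      fderiv ℝ ψ x (EuclideanSpace.single i 1) := by
  unfold jPair
  simp_rw [jvec_proj hn u a x hd hx]

lemma jacMat_slice {n : ℕ} {T : ℝ} (U : ℝ × Euc n → Euc n)
    (hU : ContDiffOn ℝ 2 U (Set.Ioo 0 T ×ˢ Set.univ)) {t : ℝ} (ht : t ∈ Set.Ioo 0 T) (x : Euc n) :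
    jacMat n (fun x => U (t, x)) x = dirJac U (sdir n) (t, x) := by
  ext i j
  simp only [jacMat, dirJac, Matrix.of_apply, sdir]
  rw [slice_fderiv U (hU.of_le (by norm_num)) ht]
end A6S

section A7S

/-- mollifier in space-time -/
def mol (n : ℕ) (η : Euc n → ℝ) (p : ℝ × Euc n) : ℝ := (p.1 ^ n)⁻¹ * η (p.1⁻¹ • p.2)

/-- scalar multiplication, flipped -/
def mL (n : ℕ) : Euc n →L[ℝ] ℝ →L[ℝ] Euc n := (ContinuousLinearMap.lsmul ℝ ℝ).flip

lemma mL_apply {n : ℕ} (v : Euc n) (c : ℝ) : mL n v c = c • v := rfl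

/-- space-time mollification -/
def molU (n : ℕ) (η : Euc n → ℝ) (w : Euc n → Euc n) (p : ℝ × Euc n) : Euc n :=
  ∫ y, mol n η (p.1, p.2 - y) • w y

lemma molU_eq_conv {n : ℕ} (η : Euc n → ℝ) (w : Euc n → Euc n) (p : ℝ × Euc n) :
    molU n η w p = (w ⋆[mL n, volume] (fun s z => mol n η (s, z)) p.1) p.2 := rfl

lemma mol_contDiffOn {n : ℕ} {η : Euc n → ℝ} (hη : ContDiff ℝ (⊤ : ℕ∞) η) {T : ℝ} (m : ℕ∞) :
    ContDiffOn ℝ m (mol n η) (Set.Ioo 0 T ×ˢ Set.univ) := by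
  unfold mol
  have h1 : ContDiffOn ℝ m (fun p : ℝ × Euc n => p.1) (Set.Ioo 0 T ×ˢ Set.univ) :=
    contDiff_fst.contDiffOn
  have h2 : ContDiffOn ℝ m (fun p : ℝ × Euc n => p.2) (Set.Ioo 0 T ×ˢ Set.univ) :=
    contDiff_snd.contDiffOn
  have hη' : ContDiff ℝ m η := hη.of_le (by exact_mod_cast le_top)
  refine ((h1.pow n).inv fun p hp => (pow_pos hp.1.1 n).ne').mul ?_
  exact hη'.comp_contDiffOn ((h1.inv fun p hp => hp.1.1.ne').smul h2)

lemma mol_zero {n : ℕ} {η : Euc n → ℝ} {R : ℝ} (hR : ∀ z, R < ‖z‖ → η z = 0) {t : ℝ} (ht : 0 < t)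
    {z : Euc n} (hz : R * t < ‖z‖) : mol n η (t, z) = 0 := by
  unfold mol
  rw [hR, mul_zero]
  simp only [norm_smul, norm_inv, Real.norm_of_nonneg ht.le]
  rw [inv_mul_eq_div, lt_div_iff₀ ht]; exact hz

lemma mol_scale {n : ℕ} (η : Euc n → ℝ) {t : ℝ} (ht : 0 < t) (p : ℝ × Euc n) :
    mol n η p = (t ^ n)⁻¹ * mol n η (t⁻¹ • p) := by
  unfold mol
  simp only [Prod.smul_fst, Prod.smul_snd, smul_eq_mul, smul_smul]
  rw [mul_pow, mul_inv, mul_inv, inv_inv, inv_pow, inv_inv, ← mul_assoc, ← mul_assoc,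
    inv_mul_cancel₀ (by positivity), one_mul]
  congr 3
  field_simp

lemma mol_fderiv_scale {n : ℕ} (η : Euc n → ℝ) {t : ℝ} (ht : 0 < t) (z : Euc n) :
    fderiv ℝ (mol n η) (t, z) = ((t ^ n)⁻¹ * t⁻¹) • fderiv ℝ (mol n η) (1, t⁻¹ • z) := by
  have h : mol n η = fun p => (t ^ n)⁻¹ • mol n η (t⁻¹ • p) := by
    funext p; exact mol_scale η ht p
  conv_lhs => rw [h]
  have h2 : fderiv ℝ (fun p => (t ^ n)⁻¹ • mol n η (t⁻¹ • p)) (t, z)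
      = (t ^ n)⁻¹ • fderiv ℝ (fun p => mol n η (t⁻¹ • p)) (t, z) := by
    exact congrFun (fderiv_const_smul_field (𝕜 := ℝ) (f := fun p => mol n η (t⁻¹ • p)) ((t ^ n)⁻¹)) (t, z)
  rw [h2, fderiv_comp_smul, smul_smul]
  congr 2
  simp [inv_mul_cancel₀ ht.ne']

lemma mol_fderiv_zero {n : ℕ} {η : Euc n → ℝ} {R : ℝ} (hR : ∀ z, R < ‖z‖ → η z = 0) {t : ℝ}
    (ht : 0 < t) {z : Euc n} (hz : R * t < ‖z‖) : fderiv ℝ (mol n η) (t, z) = 0 := by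
  have : mol n η =ᶠ[𝓝 (t, z)] fun _ => 0 := by
    have h1 : ∀ᶠ p : ℝ × Euc n in 𝓝 (t, z), 0 < p.1 :=
      continuous_fst.continuousAt.eventually (lt_mem_nhds ht)
    have h2 : ∀ᶠ p : ℝ × Euc n in 𝓝 (t, z), R * p.1 < ‖p.2‖ :=
      ContinuousAt.eventually_lt (f := fun p : ℝ × Euc n => R * p.1)
        (g := fun p : ℝ × Euc n => ‖p.2‖) (by fun_prop) (by fun_prop) hz
    filter_upwards [h1, h2] with p hp1 hp2
    exact mol_zero hR hp1 hp2
  rw [this.fderiv_eq]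
  simp

lemma mol_fderiv_bound {n : ℕ} {η : Euc n → ℝ} (hη : ContDiff ℝ (⊤ : ℕ∞) η) {R : ℝ}
    (hR : ∀ z, R < ‖z‖ → η z = 0) : ∃ C : ℝ, 0 ≤ C ∧ ∀ t, 0 < t → ∀ z,
      ‖fderiv ℝ (mol n η) (t, z)‖ ≤ C * (t ^ (n + 1))⁻¹ := by
  have hc : Continuous fun z => fderiv ℝ (mol n η) (1, z) := by
    have h1 : ContinuousOn (fderiv ℝ (mol n η)) (Set.Ioo 0 2 ×ˢ Set.univ) :=
      (mol_contDiffOn hη 1).continuousOn_fderiv_of_isOpen (slab_isOpen 2) (by norm_num)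
    rw [← continuousOn_univ]
    refine h1.comp (by fun_prop) ?_
    intro z _
    exact ⟨⟨by norm_num, by norm_num⟩, trivial⟩
  obtain ⟨C, hC⟩ := (isCompact_closedBall (0 : Euc n) R).exists_bound_of_continuousOn hc.continuousOn
  have hC' : ∀ z, ‖fderiv ℝ (mol n η) (1, z)‖ ≤ max C 0 := by
    intro z
    by_cases hz : ‖z‖ ≤ R
    · exact (hC z (by simpa using hz)).trans (le_max_left _ _)
    · rw [mol_fderiv_zero hR one_pos (by simpa using hz)]; simp
  refine ⟨max C 0, le_max_right _ _, fun t ht z => ?_⟩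
  rw [mol_fderiv_scale η ht, norm_smul, Real.norm_of_nonneg (by positivity), pow_succ, mul_inv,
    mul_comm]
  gcongr
  exact hC' _

lemma molU_contDiffOn {n : ℕ} {η : Euc n → ℝ} (hη : ContDiff ℝ (⊤ : ℕ∞) η) {R : ℝ} (hR0 : 0 < R)
    (hR : ∀ z, R < ‖z‖ → η z = 0) {w : Euc n → Euc n} (hw : LocallyIntegrable w volume) {T : ℝ} :
    ContDiffOn ℝ 2 (molU n η w) (Set.Ioo 0 T ×ˢ Set.univ) := by
  have := contDiffOn_convolution_right_with_param (μ := volume) (n := 2) (mL n)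
    (g := fun s z => mol n η (s, z)) (s := Set.Ioo 0 T) (k := closedBall (0 : Euc n) (R * T))
    isOpen_Ioo (isCompact_closedBall _ _) (by
      intro p x hp hx
      refine mol_zero hR hp.1 (lt_of_le_of_lt ?_ (by simpa using hx))
      gcongr; exact hp.2.le) hw (mol_contDiffOn hη 2)
  exact this

lemma molU_fderiv {n : ℕ} {η : Euc n → ℝ} (hη : ContDiff ℝ (⊤ : ℕ∞) η) {R : ℝ} (hR0 : 0 < R)
    (hR : ∀ z, R < ‖z‖ → η z = 0) {w : Euc n → Euc n} (hw : LocallyIntegrable w volume) {t : ℝ}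
    (ht : 0 < t) (x : Euc n) :
    HasFDerivAt (molU n η w) (∫ y, (mL n).precompR (ℝ × Euc n) (w y)
      (fderiv ℝ (mol n η) (t, x - y))) (t, x) := by
  have := hasFDerivAt_convolution_right_with_param (μ := volume) (mL n)
    (g := fun s z => mol n η (s, z)) (s := Set.Ioo 0 (t+1)) (k := closedBall (0 : Euc n) (R * (t+1)))
    isOpen_Ioo (isCompact_closedBall _ _) (by
      intro p x hp hx
      refine mol_zero hR hp.1 (lt_of_le_of_lt ?_ (by simpa using hx))
      gcongr; exact hp.2.le) hw (mol_contDiffOn hη 1) (t, x) ⟨ht, by simp⟩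
  exact this

lemma mol_integral {n : ℕ} {η : Euc n → ℝ} (h1 : ∫ z, η z = 1) {t : ℝ} (ht : 0 < t) (x : Euc n) :
    ∫ y, mol n η (t, x - y) = 1 := by
  rw [integral_sub_left_eq_self (fun z => mol n η (t, z)) volume x]
  unfold mol
  simp only
  rw [integral_const_mul, Measure.integral_comp_inv_smul_of_nonneg _ _ ht.le, h1]
  simp [inv_mul_cancel₀ (pow_pos ht n).ne']

lemma mol_conv_integrable {n : ℕ} {η : Euc n → ℝ} (hη : ContDiff ℝ (⊤ : ℕ∞) η) {R : ℝ}
    (hR : ∀ z, R < ‖z‖ → η z = 0) {w : Euc n → Euc n} (hw : LocallyIntegrable w volume) {t : ℝ}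
    (ht : 0 < t) (x : Euc n) : Integrable (fun y => mol n η (t, x - y) • w y) := by
  have hc : Continuous fun y : Euc n => mol n η (t, x - y) := by
    unfold mol
    have := hη.continuous
    change Continuous fun y : Euc n => (t ^ n)⁻¹ * η (t⁻¹ • (x - y))
    fun_prop
  refine hw.integrable_smul_left_of_hasCompactSupport hc ?_
  refine HasCompactSupport.intro (isCompact_closedBall x (R * t)) fun y hy => mol_zero hR ht ?_
  rw [mem_closedBall, dist_comm, dist_eq_norm] at hy
  exact not_le.1 hy

lemma molU_sub {n : ℕ} {η : Euc n → ℝ} (hη : ContDiff ℝ (⊤ : ℕ∞) η) (h1 : ∫ z, η z = 1) {R : ℝ}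
    (hR : ∀ z, R < ‖z‖ → η z = 0) {w : Euc n → Euc n} (hw : LocallyIntegrable w volume) 
    (c : Euc n) {p : ℝ × Euc n} (hp : 0 < p.1) :
    molU n η w p = molU n η (fun y => w y - c) p + c := by
  unfold molU
  simp only [smul_sub]
  rw [integral_sub (mol_conv_integrable hη hR hw hp p.2)
    (mol_conv_integrable hη hR (continuous_const.locallyIntegrable) hp p.2), integral_smul_const,
    mol_integral h1 hp]
  simp

lemma mL_norm {n : ℕ} : ‖mL n‖ ≤ 1 := by
  unfold mL
  rw [ContinuousLinearMap.opNorm_flip]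
  exact ContinuousLinearMap.opNorm_lsmul_le

lemma molU_fderiv_bound {n : ℕ} {η : Euc n → ℝ} (hη : ContDiff ℝ (⊤ : ℕ∞) η) (h1 : ∫ z, η z = 1)
    {R : ℝ} (hR0 : 0 < R)
    (hR : ∀ z, R < ‖z‖ → η z = 0) {C : ℝ} (hC : ∀ t, 0 < t → ∀ z,
      ‖fderiv ℝ (mol n η) (t, z)‖ ≤ C * (t ^ (n + 1))⁻¹)
    {w : Euc n → Euc n} (hw : LocallyIntegrable w volume) {t : ℝ}
    (ht : 0 < t) (x : Euc n) :
    ‖fderiv ℝ (molU n η w) (t, x)‖ₑ ≤ ENNReal.ofReal (C * (t ^ (n + 1))⁻¹) *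
      ∫⁻ y in closedBall x (R * t), ‖w x - w y‖ₑ := by
  have hw' : LocallyIntegrable (fun y => w y - w x) volume :=
    hw.sub continuous_const.locallyIntegrable
  have e : molU n η w =ᶠ[𝓝 (t, x)] fun p => molU n η (fun y => w y - w x) p + w x := by
    have h1' : ∀ᶠ p : ℝ × Euc n in 𝓝 (t, x), 0 < p.1 :=
      continuous_fst.continuousAt.eventually (lt_mem_nhds ht)
    filter_upwards [h1'] with p hp
    exact molU_sub hη h1 hR hw _ hp
  rw [e.fderiv_eq, fderiv_add_const, (molU_fderiv hη hR0 hR hw' ht x).fderiv]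
  refine (enorm_integral_le_lintegral_enorm _).trans ?_
  rw [← lintegral_const_mul' _ _ ENNReal.ofReal_ne_top, ← lintegral_indicator measurableSet_closedBall]
  refine lintegral_mono fun y => ?_
  by_cases hy : y ∈ closedBall x (R * t)
  · rw [Set.indicator_of_mem hy]
    rw [← ofReal_norm, ← ofReal_norm, ← ENNReal.ofReal_mul' (norm_nonneg _)]
    apply ENNReal.ofReal_le_ofReal
    refine (ContinuousLinearMap.le_opNorm₂ _ _ _).trans ?_
    have := ContinuousLinearMap.norm_precompR_le (ℝ × Euc n) (mL n)
    have h2 := this.trans mL_norm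
    calc _ ≤ 1 * ‖w y - w x‖ * (C * (t ^ (n + 1))⁻¹) := by
          gcongr
          exact hC t ht _
      _ = _ := by rw [norm_sub_rev]; ring
  · rw [Set.indicator_of_notMem hy, mol_fderiv_zero hR ht (by
      rw [mem_closedBall, dist_comm, dist_eq_norm] at hy
      exact not_le.1 hy)]
    simp
end A7S

section A8S

lemma holder_pow {α : Type*} [MeasurableSpace α] (μ : Measure α) {n : ℕ} (hn : 2 ≤ n)
    (g : α → ℝ≥0∞) (hg : AEMeasurable g μ) :
    (∫⁻ y, g y ∂μ) ^ n ≤ (μ Set.univ) ^ (n - 1) * ∫⁻ y, g y ^ n ∂μ := by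
  have hn1 : (1 : ℝ) < n := by exact_mod_cast (by omega : 1 < n)
  have hpq := Real.HolderConjugate.conjExponent hn1
  have h := ENNReal.lintegral_mul_le_Lp_mul_Lq μ hpq hg (aemeasurable_const (b := (1 : ℝ≥0∞)))
  simp only [Pi.mul_apply, mul_one, ENNReal.one_rpow, lintegral_const, one_mul,
    ENNReal.rpow_natCast] at h
  calc (∫⁻ y, g y ∂μ) ^ n ≤ ((∫⁻ y, g y ^ n ∂μ) ^ (1 / (n:ℝ)) * (μ Set.univ) ^ (1 / Real.conjExponent n)) ^ n := by
        gcongr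
    _ = _ := by
        rw [mul_pow, ← ENNReal.rpow_mul_natCast, ← ENNReal.rpow_mul_natCast, mul_comm]
        have e1 : 1 / (n:ℝ) * n = 1 := by field_simp
        have e2 : 1 / Real.conjExponent n * n = ((n - 1 : ℕ) : ℝ) := by
          rw [Nat.cast_sub (by omega)]
          unfold Real.conjExponent
          field_simp
          push_cast; ring
        rw [e1, e2, ENNReal.rpow_one, ENNReal.rpow_natCast]

lemma time_int {n : ℕ} (hn : 2 ≤ n) {c : ℝ} (hc : 0 < c) :
    ∫⁻ t in Set.Ioi (0:ℝ), (Set.Ici c).indicator (fun t => ENNReal.ofReal ((t ^ (2 * n))⁻¹)) t ≤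
      ENNReal.ofReal (c ^ (1 - 2 * (n:ℝ))) := by
  have hn1 : (2 : ℝ) ≤ n := by exact_mod_cast hn
  have ha : (-(2 * (n:ℝ))) < -1 := by linarith
  calc _ ≤ ∫⁻ t, (Set.Ici c).indicator (fun t => ENNReal.ofReal ((t ^ (2 * n))⁻¹)) t :=
        lintegral_mono' Measure.restrict_le_self le_rfl
    _ = ∫⁻ t in Set.Ici c, ENNReal.ofReal ((t ^ (2 * n))⁻¹) :=
        lintegral_indicator measurableSet_Ici _
    _ = ∫⁻ t in Set.Ioi c, ENNReal.ofReal ((t ^ (2 * n))⁻¹) := by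
        rw [Measure.restrict_congr_set Ioi_ae_eq_Ici]
    _ = ∫⁻ t in Set.Ioi c, ENNReal.ofReal (t ^ (-(2 * (n:ℝ)))) := by
        refine setLIntegral_congr_fun measurableSet_Ioi fun t ht => ?_
        have ht0 : 0 < t := hc.trans ht
        rw [Real.rpow_neg ht0.le, ← Real.rpow_natCast]; push_cast; rfl
    _ = ENNReal.ofReal (∫ t in Set.Ioi c, t ^ (-(2 * (n:ℝ)))) := by
        rw [ofReal_integral_eq_lintegral_ofReal (integrableOn_Ioi_rpow_of_lt ha hc)]
        refine (ae_restrict_mem measurableSet_Ioi).mono fun t ht => ?_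
        have ht0 : 0 < t := hc.trans ht
        simp only [Pi.zero_apply]; positivity
    _ ≤ _ := by
        apply ENNReal.ofReal_le_ofReal
        rw [integral_Ioi_rpow_of_lt ha hc]
        have e : -(2 * (n:ℝ)) + 1 = 1 - 2 * n := by ring
        rw [e]
        have h0 : 0 ≤ c ^ (1 - 2 * (n:ℝ)) := by positivity
        rw [neg_div, ← div_neg]
        exact div_le_self h0 (by linarith)

lemma molU_pow_bound {n : ℕ} (hn : 2 ≤ n) {η : Euc n → ℝ} (hη : ContDiff ℝ (⊤ : ℕ∞) η)
    (h1 : ∫ z, η z = 1) {R : ℝ} (hR0 : 0 < R) (hR : ∀ z, R < ‖z‖ → η z = 0)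
    {w : Euc n → Euc n} (hwm : Measurable w) (hw : LocallyIntegrable w volume) :
    ∃ A : ℝ≥0∞, A ≠ ∞ ∧ ∀ t, 0 < t → ∀ x, ‖fderiv ℝ (molU n η w) (t, x)‖ₑ ^ n ≤
      A * (ENNReal.ofReal ((t ^ (2 * n))⁻¹) * ∫⁻ y in closedBall x (R * t), ‖w x - w y‖ₑ ^ n) := by
  obtain ⟨C, hC0, hC⟩ := mol_fderiv_bound hη hR
  refine ⟨ENNReal.ofReal (C ^ n * (R ^ n) ^ (n - 1)) * volume (ball (0 : Euc n) 1) ^ (n - 1), ?_, ?_⟩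
  · exact ENNReal.mul_ne_top ENNReal.ofReal_ne_top (ENNReal.pow_ne_top measure_ball_lt_top.ne)
  intro t ht x
  have h2 := molU_fderiv_bound hη h1 hR0 hR hC hw ht x
  have h3 := holder_pow (volume.restrict (closedBall x (R * t))) hn (fun y => ‖w x - w y‖ₑ)
    (by fun_prop)
  rw [Measure.restrict_apply_univ, Measure.addHaar_closedBall _ _ (by positivity)] at h3
  calc _ ≤ (ENNReal.ofReal (C * (t ^ (n + 1))⁻¹) * ∫⁻ y in closedBall x (R * t), ‖w x - w y‖ₑ) ^ n := by
        gcongr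
    _ ≤ ENNReal.ofReal (C * (t ^ (n + 1))⁻¹) ^ n * ((ENNReal.ofReal ((R * t) ^ Module.finrank ℝ (Euc n)) * volume (ball (0 : Euc n) 1)) ^ (n - 1) * ∫⁻ y in closedBall x (R * t), ‖w x - w y‖ₑ ^ n) := by
        rw [mul_pow]; gcongr
    _ = _ := by
        rw [mul_pow, finrank_euclideanSpace_fin, ← ENNReal.ofReal_pow (by positivity), ← ENNReal.ofReal_pow (by positivity)]
        have e : (C * (t ^ (n + 1))⁻¹) ^ n * ((R * t) ^ n) ^ (n - 1) = C ^ n * (R ^ n) ^ (n - 1) * (t ^ (2 * n))⁻¹ := by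
          obtain ⟨m, rfl⟩ : ∃ m, n = m + 1 := ⟨n - 1, by omega⟩
          simp only [Nat.add_sub_cancel]
          have e0 : (t ^ (m + 1)) ^ m * t ^ (2 * (m + 1)) = (t ^ (m + 1 + 1)) ^ (m + 1) := by ring
          have e1 : ((t ^ (m + 1 + 1)) ^ (m + 1))⁻¹ * (t ^ (m + 1)) ^ m = (t ^ (2 * (m + 1)))⁻¹ := by
            rw [← e0]; field_simp
          rw [mul_pow, mul_pow, mul_pow, inv_pow, ← e1]; ring
        have e2 : ENNReal.ofReal ((C * (t ^ (n + 1))⁻¹) ^ n) * ENNReal.ofReal (((R * t) ^ n) ^ (n - 1)) = ENNReal.ofReal (C ^ n * (R ^ n) ^ (n - 1)) * ENNReal.ofReal ((t ^ (2 * n))⁻¹) := by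
          rw [← ENNReal.ofReal_mul (by positivity), ← ENNReal.ofReal_mul (by positivity), e]
        calc _ = (ENNReal.ofReal ((C * (t ^ (n + 1))⁻¹) ^ n) * ENNReal.ofReal (((R * t) ^ n) ^ (n - 1))) * (volume (ball (0 : Euc n) 1) ^ (n - 1) * ∫⁻ y in closedBall x (R * t), ‖w x - w y‖ₑ ^ n) := by ring
          _ = _ := by rw [e2]; ring

lemma tri_swap {n : ℕ} (H : ℝ → Euc n → Euc n → ℝ≥0∞)
    (hHm : Measurable fun q : ℝ × Euc n × Euc n => H q.1 q.2.1 q.2.2) :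
    ∫⁻ t in Set.Ioi (0:ℝ), ∫⁻ x, ∫⁻ y, H t x y = ∫⁻ x, ∫⁻ y, ∫⁻ t in Set.Ioi (0:ℝ), H t x y := by
  have m1 : Measurable fun q : (ℝ × Euc n) × Euc n => H q.1.1 q.1.2 q.2 :=
    hHm.comp (by fun_prop : Measurable fun q : (ℝ × Euc n) × Euc n => (q.1.1, q.1.2, q.2))
  have m2 : Measurable fun q : ℝ × Euc n => ∫⁻ y, H q.1 q.2 y := m1.lintegral_prod_right'
  have s1 := lintegral_lintegral_swap (μ := volume.restrict (Set.Ioi (0:ℝ)))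
    (ν := (volume : Measure (Euc n))) (f := fun t x => ∫⁻ y, H t x y) m2.aemeasurable
  rw [s1]
  refine lintegral_congr fun x => ?_
  have m3 : Measurable fun q : ℝ × Euc n => H q.1 x q.2 :=
    hHm.comp (by fun_prop : Measurable fun q : ℝ × Euc n => (q.1, x, q.2))
  exact lintegral_lintegral_swap (μ := volume.restrict (Set.Ioi (0:ℝ)))
    (ν := (volume : Measure (Euc n))) (f := fun t y => H t x y) m3.aemeasurable

lemma energy_fin {n : ℕ} (hn : 2 ≤ n) {η : Euc n → ℝ} (hη : ContDiff ℝ (⊤ : ℕ∞) η)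
    (h1 : ∫ z, η z = 1) {R : ℝ} (hR0 : 0 < R) (hR : ∀ z, R < ‖z‖ → η z = 0)
    {w : Euc n → Euc n} (hwm : Measurable w) (hw : LocallyIntegrable w volume)
    (hE : ∫⁻ x, ∫⁻ y, ‖w x - w y‖ₑ ^ n * ENNReal.ofReal (‖x - y‖ ^ (1 - 2 * (n:ℝ))) < ∞) :
    ∫⁻ p, ‖fderiv ℝ (molU n η w) p‖ₑ ^ n
      ∂((volume.restrict (Set.Ioi (0:ℝ))).prod (volume : Measure (Euc n))) < ∞ := by
  obtain ⟨A, hA, hb⟩ := molU_pow_bound hn hη h1 hR0 hR hwm hw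
  have hm : Measurable fun p => ‖fderiv ℝ (molU n η w) p‖ₑ ^ n :=
    ((measurable_fderiv ℝ (molU n η w)).enorm).pow_const n
  rw [lintegral_prod _ hm.aemeasurable]
  set H : ℝ → Euc n → Euc n → ℝ≥0∞ := fun t x y =>
    ‖w x - w y‖ₑ ^ n * (Set.Ici (‖x - y‖ / R)).indicator (fun t => ENNReal.ofReal ((t ^ (2 * n))⁻¹)) t with hH
  have hHm : Measurable fun q : ℝ × Euc n × Euc n => H q.1 q.2.1 q.2.2 := by
    have hS : MeasurableSet {q : ℝ × Euc n × Euc n | ‖q.2.1 - q.2.2‖ / R ≤ q.1} :=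
      measurableSet_le (by fun_prop) (by fun_prop)
    have e : (fun q : ℝ × Euc n × Euc n => H q.1 q.2.1 q.2.2) = fun q => ‖w q.2.1 - w q.2.2‖ₑ ^ n *
        {q : ℝ × Euc n × Euc n | ‖q.2.1 - q.2.2‖ / R ≤ q.1}.indicator (fun q => ENNReal.ofReal ((q.1 ^ (2 * n))⁻¹)) q := by
      funext q
      simp [hH, Set.indicator_apply]
    rw [e]
    refine Measurable.mul (by fun_prop) (Measurable.indicator (by fun_prop) hS)
  have step1 : ∀ t ∈ Set.Ioi (0:ℝ), ∀ x, ‖fderiv ℝ (molU n η w) (t, x)‖ₑ ^ n ≤ A * ∫⁻ y, H t x y := by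
    intro t ht x
    refine (hb t ht x).trans_eq ?_
    congr 1
    rw [← lintegral_const_mul' _ _ ENNReal.ofReal_ne_top, ← lintegral_indicator measurableSet_closedBall]
    refine lintegral_congr fun y => ?_
    have hiff : y ∈ closedBall x (R * t) ↔ t ∈ Set.Ici (‖x - y‖ / R) := by
      rw [mem_closedBall, dist_comm, dist_eq_norm, Set.mem_Ici, div_le_iff₀' hR0]
    by_cases hy : y ∈ closedBall x (R * t)
    · simp only [hH]
      rw [Set.indicator_of_mem hy, Set.indicator_of_mem (hiff.1 hy), mul_comm]
    · simp only [hH]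
      rw [Set.indicator_of_notMem hy, Set.indicator_of_notMem (fun h => hy (hiff.2 h)), mul_zero]
  calc _ ≤ ∫⁻ t in Set.Ioi (0:ℝ), ∫⁻ x, A * ∫⁻ y, H t x y := by
        refine setLIntegral_mono' measurableSet_Ioi fun t ht => lintegral_mono fun x => step1 t ht x
    _ = A * ∫⁻ t in Set.Ioi (0:ℝ), ∫⁻ x, ∫⁻ y, H t x y := by
        simp_rw [lintegral_const_mul' A _ hA]
    _ = A * ∫⁻ x, ∫⁻ y, ∫⁻ t in Set.Ioi (0:ℝ), H t x y := by
        rw [tri_swap H hHm]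
    _ ≤ A * ∫⁻ x, ∫⁻ y, ENNReal.ofReal ((R⁻¹) ^ (1 - 2 * (n:ℝ))) * (‖w x - w y‖ₑ ^ n * ENNReal.ofReal (‖x - y‖ ^ (1 - 2 * (n:ℝ)))) := by
        gcongr with x y
        simp only [hH]
        by_cases hxy : x = y
        · subst hxy
          have : n ≠ 0 := by omega
          simp [this]
        have hpos : 0 < ‖x - y‖ := norm_pos_iff.2 (sub_ne_zero.2 hxy)
        rw [lintegral_const_mul' _ _ (ENNReal.pow_ne_top enorm_ne_top)]
        have := time_int hn (div_pos hpos hR0)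
        rw [div_eq_mul_inv, Real.mul_rpow hpos.le (by positivity), mul_comm (‖x - y‖ ^ _), ENNReal.ofReal_mul (by positivity)] at this
        rw [mul_left_comm]
        gcongr
        simpa [div_eq_mul_inv] using this
    _ < ∞ := by
        simp_rw [lintegral_const_mul' _ _ ENNReal.ofReal_ne_top]
        exact ENNReal.mul_lt_top hA.lt_top (ENNReal.mul_lt_top ENNReal.ofReal_lt_top hE)
end A8S

section A9S

lemma wsp_rep {n : ℕ} (hn : 2 ≤ n) {ut : Euc n → Euc n}
    (hut : MemWsp n (((n : ℝ) - 1) / n) n Set.univ ut) :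
    ∃ w : Euc n → Euc n, Measurable w ∧ ut =ᵐ[volume] w ∧ LocallyIntegrable w volume ∧
      ∫⁻ x, ∫⁻ y, ‖w x - w y‖ₑ ^ n * ENNReal.ofReal (‖x - y‖ ^ (1 - 2 * (n:ℝ))) < ∞ := by
  obtain ⟨h1, h2, h3⟩ := hut
  rw [Measure.restrict_univ] at h1 h2 h3
  have hn0 : (n : ℝ) ≠ 0 := by positivity
  have hae : ut =ᵐ[volume] h1.mk ut := h1.ae_eq_mk
  have hwm : Measurable (h1.mk ut) := h1.stronglyMeasurable_mk.measurable
  refine ⟨h1.mk ut, hwm, hae, ?_, ?_⟩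
  · have : MemLp ut n volume := by
      rw [← integrable_norm_rpow_iff h1 (by simp; omega) (by simp)]
      simpa using h2
    exact ((memLp_congr_ae hae).1 this).locallyIntegrable (by exact_mod_cast (by omega : 1 ≤ n))
  · set w := h1.mk ut
    have hm : Measurable fun q : Euc n × Euc n =>
        ‖w q.1 - w q.2‖ₑ ^ n * ENNReal.ofReal (‖q.1 - q.2‖ ^ (1 - 2 * (n:ℝ))) := by fun_prop
    have hp := lintegral_prod (μ := (volume : Measure (Euc n))) (ν := (volume : Measure (Euc n)))
      _ hm.aemeasurable
    rw [← hp]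
    have h4 := h3.hasFiniteIntegral
    rw [hasFiniteIntegral_iff_enorm] at h4
    refine lt_of_le_of_lt (lintegral_mono_ae ?_) h4
    have ha1 : ∀ᵐ q : Euc n × Euc n ∂(volume.prod volume), ut q.1 = w q.1 :=
      Measure.quasiMeasurePreserving_fst.ae hae
    have ha2 : ∀ᵐ q : Euc n × Euc n ∂(volume.prod volume), ut q.2 = w q.2 :=
      Measure.quasiMeasurePreserving_snd.ae hae
    filter_upwards [ha1, ha2] with q e1 e2
    rw [e1, e2, Real.enorm_of_nonneg (by positivity), ← ofReal_norm,
      ← ENNReal.ofReal_pow (norm_nonneg _), ← ENNReal.ofReal_mul (by positivity)]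
    apply ENNReal.ofReal_le_ofReal
    rw [Real.rpow_natCast, div_eq_mul_inv, ← Real.rpow_neg dist_nonneg, dist_eq_norm]
    apply le_of_eq
    congr 2
    field_simp
    ring

lemma molU_measurable {n : ℕ} {η : Euc n → ℝ} (hη : Continuous η) {w : Euc n → Euc n}
    (hw : Measurable w) : Measurable (molU n η w) := by
  have hm : StronglyMeasurable (fun q : (ℝ × Euc n) × Euc n => mol n η (q.1.1, q.1.2 - q.2) • w q.2) := by
    have := hη.measurable
    unfold mol
    apply Measurable.stronglyMeasurable
    fun_prop
  exact (hm.integral_prod_right' (ν := volume)).measurable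

lemma molU_uk {n : ℕ} {η : Euc n → ℝ} {ut w : Euc n → Euc n} (h : ut =ᵐ[volume] w) (t : ℝ) (x : Euc n) :
    ∫ y, ((t ^ n)⁻¹ * η (t⁻¹ • y)) • ut (x - y) = molU n η w (t, x) := by
  have := integral_sub_left_eq_self (fun y => ((t ^ n)⁻¹ * η (t⁻¹ • y)) • ut (x - y)) volume x
  rw [← this]
  unfold molU mol
  refine integral_congr_ae ?_
  filter_upwards [h] with y hy
  simp [hy]
end A9S

section B1S

lemma sing_ball {n : ℕ} (hn : 2 ≤ n) : ∫⁻ z in ball (0 : Euc n) 1, (‖z‖ₑ ^ (n - 1))⁻¹ < ∞ := by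
  have hn1 : 1 ≤ n := by omega
  have hz : ∀ᵐ z : Euc n ∂(volume.restrict (ball (0 : Euc n) 1)), z ≠ 0 := by
    haveI : Nonempty (Fin n) := ⟨⟨0, by omega⟩⟩
    exact ae_restrict_of_ae (Measure.ae_ne volume 0)
  have h : IntegrableOn (fun z : Euc n => (‖z‖ ^ (n - 1))⁻¹) (ball 0 1) := by
    refine integrableOn_ball_of_norm_le_rpow (C := 1) (α := (n : ℝ) - 1) (by simpa using hn1)
      (by simp) ?_ (by apply Measurable.aestronglyMeasurable; fun_prop)
    filter_upwards [hz] with z hz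
    have h0 : 0 < ‖z‖ := norm_pos_iff.2 hz
    rw [Real.norm_of_nonneg (by positivity), one_mul, Real.rpow_neg h0.le, ← Real.rpow_natCast,
      Nat.cast_sub hn1, Nat.cast_one]
  have h2 := h.hasFiniteIntegral
  rw [hasFiniteIntegral_iff_enorm] at h2
  refine lt_of_le_of_lt (lintegral_mono_ae ?_) h2
  filter_upwards [hz] with z hz
  have h0 : 0 < ‖z‖ := norm_pos_iff.2 hz
  rw [enorm_inv (by positivity), enorm_pow, enorm_norm]

lemma good_ae {n : ℕ} (hn : 2 ≤ n) {Ω : Set (Euc n)} (hΩ : volume Ω ≠ ∞) {v : Euc n → Euc n}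
    (hv : Measurable v) : ∀ᵐ a : Euc n, ∫⁻ x in Ω, (‖v x - a‖ₑ ^ (n - 1))⁻¹ < ∞ := by
  set c0 := ∫⁻ z in ball (0 : Euc n) 1, (‖z‖ₑ ^ (n - 1))⁻¹ with hc0
  have hc0f : c0 < ∞ := sing_ball hn
  have hm : Measurable fun q : Euc n × Euc n => (‖v q.2 - q.1‖ₑ ^ (n - 1))⁻¹ := by fun_prop
  have key : ∀ N : ℕ, ∀ᵐ a : Euc n, a ∈ ball (0 : Euc n) N →
      ∫⁻ x in Ω, (‖v x - a‖ₑ ^ (n - 1))⁻¹ < ∞ := by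
    intro N
    rw [← ae_restrict_iff' measurableSet_ball]
    refine ae_lt_top (hm.lintegral_prod_right' (ν := volume.restrict Ω)) ?_
    have inner : ∀ y : Euc n, ∫⁻ a in ball (0 : Euc n) N, (‖y - a‖ₑ ^ (n - 1))⁻¹ ≤
        c0 + volume (ball (0 : Euc n) N) := by
      intro y
      have hb : ∀ a, (‖y - a‖ₑ ^ (n - 1))⁻¹ ≤
          (ball (0 : Euc n) 1).indicator (fun z => (‖z‖ₑ ^ (n - 1))⁻¹) (y - a) + 1 := by
        intro a
        by_cases h : y - a ∈ ball (0 : Euc n) 1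
        · rw [Set.indicator_of_mem h]; exact le_self_add
        · rw [Set.indicator_of_notMem h, zero_add, ENNReal.inv_le_one]
          apply one_le_pow₀
          rw [← ofReal_norm, ENNReal.one_le_ofReal]
          simpa using h
      have hmi : Measurable fun a : Euc n =>
          (ball (0 : Euc n) 1).indicator (fun z => (‖z‖ₑ ^ (n - 1))⁻¹) (y - a) := by
        refine Measurable.comp (g := (ball (0 : Euc n) 1).indicator (fun z => (‖z‖ₑ ^ (n - 1))⁻¹))
          (Measurable.indicator (by fun_prop) measurableSet_ball) (by fun_prop)
      calc _ ≤ ∫⁻ a in ball (0 : Euc n) N, ((ball (0 : Euc n) 1).indicator (fun z => (‖z‖ₑ ^ (n - 1))⁻¹) (y - a) + 1) := lintegral_mono hb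
        _ = (∫⁻ a in ball (0 : Euc n) N, (ball (0 : Euc n) 1).indicator (fun z => (‖z‖ₑ ^ (n - 1))⁻¹) (y - a)) + volume (ball (0 : Euc n) N) := by
          rw [lintegral_add_left hmi]; simp
        _ ≤ (∫⁻ a, (ball (0 : Euc n) 1).indicator (fun z => (‖z‖ₑ ^ (n - 1))⁻¹) (y - a)) + volume (ball (0 : Euc n) N) := by
          gcongr; exact Measure.restrict_le_self
        _ = _ := by
          rw [lintegral_sub_left_eq_self ((ball (0 : Euc n) 1).indicator (fun z => (‖z‖ₑ ^ (n - 1))⁻¹)) y, lintegral_indicator measurableSet_ball]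
    have sw := lintegral_lintegral_swap (μ := volume.restrict (ball (0 : Euc n) N))
      (ν := volume.restrict Ω) (f := fun a x => (‖v x - a‖ₑ ^ (n - 1))⁻¹) hm.aemeasurable
    refine ne_top_of_le_ne_top (b := (c0 + volume (ball (0 : Euc n) N)) * volume Ω) ?_ ?_
    · exact ENNReal.mul_ne_top (ENNReal.add_ne_top.2 ⟨hc0f.ne, measure_ball_lt_top.ne⟩) hΩ
    · refine sw.le.trans ?_
      calc _ ≤ ∫⁻ x in Ω, (c0 + volume (ball (0 : Euc n) N)) := lintegral_mono fun x => inner (v x)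
        _ = _ := by simp
  filter_upwards [ae_all_iff.2 key] with a ha
  obtain ⟨N, hN⟩ := exists_nat_gt ‖a‖
  exact ha N (by simpa using hN)

lemma good_ne {n : ℕ} (hn : 2 ≤ n) {Ω : Set (Euc n)} {v : Euc n → Euc n}
    (hv : Measurable v) {a : Euc n} (ha : ∫⁻ x in Ω, (‖v x - a‖ₑ ^ (n - 1))⁻¹ < ∞) :
    ∀ᵐ x ∂(volume.restrict Ω), v x ≠ a := by
  filter_upwards [ae_lt_top (by fun_prop) ha.ne] with x hx h
  rw [h] at hx
  have : n - 1 ≠ 0 := by omega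
  simp [this] at hx

lemma good_integrable {n : ℕ} (hn : 2 ≤ n) {Ω : Set (Euc n)} {v : Euc n → Euc n}
    (hv : Measurable v) {a : Euc n} (ha : ∫⁻ x in Ω, (‖v x - a‖ₑ ^ (n - 1))⁻¹ < ∞) :
    IntegrableOn (fun x => (‖v x - a‖ ^ (n - 1))⁻¹) Ω := by
  refine ⟨by apply Measurable.aestronglyMeasurable; fun_prop, ?_⟩
  rw [hasFiniteIntegral_iff_enorm]
  refine lt_of_le_of_lt (lintegral_mono_ae ?_) ha
  filter_upwards [good_ne hn hv ha] with x hx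
  have h0 : 0 < ‖v x - a‖ := norm_pos_iff.2 (sub_ne_zero.2 hx)
  rw [enorm_inv (by positivity), enorm_pow, enorm_norm]

/-- integrand with general kernel vector -/
def kInt (n : ℕ) (v : Euc n → Euc n) (ψ : Euc n → ℝ) (x k : Euc n) : ℝ :=
  ∑ i, (∑ j, (jacMat n v x).adjugate i j * k j) * fderiv ℝ ψ x (EuclideanSpace.single i 1)

lemma kInt_coef {n : ℕ} {v : Euc n → Euc n} (hv : ContDiff ℝ 1 v) {Ω : Set (Euc n)}
    {ψ : Euc n → ℝ} (hψ : Cc1 n Ω ψ) : ∃ B : ℝ, 0 ≤ B ∧ ∀ x k, |kInt n v ψ x k| ≤ B * ‖k‖ := by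
  have hJ : Continuous fun x => jacMat n v x := by
    refine continuous_matrix fun i j => ?_
    have := (hv.continuous_fderiv (by norm_num)).clm_apply (continuous_const (y := EuclideanSpace.single j (1:ℝ)))
    exact (EuclideanSpace.proj (𝕜 := ℝ) i).continuous.comp this
  have hψ' := hψ.1.continuous_fderiv (by norm_num)
  have hb : ∀ i j, ∃ C, 0 ≤ C ∧ ∀ x, |(jacMat n v x).adjugate i j * fderiv ℝ ψ x (EuclideanSpace.single i 1)| ≤ C := by
    intro i j
    have hc : Continuous fun x => (jacMat n v x).adjugate i j * fderiv ℝ ψ x (EuclideanSpace.single i 1) :=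
      (hJ.matrix_adjugate.matrix_elem i j).mul (hψ'.clm_apply continuous_const)
    obtain ⟨C, hC⟩ := hψ.2.1.isCompact.exists_bound_of_continuousOn hc.continuousOn
    refine ⟨max C 0, le_max_right _ _, fun x => ?_⟩
    by_cases hx : x ∈ tsupport ψ
    · exact (hC x hx).trans (le_max_left _ _)
    · rw [fderiv_zero_off hx]; simp
  choose C hC0 hC using hb
  refine ⟨∑ i, ∑ j, C i j, Finset.sum_nonneg fun i _ => Finset.sum_nonneg fun j _ => hC0 i j, ?_⟩
  intro x k
  unfold kInt
  simp only [Finset.sum_mul]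
  refine (Finset.abs_sum_le_sum_abs _ _).trans (Finset.sum_le_sum fun i _ => ?_)
  refine (Finset.abs_sum_le_sum_abs _ _).trans (Finset.sum_le_sum fun j _ => ?_)
  have e : (jacMat n v x).adjugate i j * k j * fderiv ℝ ψ x (EuclideanSpace.single i 1) =
    ((jacMat n v x).adjugate i j * fderiv ℝ ψ x (EuclideanSpace.single i 1)) * k j := by ring
  rw [e, abs_mul]
  exact mul_le_mul (hC i j x) (PiLp.norm_apply_le k j) (abs_nonneg _) (hC0 i j)

lemma kInt_measurable {n : ℕ} {v : Euc n → Euc n} (hv : ContDiff ℝ 1 v) 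
    {ψ : Euc n → ℝ} (hψ : ContDiff ℝ 1 ψ) {k : Euc n → Euc n} (hk : Measurable k) :
    Measurable fun x => kInt n v ψ x (k x) := by
  have hJ : Continuous fun x => jacMat n v x := by
    refine continuous_matrix fun i j => ?_
    have := (hv.continuous_fderiv (by norm_num)).clm_apply (continuous_const (y := EuclideanSpace.single j (1:ℝ)))
    exact (EuclideanSpace.proj (𝕜 := ℝ) i).continuous.comp this
  have hψ' := hψ.continuous_fderiv (by norm_num)
  unfold kInt
  refine Finset.measurable_sum _ fun i _ => ?_
  refine Measurable.mul ?_ (hψ'.clm_apply continuous_const).measurable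
  refine Finset.measurable_sum _ fun j _ => ?_
  refine Measurable.mul (hJ.matrix_adjugate.matrix_elem i j).measurable ?_
  exact (EuclideanSpace.proj (𝕜 := ℝ) j).continuous.measurable.comp hk

lemma kInt_continuous {n : ℕ} (v : Euc n → Euc n) (ψ : Euc n → ℝ) (x : Euc n) :
    Continuous fun k => kInt n v ψ x k := by
  unfold kInt
  fun_prop

lemma kerZ_bound {n : ℕ} (hn : 2 ≤ n) {y : Euc n} (h : y ≠ 0) :
    ‖kerZ n y‖ ≤ (‖y‖ ^ (n - 1))⁻¹ := by
  have h1 := kerK_tendsto (a := 0) h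
  rw [sub_zero] at h1
  refine le_of_tendsto h1.norm (Eventually.of_forall fun m => ?_)
  simpa using kerK_bound hn (ε := 1 / ((m:ℝ) + 1)) h

lemma good_conv {n : ℕ} (hn : 2 ≤ n) {Ω : Set (Euc n)} (hΩ : MeasurableSet Ω) {v : Euc n → Euc n}
    (hv : ContDiff ℝ 1 v) {a : Euc n} (ha : ∫⁻ x in Ω, (‖v x - a‖ₑ ^ (n - 1))⁻¹ < ∞)
    {ψ : Euc n → ℝ} (hψ : Cc1 n Ω ψ) :
    IntegrableOn (fun x => jPair n (proj n v a) ψ x) Ω ∧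
    Tendsto (fun m : ℕ => ∫ x, kInt n v ψ x (kerK n (1 / ((m : ℝ) + 1)) a (v x))) atTop
      (𝓝 (∫ x in Ω, jPair n (proj n v a) ψ x)) := by
  have hvm := hv.continuous.measurable
  have hne := good_ne hn hvm ha
  have hi := good_integrable hn hvm ha
  obtain ⟨B, hB0, hB⟩ := kInt_coef hv hψ
  have hae : ∀ᵐ x ∂(volume.restrict Ω), kInt n v ψ x (kerZ n (v x - a)) = jPair n (proj n v a) ψ x := by
    filter_upwards [hne] with x hx
    rw [jPair_proj hn v a x (hv.differentiable (by norm_num) x) hx]; rfl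
  have hzm : Measurable fun x => kerZ n (v x - a) := by unfold kerZ; fun_prop
  constructor
  · have : IntegrableOn (fun x => kInt n v ψ x (kerZ n (v x - a))) Ω := by
      refine Integrable.mono' (hi.const_mul B)
        (kInt_measurable hv hψ.1 hzm).aestronglyMeasurable ?_
      filter_upwards [hne] with x hx
      refine (hB _ _).trans ?_
      gcongr
      exact kerZ_bound hn (sub_ne_zero.2 hx)
    exact this.congr hae
  · rw [← integral_congr_ae hae]
    have e : ∀ m : ℕ, ∫ x, kInt n v ψ x (kerK n (1 / ((m : ℝ) + 1)) a (v x)) =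
        ∫ x in Ω, kInt n v ψ x (kerK n (1 / ((m : ℝ) + 1)) a (v x)) := by
      intro m
      rw [setIntegral_eq_integral_of_forall_compl_eq_zero]
      intro x hx
      unfold kInt
      rw [fderiv_zero_off (fun h => hx (hψ.2.2 h))]; simp
    simp_rw [e]
    refine tendsto_integral_of_dominated_convergence (fun x => B * (‖v x - a‖ ^ (n - 1))⁻¹) ?_
      (hi.const_mul B) ?_ ?_
    · intro m
      refine (kInt_measurable hv hψ.1 ?_).aestronglyMeasurable
      exact (kerK_contDiff (by positivity) a).continuous.measurable.comp hvm
    · intro m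
      filter_upwards [hne] with x hx
      refine (hB _ _).trans ?_
      gcongr
      exact kerK_bound hn hx
    · filter_upwards [hne] with x hx
      exact ((kInt_continuous v ψ x).tendsto _).comp (kerK_tendsto hx)
end B1S

section B2S

/-- regularised energy concentrated near the level `a` -/
def GI (n : ℕ) (Ω : Set (Euc n)) (U : ℝ × Euc n → Euc n) (s : ℝ) (a : Euc n) (m : ℕ) : ℝ≥0∞ :=
  ∫⁻ p, ENNReal.ofReal (kerX n (1 / ((m : ℝ) + 1)) a (U p)) * ‖fderiv ℝ U p‖ₑ ^ n
    ∂((volume.restrict (Set.Ioc 0 s)).prod (volume.restrict Ω))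

/-- the dominating function -/
def GG (n : ℕ) (Ω : Set (Euc n)) (U : ℝ × Euc n → Euc n) (s : ℝ) (a : Euc n) : ℝ≥0∞ :=
  ENNReal.ofReal (n * (n * n.factorial)) * liminf (fun m => GI n Ω U s a m) atTop

lemma GI_joint {n : ℕ} {U : ℝ × Euc n → Euc n} (hU : Measurable U) (ε : ℝ) :
    Measurable fun q : Euc n × (ℝ × Euc n) =>
      ENNReal.ofReal (kerX n ε q.1 (U q.2)) * ‖fderiv ℝ U q.2‖ₑ ^ n := by
  have h1 : Measurable fun q : Euc n × (ℝ × Euc n) => kerX n ε q.1 (U q.2) := by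
    unfold kerX; fun_prop
  have h2 : Measurable fun q : Euc n × (ℝ × Euc n) => ‖fderiv ℝ U q.2‖ₑ :=
    ((measurable_fderiv ℝ U).comp measurable_snd).enorm
  exact h1.ennreal_ofReal.mul (h2.pow_const n)

lemma GI_meas {n : ℕ} (Ω : Set (Euc n)) {U : ℝ × Euc n → Euc n} (hU : Measurable U) (s : ℝ) (m : ℕ) :
    Measurable fun a => GI n Ω U s a m :=
  (GI_joint hU (1 / ((m : ℝ) + 1))).lintegral_prod_right'

lemma GG_meas {n : ℕ} (Ω : Set (Euc n)) {U : ℝ × Euc n → Euc n} (hU : Measurable U) (s : ℝ) :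
    Measurable (GG n Ω U s) :=
  (Measurable.liminf fun m => GI_meas Ω hU s m).const_mul _

lemma GI_int {n : ℕ} (Ω : Set (Euc n)) {U : ℝ × Euc n → Euc n} (hU : Measurable U) (s : ℝ) (m : ℕ) :
    ∫⁻ a, GI n Ω U s a m = (∫⁻ z, ENNReal.ofReal (kerX n 1 0 z)) *
      ∫⁻ p, ‖fderiv ℝ U p‖ₑ ^ n ∂((volume.restrict (Set.Ioc 0 s)).prod (volume.restrict Ω)) := by
  unfold GI
  have sw := lintegral_lintegral_swap (μ := (volume : Measure (Euc n)))
      (ν := ((volume.restrict (Set.Ioc (0:ℝ) s)).prod (volume.restrict Ω)))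
      (f := fun a p => ENNReal.ofReal (kerX n (1 / ((m : ℝ) + 1)) a (U p)) * ‖fderiv ℝ U p‖ₑ ^ n)
      (GI_joint hU (1 / ((m : ℝ) + 1))).aemeasurable
  rw [sw]
  have h2 : Measurable fun p : ℝ × Euc n => ‖fderiv ℝ U p‖ₑ ^ n :=
    (measurable_fderiv ℝ U).enorm.pow_const n
  rw [← lintegral_const_mul _ h2]
  refine lintegral_congr fun p => ?_
  rw [lintegral_mul_const, kerX_lintegral (by positivity)]
  unfold kerX; fun_prop

lemma GG_int {n : ℕ} (Ω : Set (Euc n)) {U : ℝ × Euc n → Euc n} (hU : Measurable U) (s : ℝ) :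
    ∫⁻ a, GG n Ω U s a ≤ ENNReal.ofReal (n * (n * n.factorial)) *
      ((∫⁻ z, ENNReal.ofReal (kerX n 1 0 z)) *
      ∫⁻ p, ‖fderiv ℝ U p‖ₑ ^ n ∂((volume.restrict (Set.Ioc 0 s)).prod (volume.restrict Ω))) := by
  unfold GG
  rw [lintegral_const_mul' _ _ ENNReal.ofReal_ne_top]
  gcongr
  refine (lintegral_liminf_le fun m => GI_meas Ω hU s m).trans ?_
  simp only [GI_int Ω hU, liminf_const, le_refl]

lemma GG_key {n : ℕ} (hn : 2 ≤ n) {T : ℝ} {Ω : Set (Euc n)} (hΩ : MeasurableSet Ω)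
    {U : ℝ × Euc n → Euc n} (hUm : Measurable U)
    (hU : ContDiffOn ℝ 2 U (Set.Ioo 0 T ×ˢ Set.univ))
    {t₁ t₂ s : ℝ} (h₁ : t₁ ∈ Set.Ioo 0 T) (h₂ : t₂ ∈ Set.Ioo 0 T) (h1s : t₁ ≤ s) (h2s : t₂ ≤ s)
    {a : Euc n} (ha₁ : ∫⁻ x in Ω, (‖U (t₁, x) - a‖ₑ ^ (n - 1))⁻¹ < ∞)
    (ha₂ : ∫⁻ x in Ω, (‖U (t₂, x) - a‖ₑ ^ (n - 1))⁻¹ < ∞)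
    (ψ : Euc n → ℝ) (hψ : Cc1 n Ω ψ) {M : ℝ} (hM0 : 0 < M)
    (hM : ∀ x i, |fderiv ℝ ψ x (EuclideanSpace.single i 1)| ≤ M) :
    ENNReal.ofReal |jpairOn n Ω (proj n (fun x => U (t₁, x)) a) ψ
      - jpairOn n Ω (proj n (fun x => U (t₂, x)) a) ψ| ≤ ENNReal.ofReal M * GG n Ω U s a := by
  have hreg : ∀ t ∈ Set.Ioo 0 T, ∀ K : Euc n → Euc n, regP n U K ψ t =
      ∫ x, kInt n (fun x => U (t, x)) ψ x (K (U (t, x))) := by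
    intro t ht K
    simp only [regP, kInt, jacMat_slice U hU ht]
  have c₁ := (good_conv hn hΩ ((slice_contDiff U hU h₁).of_le (by norm_num)) ha₁ hψ).2
  have c₂ := (good_conv hn hΩ ((slice_contDiff U hU h₂).of_le (by norm_num)) ha₂ hψ).2
  have c := ENNReal.tendsto_ofReal (c₂.sub c₁).abs
  have e : |jpairOn n Ω (proj n (fun x => U (t₁, x)) a) ψ
      - jpairOn n Ω (proj n (fun x => U (t₂, x)) a) ψ| = 
      |(∫ x in Ω, jPair n (proj n (fun x => U (t₂, x)) a) ψ x) -
        ∫ x in Ω, jPair n (proj n (fun x => U (t₁, x)) a) ψ x| := by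
    unfold jpairOn; congr 1; ring
  rw [e, ← c.liminf_eq, GG, ← mul_assoc, ← ENNReal.ofReal_mul hM0.le]
  have hn0 : (0 : ℝ) < n := by positivity
  have hpos : 0 < M * (n * (n * n.factorial)) := by positivity
  rw [← ENNReal.liminf_const_mul_of_ne_zero_of_ne_top (by simpa using hpos) ENNReal.ofReal_ne_top]
  refine liminf_le_liminf (Eventually.of_forall fun m => ?_)
  have hε : (0 : ℝ) < 1 / ((m : ℝ) + 1) := by positivity
  have := regP_bound hn Ω U hUm hU (kerK n (1 / ((m : ℝ) + 1)) a) (kerX n (1 / ((m : ℝ) + 1)) a)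
    (kerK_contDiff hε a) (kerX_contDiff hε a) (kerX_nonneg n _ a) (kerK_div hn hε a) h₁ h₂ h1s h2s
    ψ hψ M hM
  rw [hreg _ h₁, hreg _ h₂] at this
  exact this

lemma E_tendsto {n : ℕ} {Ω : Set (Euc n)} (hΩ : volume Ω ≠ ∞)
    {f : ℝ × Euc n → ℝ≥0∞}
    (hf : ∫⁻ p, f p ∂((volume.restrict (Set.Ioi 0)).prod volume) < ∞)
    {t : ℕ → ℝ} (htlim : Tendsto t atTop (𝓝 0)) :
    Tendsto (fun k => ∫⁻ p, f p
      ∂((volume.restrict (Set.Ioc 0 (t k))).prod (volume.restrict Ω))) atTop (𝓝 0) := by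
  have hmu : ∀ k, ((volume.restrict (Set.Ioc 0 (t k))).prod (volume.restrict Ω)) =
      ((volume.restrict (Set.Ioi (0:ℝ))).prod (volume : Measure (Euc n))).restrict
        (Set.Ioc 0 (t k) ×ˢ Ω) := by
    intro k
    rw [← Measure.prod_restrict, Measure.restrict_restrict_of_subset Set.Ioc_subset_Ioi_self]
  simp_rw [hmu]
  refine tendsto_setLIntegral_zero hf.ne ?_
  have : Tendsto (fun k => ENNReal.ofReal (t k) * volume Ω) atTop (𝓝 0) := by
    have := ENNReal.Tendsto.mul_const (ENNReal.tendsto_ofReal htlim) (Or.inr hΩ)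
    simpa using this
  refine tendsto_of_tendsto_of_tendsto_of_le_of_le tendsto_const_nhds this (fun _ => zero_le) ?_
  intro k
  simp only [Function.comp, Measure.prod_prod]
  gcongr
  refine (Measure.restrict_le_self _).trans ?_
  simp

end B2S

section B3S

/-- the space of test functions as a submodule -/
def CcSub (n : ℕ) (Ω : Set (Euc n)) : Submodule ℝ (Euc n → ℝ) where
  carrier := {ψ | Cc1 n Ω ψ}
  zero_mem' := by
    refine ⟨contDiff_const, HasCompactSupport.zero, ?_⟩
    simp [tsupport]
  add_mem' := by
    rintro φ ψ ⟨h1, h2, h3⟩ ⟨k1, k2, k3⟩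
    exact ⟨h1.add k1, h2.add k2, (tsupport_add φ ψ).trans (Set.union_subset h3 k3)⟩
  smul_mem' := by
    rintro c ψ ⟨k1, k2, k3⟩
    refine ⟨contDiff_const.mul k1, k2.smul_left (f := fun _ => c), ?_⟩
    exact (tsupport_smul_subset_right (fun _ => c) ψ).trans k3

lemma wm_est {n : ℕ} {Ω : Set (Euc n)} {S T : Euc n → (Euc n → ℝ) → ℝ} {g : Euc n → ℝ≥0∞}
    (hg : Measurable g) {ε : ℝ} (hgε : ∫⁻ a, g a < ENNReal.ofReal ε)
    (hS : ∀ a, S a 0 = 0) (hT : ∀ a, T a 0 = 0)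
    (hb : ∀ᵐ a, ∀ ψ, Cc1 n Ω ψ → (∀ x i, |fderiv ℝ ψ x (EuclideanSpace.single i 1)| ≤ 1) →
      ENNReal.ofReal |S a ψ - T a ψ| ≤ g a) :
    dist (∫ a, Wm11dist n Ω (S a) (T a)) 0 < ε := by
  have hfin : ∫⁻ a, g a ≠ ∞ := (hgε.trans ENNReal.ofReal_lt_top).ne
  have hae : ∀ᵐ a, g a < ∞ := ae_lt_top hg hfin
  have hnn : ∀ a, 0 ≤ Wm11dist n Ω (S a) (T a) := by
    intro a
    refine Real.sSup_nonneg' ⟨0, ⟨0, (CcSub n Ω).zero_mem, LipschitzWith.const' _, ?_⟩, le_rfl⟩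
    rw [hS, hT, sub_zero]
  have hle : ∀ᵐ a, Wm11dist n Ω (S a) (T a) ≤ (g a).toReal := by
    filter_upwards [hae, hb] with a ha hb
    refine Real.sSup_le ?_ ENNReal.toReal_nonneg
    rintro r ⟨ψ, hψ, hl, rfl⟩
    refine (le_abs_self _).trans ?_
    rw [← ENNReal.ofReal_le_iff_le_toReal ha.ne]
    refine hb ψ hψ fun x i => ?_
    have h1 := norm_fderiv_le_of_lipschitz ℝ hl (x₀ := x)
    have h2 := (fderiv ℝ ψ x).le_opNorm (EuclideanSpace.single i 1)
    rw [← Real.norm_eq_abs]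
    simpa using h2.trans (by simpa using h1)
  have h1 : ∫ a, Wm11dist n Ω (S a) (T a) ≤ ∫ a, (g a).toReal :=
    integral_mono_of_nonneg (Eventually.of_forall hnn)
      (integrable_toReal_of_lintegral_ne_top hg.aemeasurable hfin) hle
  rw [integral_toReal hg.aemeasurable hae] at h1
  have h2 : (∫⁻ a, g a).toReal < ε := by
    have hε : 0 < ε := by
      by_contra h
      rw [ENNReal.ofReal_of_nonpos (not_lt.1 h)] at hgε
      simp at hgε
    exact (ENNReal.lt_ofReal_iff_toReal_lt hfin).1 hgε
  rw [Real.dist_0_eq_abs, abs_of_nonneg (integral_nonneg hnn)]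
  exact h1.trans_lt h2

lemma cc1_bound {n : ℕ} {Ω : Set (Euc n)} {ψ : Euc n → ℝ} (hψ : Cc1 n Ω ψ) :
    ∃ M : ℝ, 0 < M ∧ ∀ x i, |fderiv ℝ ψ x (EuclideanSpace.single i 1)| ≤ M := by
  obtain ⟨C, hC⟩ := (hψ.2.1.fderiv (𝕜 := ℝ)).exists_bound_of_continuous
    (hψ.1.continuous_fderiv (by norm_num))
  refine ⟨max C 1, by positivity, fun x i => ?_⟩
  have h2 := (fderiv ℝ ψ x).le_opNorm (EuclideanSpace.single i 1)
  rw [← Real.norm_eq_abs]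
  exact (h2.trans (by simpa using hC x)).trans (le_max_left _ _)

lemma abstract_limit {n : ℕ} {Ω : Set (Euc n)} {J : ℕ → (Euc n → ℝ) → ℝ} {G : ℕ → ℝ≥0∞}
    (hG : ⨅ N, G N = 0)
    (hadd : ∀ k φ ψ, Cc1 n Ω φ → Cc1 n Ω ψ → J k (φ + ψ) = J k φ + J k ψ)
    (hsmul : ∀ k (c : ℝ) ψ, Cc1 n Ω ψ → J k (c • ψ) = c * J k ψ)
    (hb : ∀ N k l, N ≤ k → N ≤ l → ∀ ψ, Cc1 n Ω ψ → ∀ M : ℝ, 0 < M →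
      (∀ x i, |fderiv ℝ ψ x (EuclideanSpace.single i 1)| ≤ M) →
      ENNReal.ofReal |J k ψ - J l ψ| ≤ ENNReal.ofReal M * G N) :
    ∃ T : (Euc n → ℝ) →ₗ[ℝ] ℝ, ∀ ψ, Cc1 n Ω ψ → Tendsto (fun k => J k ψ) atTop (𝓝 (T ψ)) := by
  have hlim : ∀ ψ : CcSub n Ω, ∃ L, Tendsto (fun k => J k ψ) atTop (𝓝 L) := by
    rintro ⟨ψ, hψ⟩
    obtain ⟨M, hM0, hM⟩ := cc1_bound hψ
    apply cauchySeq_tendsto_of_complete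
    rw [Metric.cauchySeq_iff]
    intro ε hε
    have hpos : (⨅ N, G N) < ENNReal.ofReal (ε / M) := by
      rw [hG]; simpa using div_pos hε hM0
    obtain ⟨N, hN⟩ := iInf_lt_iff.1 hpos
    refine ⟨N, fun k hk l hl => ?_⟩
    have h1 := hb N k l hk hl ψ hψ M hM0 hM
    have h2 : ENNReal.ofReal M * G N < ENNReal.ofReal ε := by
      calc _ < ENNReal.ofReal M * ENNReal.ofReal (ε / M) :=
            ENNReal.mul_lt_mul_right (by simpa using hM0) ENNReal.ofReal_ne_top hN
        _ = _ := by rw [← ENNReal.ofReal_mul hM0.le]; congr 1; field_simp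
    rw [Real.dist_eq]
    exact (ENNReal.ofReal_lt_ofReal_iff hε).1 (h1.trans_lt h2)
  choose L hL using hlim
  let T0 : CcSub n Ω →ₗ[ℝ] ℝ :=
    { toFun := L
      map_add' := by
        intro φ ψ
        refine tendsto_nhds_unique (hL (φ + ψ)) (((hL φ).add (hL ψ)).congr fun k => ?_)
        exact (hadd k φ ψ φ.2 ψ.2).symm
      map_smul' := by
        intro c ψ
        refine tendsto_nhds_unique (hL (c • ψ)) (((hL ψ).const_mul c).congr fun k => ?_)
        exact (hsmul k c ψ ψ.2).symm }
  obtain ⟨T, hT⟩ := T0.exists_extend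
  refine ⟨T, fun ψ hψ => ?_⟩
  have : T ψ = L ⟨ψ, hψ⟩ := by
    have := LinearMap.congr_fun hT ⟨ψ, hψ⟩
    simpa [T0] using this
  rw [this]
  exact hL ⟨ψ, hψ⟩

lemma abstract_main {n : ℕ} {Ω : Set (Euc n)} {J : ℕ → Euc n → (Euc n → ℝ) → ℝ}
    {G : ℕ → Euc n → ℝ≥0∞} (hGm : ∀ N, Measurable (G N))
    (hG : Tendsto (fun N => ∫⁻ a, G N a) atTop (𝓝 0))
    (hJ0 : ∀ k a, J k a 0 = 0)
    (hadd : ∀ᵐ a, ∀ k φ ψ, Cc1 n Ω φ → Cc1 n Ω ψ → J k a (φ + ψ) = J k a φ + J k a ψ)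
    (hsmul : ∀ᵐ a, ∀ k (c : ℝ) ψ, Cc1 n Ω ψ → J k a (c • ψ) = c * J k a ψ)
    (hb : ∀ᵐ a, ∀ N k l, N ≤ k → N ≤ l → ∀ ψ, Cc1 n Ω ψ → ∀ M : ℝ, 0 < M →
      (∀ x i, |fderiv ℝ ψ x (EuclideanSpace.single i 1)| ≤ M) →
      ENNReal.ofReal |J k a ψ - J l a ψ| ≤ ENNReal.ofReal M * G N a) :
    Tendsto (fun kl : ℕ × ℕ => ∫ a : Euc n, Wm11dist n Ω (J kl.1 a) (J kl.2 a)) atTop (𝓝 0) ∧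
    ∃ T : Euc n → (Euc n → ℝ) → ℝ, (∀ a, IsLinearMap ℝ (T a)) ∧
      Tendsto (fun k => ∫ a : Euc n, Wm11dist n Ω (J k a) (T a)) atTop (𝓝 0) := by
  have hex : ∀ ε : ℝ, 0 < ε → ∃ N, ∫⁻ a, G N a < ENNReal.ofReal ε := fun ε hε =>
    (hG.eventually_lt_const (by simpa using hε)).exists
  constructor
  · rw [Metric.tendsto_atTop]
    intro ε hε
    obtain ⟨N, hN⟩ := hex ε hε
    refine ⟨(N, N), fun kl hkl => wm_est (hGm N) hN (hJ0 _) (hJ0 _) ?_⟩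
    filter_upwards [hb] with a ha ψ hψ hM
    simpa using ha N kl.1 kl.2 hkl.1 hkl.2 ψ hψ 1 one_pos hM
  · have hinf : ∀ᵐ a, ⨅ N, G N a = 0 := by
      have : ∫⁻ a, ⨅ N, G N a = 0 := by
        refine le_antisymm (ge_of_tendsto' hG fun N => lintegral_mono fun a => iInf_le _ N) zero_le
      exact (lintegral_eq_zero_iff (Measurable.iInf hGm)).1 this
    let P : Euc n → ((Euc n → ℝ) →ₗ[ℝ] ℝ) → Prop := fun a T =>
      ∀ ψ, Cc1 n Ω ψ → Tendsto (fun k => J k a ψ) atTop (𝓝 (T ψ))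
    have hP : ∀ a, ∃ T, (∃ T', P a T') → P a T := by
      intro a
      by_cases h : ∃ T', P a T'
      · obtain ⟨T', h'⟩ := h; exact ⟨T', fun _ => h'⟩
      · exact ⟨0, fun h' => (h h').elim⟩
    choose T hT using hP
    refine ⟨fun a => T a, fun a => (T a).isLinear, ?_⟩
    rw [Metric.tendsto_atTop]
    intro ε hε
    obtain ⟨N, hN⟩ := hex ε hε
    refine ⟨N, fun k hk => wm_est (hGm N) hN (hJ0 _) (fun a => map_zero _) ?_⟩
    filter_upwards [hinf, hadd, hsmul, hb] with a h1 h2 h3 h4 ψ hψ hM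
    have h5 := hT a (abstract_limit h1 h2 h3 h4) ψ hψ
    have h6 := ENNReal.tendsto_ofReal ((tendsto_const_nhds (x := J k a ψ)).sub h5).abs
    refine le_of_tendsto h6 ?_
    filter_upwards [eventually_ge_atTop N] with l hl
    simpa using h4 N k l hk hl ψ hψ 1 one_pos hM

lemma jPair_add {n : ℕ} (v : Euc n → Euc n) {φ ψ : Euc n → ℝ} (h1 : ContDiff ℝ 1 φ)
    (h2 : ContDiff ℝ 1 ψ) (x : Euc n) : jPair n v (φ + ψ) x = jPair n v φ x + jPair n v ψ x := by
  unfold jPair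
  rw [fderiv_add (h1.differentiable (by norm_num) x) (h2.differentiable (by norm_num) x),
    ← Finset.sum_add_distrib]
  exact Finset.sum_congr rfl fun i _ => by rw [add_apply]; ring

lemma jPair_smul {n : ℕ} (v : Euc n → Euc n) (c : ℝ) {ψ : Euc n → ℝ}
    (h2 : ContDiff ℝ 1 ψ) (x : Euc n) : jPair n v (c • ψ) x = c * jPair n v ψ x := by
  unfold jPair
  rw [fderiv_const_smul (h2.differentiable (by norm_num) x), Finset.mul_sum]
  exact Finset.sum_congr rfl fun i _ => by rw [smul_apply, smul_eq_mul]; ring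

lemma jPair_zero {n : ℕ} (v : Euc n → Euc n) (x : Euc n) : jPair n v 0 x = 0 := by
  have := jPair_smul v 0 (ψ := 0) contDiff_const x
  simpa using this

theorem main_thm
    (n : ℕ) (hn : 2 ≤ n) (Ω : Set (Euc n)) (hΩo : IsOpen Ω)
    (hΩb : Bornology.IsBounded Ω)
    (ut : Euc n → Euc n) (hut : MemWsp n (((n : ℝ) - 1) / n) n Set.univ ut)
    (η : Euc n → ℝ) (hη₁ : ContDiff ℝ (⊤ : ℕ∞) η) (hη₂ : HasCompactSupport η)
    (hη₃ : (∫ x, η x) = 1)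
    (t : ℕ → ℝ) (ht₀ : ∀ k, 0 < t k) (htanti : StrictAnti t)
    (htlim : Tendsto t atTop (𝓝 0))
    (uk : ℕ → Euc n → Euc n)
    (huk : ∀ k x, uk k x = ∫ y, ((t k ^ n)⁻¹ * η ((t k)⁻¹ • y)) • ut (x - y)) :
    (∀ᵐ a : Euc n, ∀ k, ∀ ψ : Euc n → ℝ, Cc1 n Ω ψ →
        IntegrableOn (fun x => jPair n (proj n (uk k) a) ψ x) Ω) ∧
    Tendsto
      (fun kl : ℕ × ℕ => ∫ a : Euc n,
        Wm11dist n Ω (fun ψ => jpairOn n Ω (proj n (uk kl.1) a) ψ)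
          (fun ψ => jpairOn n Ω (proj n (uk kl.2) a) ψ))
      atTop (𝓝 0) ∧
    ∃ T : Euc n → (Euc n → ℝ) → ℝ, (∀ a, IsLinearMap ℝ (T a)) ∧
      Tendsto
        (fun k => ∫ a : Euc n,
          Wm11dist n Ω (fun ψ => jpairOn n Ω (proj n (uk k) a) ψ) (T a))
        atTop (𝓝 0) := by
  have hΩm := hΩo.measurableSet
  have hΩv : volume Ω ≠ ∞ := hΩb.measure_lt_top.ne
  obtain ⟨R, hR0, hR⟩ : ∃ R : ℝ, 0 < R ∧ ∀ z, R < ‖z‖ → η z = 0 := by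
    obtain ⟨R, hR⟩ := hη₂.isCompact.isBounded.subset_closedBall (0 : Euc n)
    refine ⟨max R 1, by positivity, fun z hz => image_eq_zero_of_notMem_tsupport fun h => ?_⟩
    have := hR h
    rw [mem_closedBall_zero_iff] at this
    exact absurd (lt_of_le_of_lt (le_max_left R 1) hz) (not_lt.2 this)
  obtain ⟨w, hwm, hw, hwl, hwE⟩ := wsp_rep hn hut
  set U := molU n η w with hUdef
  have hUm : Measurable U := molU_measurable hη₁.continuous hwm
  have hU : ContDiffOn ℝ 2 U (Set.Ioo 0 (t 0 + 1) ×ˢ Set.univ) := molU_contDiffOn hη₁ hR0 hR hwl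
  have hE := energy_fin hn hη₁ hη₃ hR0 hR hwm hwl hwE
  have htI : ∀ k, t k ∈ Set.Ioo 0 (t 0 + 1) := fun k =>
    ⟨ht₀ k, lt_of_le_of_lt (htanti.antitone (Nat.zero_le k)) (lt_add_one _)⟩
  have hukU : uk = fun k x => U (t k, x) := by
    funext k x; rw [huk, molU_uk hw]
  subst hukU
  have hC : ∀ k, ContDiff ℝ 1 (fun x => U (t k, x)) := fun k =>
    (slice_contDiff U hU (htI k)).of_le (by norm_num)
  have hgood : ∀ᵐ a : Euc n, ∀ k, ∫⁻ x in Ω, (‖U (t k, x) - a‖ₑ ^ (n - 1))⁻¹ < ∞ :=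
    ae_all_iff.2 fun k => good_ae hn hΩv (hC k).continuous.measurable
  have hintg : ∀ᵐ a : Euc n, ∀ k, ∀ ψ : Euc n → ℝ, Cc1 n Ω ψ →
        IntegrableOn (fun x => jPair n (proj n (fun x => U (t k, x)) a) ψ x) Ω := by
    filter_upwards [hgood] with a ha k ψ hψ
    exact (good_conv hn hΩm (hC k) (ha k) hψ).1
  refine ⟨hintg, abstract_main (J := fun k a ψ => jpairOn n Ω (proj n (fun x => U (t k, x)) a) ψ)
    (G := fun N => GG n Ω U (t N)) (fun N => GG_meas Ω hUm _) ?_ ?_ ?_ ?_ ?_⟩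
  · have h1 := E_tendsto hΩv hE htlim
    have h2 := ENNReal.Tendsto.const_mul (a := ENNReal.ofReal (n * (n * n.factorial)))
      (ENNReal.Tendsto.const_mul (a := ∫⁻ z, ENNReal.ofReal (kerX n 1 0 z)) h1
        (Or.inr (kerX_lintegral_one n).ne)) (Or.inr ENNReal.ofReal_ne_top)
    rw [mul_zero, mul_zero] at h2
    exact tendsto_of_tendsto_of_tendsto_of_le_of_le tendsto_const_nhds h2 (fun _ => zero_le)
      fun N => GG_int Ω hUm (t N)
  · intro k a
    simp [jpairOn, jPair_zero]
  · filter_upwards [hintg] with a ha k φ ψ hφ hψ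
    simp only [jpairOn, jPair_add _ hφ.1 hψ.1]
    rw [integral_add (ha k φ hφ) (ha k ψ hψ), neg_add]
  · filter_upwards with a k c ψ hψ
    simp only [jpairOn, jPair_smul _ c hψ.1]
    rw [integral_const_mul, mul_neg]
  · filter_upwards [hgood] with a ha N k l hk hl ψ hψ M hM0 hM
    exact GG_key hn hΩm hUm hU (htI k) (htI l) (htanti.antitone hk) (htanti.antitone hl)
      (ha k) (ha l) ψ hψ hM0 hM

end B3S

/-- (Lemma on `Ju_k^a` limits.) For the mollified maps `u_k = η_{t_k} * ũ`,
the maps `a ↦ Ju_k^a` form a Cauchy sequence in `L¹(ℝⁿ; W^{-1,1}(Ω))`, and hence converge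
to a family of distributions `(T^a)`. -/
theorem jacobian_mollified_cauchy
    (n : ℕ) (hn : 2 ≤ n) (Ω : Set (Euc n)) (hΩo : IsOpen Ω)
    (hΩb : Bornology.IsBounded Ω) (hΩs : SmoothBoundary n Ω)
    (u : Euc n → Euc n) (hu : MemWsp n (((n : ℝ) - 1) / n) n Ω u)
    (ut : Euc n → Euc n) (hut : MemWsp n (((n : ℝ) - 1) / n) n Set.univ ut)
    (hagree : ∀ᵐ x ∂(volume.restrict Ω), ut x = u x)
    (η : Euc n → ℝ) (hη₁ : ContDiff ℝ (⊤ : ℕ∞) η) (hη₂ : HasCompactSupport η)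
    (hη₃ : (∫ x, η x) = 1)
    (t : ℕ → ℝ) (ht₀ : ∀ k, 0 < t k) (htanti : StrictAnti t)
    (htlim : Tendsto t atTop (𝓝 0))
    (uk : ℕ → Euc n → Euc n)
    (huk : ∀ k x, uk k x = ∫ y, ((t k ^ n)⁻¹ * η ((t k)⁻¹ • y)) • ut (x - y)) :
    (∀ᵐ a : Euc n, ∀ k, ∀ ψ : Euc n → ℝ, Cc1 n Ω ψ →
        IntegrableOn (fun x => jPair n (proj n (uk k) a) ψ x) Ω) ∧
    Tendsto
      (fun kl : ℕ × ℕ => ∫ a : Euc n,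
        Wm11dist n Ω (fun ψ => jpairOn n Ω (proj n (uk kl.1) a) ψ)
          (fun ψ => jpairOn n Ω (proj n (uk kl.2) a) ψ))
      atTop (𝓝 0) ∧
    ∃ T : Euc n → (Euc n → ℝ) → ℝ, (∀ a, IsLinearMap ℝ (T a)) ∧
      Tendsto
        (fun k => ∫ a : Euc n,
          Wm11dist n Ω (fun ψ => jpairOn n Ω (proj n (uk k) a) ψ) (T a))
        atTop (𝓝 0) := by
  exact main_thm n hn Ω hΩo hΩb ut hut η hη₁ hη₂ hη₃ t ht₀ htanti htlim uk huk

end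
end
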